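/- arXiv:1511.05088 — 4 statements merged into one kernel-verified Lean document; each statement's English description precedes it below -/
import Mathlib

section
/- Let G be a nontrivial finitely generated group equipped with a bi-invariant linear order <, and let φ : G → G be a group automorphism that preserves < (g < h implies φ(g) < φ(h)). Let V = ℚ ⊗_ℤ G^{ab} be the rationalization of the abelianization of G, a finite-dimensional ℚ-vector space, and let φ_* : V → V be the ℚ-linear map induced by φ. Then φ has a positive eigenvalue: the characteristic polynomial of φ_*, viewed as a real polynomial, has a positive real root. -/
open scoped TensorProduct

section helpers

variable {G : Type*} [Group G] [LinearOrder G] [MulLeftMono G] [MulRightMono G]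

theorem aux_exists_bound [Nontrivial G] (hfg : Group.FG G) :
    ∃ a : G, 1 < a ∧ ∀ g : G, ∃ n : ℕ, g ≤ a ^ n ∧ g⁻¹ ≤ a ^ n := by
  obtain ⟨S, hS, hfin⟩ := (Group.fg_iff (G := G)).1 hfg
  obtain ⟨x, hx⟩ : ∃ x : G, 1 < x := by
    obtain ⟨y, hy⟩ := exists_ne (1 : G)
    rcases lt_or_gt_of_ne hy with h | h
    · exact ⟨y⁻¹, one_lt_inv'.2 h⟩
    · exact ⟨y, h⟩
  obtain ⟨a, ha⟩ := ((hfin.union (hfin.image (fun s => s⁻¹))).union (Set.finite_singleton x)).bddAbove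
  have hxa : x ≤ a := ha (by simp)
  have h1 : 1 < a := hx.trans_le hxa
  refine ⟨a, h1, fun g => ?_⟩
  have hg : g ∈ Subgroup.closure S := by rw [hS]; trivial
  induction hg using Subgroup.closure_induction with
  | mem s hs =>
    refine ⟨1, ?_, ?_⟩
    · rw [pow_one]; exact ha (Or.inl (Or.inl hs))
    · rw [pow_one]; exact ha (Or.inl (Or.inr ⟨s, hs, rfl⟩))
  | one => exact ⟨0, by simp, by simp⟩
  | mul g h _ _ ihg ihh =>
    obtain ⟨m, h1, h2⟩ := ihg
    obtain ⟨n, h3, h4⟩ := ihh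
    refine ⟨m + n, ?_, ?_⟩
    · rw [pow_add]; exact mul_le_mul' h1 h3
    · rw [add_comm, pow_add, mul_inv_rev]; exact mul_le_mul' h4 h2
  | inv g _ ih =>
    obtain ⟨m, h1, h2⟩ := ih
    exact ⟨m, h2, by simpa using h1⟩

theorem aux_strict {a : G} (h1 : 1 < a) : StrictMono (fun n : ℤ => a ^ n) :=
  strictMono_int_of_lt_succ fun n => by
    rw [zpow_add_one]; exact lt_mul_of_one_lt_right' _ h1

theorem aux_zpow_le {a : G} (h1 : 1 < a) {m n : ℤ} : a ^ m ≤ a ^ n ↔ m ≤ n :=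
  (aux_strict h1).le_iff_le

theorem aux_zpow_lt {a : G} (h1 : 1 < a) {m n : ℤ} : a ^ m < a ^ n ↔ m < n :=
  (aux_strict h1).lt_iff_lt

theorem aux_floor {a : G} (h1 : 1 < a) (hb : ∀ g : G, ∃ n : ℕ, g ≤ a ^ n ∧ g⁻¹ ≤ a ^ n) (g : G) :
    ∃ m : ℤ, a ^ m ≤ g ∧ g < a ^ (m + 1) := by
  obtain ⟨n, hn1, hn2⟩ := hb g
  obtain ⟨m, hm, hm'⟩ := Int.exists_greatest_of_bdd (P := fun m : ℤ => a ^ m ≤ g)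
    ⟨n, fun z hz => by
      rw [← aux_zpow_le h1]; exact le_trans hz (by simpa using hn1)⟩
    ⟨-n, by
      rw [zpow_neg, zpow_natCast]; exact inv_le_of_inv_le' hn2⟩
  refine ⟨m, hm, ?_⟩
  by_contra hc
  have := hm' (m + 1) (not_lt.1 hc)
  omega

theorem aux_comm_pow {g h : G} (hgh : h * g ≤ g * h) (n : ℕ) : h ^ n * g ≤ g * h ^ n := by
  induction n with
  | zero => simp
  | succ n ih =>
    calc h ^ (n + 1) * g = h ^ n * (h * g) := by rw [pow_succ, mul_assoc]
      _ ≤ h ^ n * (g * h) := mul_le_mul_right hgh _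
      _ = h ^ n * g * h := by rw [mul_assoc]
      _ ≤ g * h ^ n * h := mul_le_mul_left ih _
      _ = g * h ^ (n + 1) := by rw [pow_succ, mul_assoc]

theorem aux_pow_upper {g h : G} (hgh : h * g ≤ g * h) (n : ℕ) : (g * h) ^ n ≤ g ^ n * h ^ n := by
  induction n with
  | zero => simp
  | succ n ih =>
    calc (g * h) ^ (n + 1) = (g * h) ^ n * (g * h) := pow_succ _ _
      _ ≤ g ^ n * h ^ n * (g * h) := mul_le_mul_left ih _
      _ = g ^ n * (h ^ n * g) * h := by simp only [mul_assoc]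
      _ ≤ g ^ n * (g * h ^ n) * h := mul_le_mul_left (mul_le_mul_right (aux_comm_pow hgh n) _) _
      _ = g ^ (n + 1) * h ^ (n + 1) := by simp only [pow_succ, mul_assoc]

theorem aux_pow_lower {g h : G} (hgh : h * g ≤ g * h) (n : ℕ) : h ^ n * g ^ n ≤ (h * g) ^ n := by
  induction n with
  | zero => simp
  | succ n ih =>
    calc h ^ (n + 1) * g ^ (n + 1) = h * (h ^ n * g) * g ^ n := by simp only [pow_succ', ← mul_assoc]
      _ ≤ h * (g * h ^ n) * g ^ n := mul_le_mul_left (mul_le_mul_right (aux_comm_pow hgh n) _) _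
      _ = (h * g) * (h ^ n * g ^ n) := by simp only [mul_assoc]
      _ ≤ (h * g) * (h * g) ^ n := mul_le_mul_right ih _
      _ = (h * g) ^ (n + 1) := (pow_succ' _ _).symm

open Filter Topology in
theorem aux_exists_hom [Nontrivial G] (hfg : Group.FG G) (φ : G ≃* G) (hφ : Monotone φ) :
    ∃ (H : G → ℝ) (a : G) (l : ℝ), (∀ g h, H (g * h) = H g + H h) ∧ H a ≠ 0 ∧ 0 < l ∧
      ∀ g, H (φ g) = l * H g := by
  obtain ⟨a, h1, hb⟩ := aux_exists_bound hfg
  choose F hF1 hF2 using aux_floor h1 hb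
  have hle : ∀ {m : ℤ} {g : G}, a ^ m ≤ g → m ≤ F g := fun {m g} h => by
    have := (aux_zpow_lt h1).1 (h.trans_lt (hF2 g)); omega
  have hlt : ∀ {m : ℤ} {g : G}, g < a ^ m → F g < m := fun {m g} h =>
    (aux_zpow_lt h1).1 ((hF1 g).trans_lt h)
  have hmono : Monotone F := fun g h hgh => hle ((hF1 g).trans hgh)
  have hlow : ∀ g h, F g + F h ≤ F (g * h) := fun g h => hle (by
    rw [zpow_add]; exact mul_le_mul' (hF1 g) (hF1 h))
  have hup : ∀ g h, F (g * h) ≤ F g + F h + 1 := fun g h => by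
    have : g * h < a ^ ((F g + 1) + (F h + 1)) := by
      rw [zpow_add]
      exact mul_lt_mul_of_lt_of_lt (hF2 g) (hF2 h)
    have := hlt this
    omega
  have hpow : ∀ g (n : ℕ), F (g ^ n) ≤ n * (F g + 1) := fun g n => by
    have h : g ^ n ≤ a ^ ((n : ℤ) * (F g + 1)) := by
      rw [mul_comm, zpow_mul, zpow_natCast]
      exact pow_le_pow_left' (hF2 g).le n
    exact (aux_zpow_le h1).1 ((hF1 _).trans h)
  have hsub : ∀ g, Subadditive (fun n : ℕ => (-(F (g ^ n)) : ℝ)) := fun g m n => by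
    have := hlow (g ^ m) (g ^ n)
    rw [← pow_add] at this
    have : ((F (g ^ m) : ℝ)) + F (g ^ n) ≤ F (g ^ (m + n)) := by exact_mod_cast this
    linarith
  have hlim : ∀ g, ∃ y : ℝ, Tendsto (fun n : ℕ => (F (g ^ n) : ℝ) / n) atTop (𝓝 y) := fun g => by
    have := (hsub g).tendsto_lim ⟨min 0 (-(F g + 1 : ℝ)), by
      rintro _ ⟨n, rfl⟩
      rcases Nat.eq_zero_or_pos n with rfl | hn
      · simp
      · refine (min_le_right _ _).trans ?_
        have hn' : (0 : ℝ) < n := by exact_mod_cast hn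
        rw [le_div_iff₀ hn']
        have : (F (g ^ n) : ℝ) ≤ n * (F g + 1) := by exact_mod_cast hpow g n
        linarith⟩
    refine ⟨_, (this.neg).congr fun n => ?_⟩
    ring
  choose H hH using hlim
  have hinv : Tendsto (fun n : ℕ => (1 : ℝ) / n) atTop (𝓝 0) := tendsto_one_div_atTop_nhds_zero_nat
  -- sandwich uniqueness
  have huniq : ∀ (K : G → ℝ), (∀ g h, K (g * h) = K g + K h) → Monotone K →
      ∀ g, K g = K a * H g := fun K hK hKm g => by
    have hK1 : K 1 = 0 := by have := hK 1 1; simp at this; exact this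
    let KK : Multiplicative ℝ → ℝ := Multiplicative.toAdd
    let K' : G →* Multiplicative ℝ :=
      { toFun := fun g => Multiplicative.ofAdd (K g), map_one' := by simp [hK1], map_mul' := fun x y => by
          simp [hK] }
    have hKz : ∀ (m : ℤ) x, K (x ^ m) = m * K x := fun m x => by
      have := congrArg Multiplicative.toAdd (map_zpow K' x m)
      simpa [K'] using this
    have hKn : ∀ (m : ℕ) x, K (x ^ m) = m * K x := fun m x => by
      have := hKz m x
      simpa using this
    have l1 : Tendsto (fun n : ℕ => K a * ((F (g ^ n) : ℝ) / n)) atTop (𝓝 (K a * H g)) :=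
      (hH g).const_mul _
    have l2 : Tendsto (fun n : ℕ => K a * ((F (g ^ n) : ℝ) / n) + K a * (1 / n)) atTop
        (𝓝 (K a * H g)) := by
      simpa using l1.add (hinv.const_mul (K a))
    apply le_antisymm
    · refine ge_of_tendsto l2 ?_
      filter_upwards [eventually_gt_atTop 0] with n hn
      have hn' : (0 : ℝ) < n := by exact_mod_cast hn
      have := hKm (hF2 (g ^ n)).le
      rw [hKz, hKn] at this
      push_cast at this
      rw [← mul_add, ← add_div, ← mul_div_assoc, le_div_iff₀ hn']
      linarith
    · refine le_of_tendsto l1 ?_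
      filter_upwards [eventually_gt_atTop 0] with n hn
      have hn' : (0 : ℝ) < n := by exact_mod_cast hn
      have := hKm (hF1 (g ^ n))
      rw [hKz, hKn] at this
      rw [← mul_div_assoc, div_le_iff₀ hn']
      linarith
  have hHmono : Monotone H := fun g h hgh => by
    refine le_of_tendsto_of_tendsto' (hH g) (hH h) fun n => ?_
    have : (F (g ^ n) : ℝ) ≤ F (h ^ n) := by exact_mod_cast hmono (pow_le_pow_left' hgh n)
    gcongr
  have key : ∀ g h, h * g ≤ g * h → H (g * h) = H g + H h ∧ H (h * g) = H g + H h := by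
    intro g h hgh
    have s1 : Tendsto (fun n : ℕ => (F (g ^ n) : ℝ) / n + (F (h ^ n) : ℝ) / n) atTop
      (𝓝 (H g + H h)) := (hH g).add (hH h)
    have s2 : Tendsto (fun n : ℕ => (F (g ^ n) : ℝ) / n + (F (h ^ n) : ℝ) / n + 1 / n) atTop
      (𝓝 (H g + H h)) := by simpa using s1.add hinv
    have u : H (g * h) ≤ H g + H h := by
      refine le_of_tendsto_of_tendsto' (hH _) s2 fun n => ?_
      have : (F ((g * h) ^ n) : ℝ) ≤ F (g ^ n) + F (h ^ n) + 1 := by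
        exact_mod_cast (hmono (aux_pow_upper hgh n)).trans (hup _ _)
      rw [← add_div, ← add_div]
      gcongr
    have v : H g + H h ≤ H (h * g) := by
      refine le_of_tendsto_of_tendsto' s1 (hH _) fun n => ?_
      have : (F (h ^ n) : ℝ) + F (g ^ n) ≤ F ((h * g) ^ n) := by
        exact_mod_cast (hlow _ _).trans (hmono (aux_pow_lower hgh n))
      rw [← add_div]
      gcongr
      linarith
    have w := hHmono hgh
    exact ⟨le_antisymm u (v.trans w), le_antisymm (w.trans u) v⟩
  have hadd : ∀ g h, H (g * h) = H g + H h := fun g h => by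
    rcases le_total (h * g) (g * h) with hh | hh
    · exact (key g h hh).1
    · rw [(key h g hh).2, add_comm]
  have hFa : ∀ n : ℕ, F (a ^ n) = n := fun n => by
    have p1 : (n : ℤ) ≤ F (a ^ n) := hle (by simp)
    have p2 : F (a ^ n) < n + 1 := hlt (by
      rw [← zpow_natCast, aux_zpow_lt h1]; omega)
    omega
  have hHa : H a = 1 := by
    refine tendsto_nhds_unique (hH a) (tendsto_const_nhds.congr' ?_)
    filter_upwards [eventually_gt_atTop 0] with n hn
    have hn' : (n : ℝ) ≠ 0 := by exact_mod_cast hn.ne'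
    rw [hFa]
    push_cast
    rw [div_self hn']
  have hu := huniq (fun g => H (φ g)) (fun g h => by simp [hadd]) (hHmono.comp hφ)
  refine ⟨H, a, H (φ a), hadd, by rw [hHa]; exact one_ne_zero, ?_, hu⟩
  have hH1 : H 1 = 0 := by have := hadd 1 1; simp at this; exact this
  have h0 : 0 ≤ H (φ a) := by
    have := hHmono (hφ h1.le)
    rwa [map_one, hH1] at this
  refine lt_of_le_of_ne h0 fun hz => ?_
  have := hu (φ.symm a)
  simp [hHa, ← hz] at this

end helpers



/-- if a nontrivial finitely generated group `G` carries a
bi-invariant linear order preserved by an automorphism `φ`, then the induced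
linear map on `V = ℚ ⊗ G^{ab}` has a positive real eigenvalue: the
characteristic polynomial of `φ_*`, viewed over `ℝ`, has a positive real
root. -/
theorem order_preserving_automorphism_has_positive_eigenvalue
    {G : Type*} [Group G] [Nontrivial G] (hfg : Group.FG G)
    (r : G → G → Prop) (hord : IsStrictTotalOrder G r)
    (hleft : ∀ f g h : G, r g h → r (f * g) (f * h))
    (hright : ∀ f g h : G, r g h → r (g * f) (h * f))
    (φ : G ≃* G) (hφ : ∀ g h : G, r g h → r (φ g) (φ h))
    [Module.Finite ℚ (ℚ ⊗[ℤ] Additive (Abelianization G))] :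
    ∃ x : ℝ, 0 < x ∧
      Polynomial.aeval x
        (LinearMap.charpoly (LinearMap.baseChange ℚ
          (AddMonoidHom.toIntLinearMap
            (MonoidHom.toAdditive (Abelianization.map φ.toMonoidHom))))) = 0 := by
    classical
  letI : LinearOrder G := linearOrderOfSTO r
  have hlt : ∀ x y : G, x < y ↔ r x y := fun _ _ => Iff.rfl
  haveI : MulLeftMono G := ⟨fun f g h hgh => by
    rcases hgh.eq_or_lt with rfl | h'
    · exact le_rfl
    · exact le_of_lt (hleft f g h h')⟩
  haveI : MulRightMono G := ⟨fun f g h hgh => by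
    rcases hgh.eq_or_lt with rfl | h'
    · exact le_rfl
    · exact le_of_lt (hright f g h h')⟩
  have hm : StrictMono φ := fun g h hgh => hφ g h hgh
  obtain ⟨H, a, l, hadd, ha, hl, hHl⟩ := aux_exists_hom hfg φ hm.monotone
  have hH1 : H 1 = 0 := by have := hadd 1 1; simp at this; exact this
  let H' : G →* Multiplicative ℝ :=
    { toFun := fun g => Multiplicative.ofAdd (H g)
      map_one' := by simp [hH1]
      map_mul' := fun x y => by simp [hadd] }
  let A : Additive (Abelianization G) →ₗ[ℤ] ℝ :=
    (MonoidHom.toAdditiveLeft (Abelianization.lift H')).toIntLinearMap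
  let L : ℚ ⊗[ℤ] Additive (Abelianization G) →ₗ[ℚ] ℝ := LinearMap.liftBaseChange ℚ A
  have hA : ∀ g : G, A (Additive.ofMul (Abelianization.of g)) = H g := fun g => rfl
  set T := (LinearMap.baseChange ℚ
          (AddMonoidHom.toIntLinearMap
            (MonoidHom.toAdditive (Abelianization.map φ.toMonoidHom)))) with hT
  have hLT : ∀ v, L (T v) = l * L v := fun v => by
    induction v using TensorProduct.induction_on with
    | zero => simp
    | add x y hx hy => rw [map_add, map_add, map_add, hx, hy, mul_add]
    | tmul q x =>
      obtain ⟨g, rfl⟩ : ∃ g : G, Additive.ofMul (Abelianization.of g) = x :=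
        QuotientGroup.mk_surjective (s := commutator G) x
      have e : T (q ⊗ₜ Additive.ofMul (Abelianization.of g)) =
        q ⊗ₜ Additive.ofMul (Abelianization.of (φ g)) := rfl
      rw [e, LinearMap.liftBaseChange_tmul, LinearMap.liftBaseChange_tmul, hA, hA, hHl,
        mul_smul_comm]
  have hpoly : ∀ (p : Polynomial ℚ) v, L (Polynomial.aeval T p v) = Polynomial.aeval l p * L v := by
    intro p
    induction p using Polynomial.induction_on' with
    | add p q hp hq => intro v; simp [hp, hq, add_mul]
    | monomial n c =>
      intro v
      have hpow : ∀ (n : ℕ) v, L ((T ^ n) v) = l ^ n * L v := fun n => by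
        induction n with
        | zero => intro v; simp
        | succ n ih => intro v; rw [pow_succ, Module.End.mul_apply, ih, hLT]; ring
      simp [Polynomial.aeval_monomial, hpow, Algebra.smul_def, mul_assoc]
  refine ⟨l, hl, ?_⟩
  have h := hpoly T.charpoly (1 ⊗ₜ Additive.ofMul (Abelianization.of a))
  rw [LinearMap.aeval_self_charpoly, LinearMap.zero_apply, map_zero,
    LinearMap.liftBaseChange_tmul, hA, one_smul] at h
  exact (mul_eq_zero.1 h.symm).resolve_right ha
end

section
/- For every n ≥ 2, the Artin braid group B_n — the presented group with generators σ₁, …, σ_{n−1} and relations σᵢσⱼ = σⱼσᵢ whenever |i − j| > 1 and σᵢσⱼσᵢ = σⱼσᵢσⱼ whenever |i − j| = 1 — is left-orderable. -/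
/-- A group is left-orderable if it admits a strict linear order invariant under
left multiplication. -/
def LeftOrderable (G : Type*) [Group G] : Prop :=
  ∃ r : G → G → Prop, IsStrictTotalOrder G r ∧ ∀ f g h : G, r g h → r (f * g) (f * h)

/-- The braid relators on `n - 1` generators `σ₀, …, σ_{n-2}`:
`σᵢσⱼσᵢ⁻¹σⱼ⁻¹` for `|i - j| > 1` and `σᵢσⱼσᵢ(σⱼσᵢσⱼ)⁻¹` for `|i - j| = 1`. -/
def braidRels (n : ℕ) : Set (FreeGroup (Fin (n - 1))) :=
  {w | (∃ i j : Fin (n - 1), 1 < |(i : ℤ) - (j : ℤ)| ∧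
          w = FreeGroup.of i * FreeGroup.of j *
              (FreeGroup.of j * FreeGroup.of i)⁻¹) ∨
       (∃ i j : Fin (n - 1), |(i : ℤ) - (j : ℤ)| = 1 ∧
          w = FreeGroup.of i * FreeGroup.of j * FreeGroup.of i *
              (FreeGroup.of j * FreeGroup.of i * FreeGroup.of j)⁻¹)}

/-- The Artin braid group `B_n`, presented with generators `σ₁, …, σ_{n-1}` and
the braid relations. -/
def BraidGroup (n : ℕ) : Type := PresentedGroup (braidRels n)

instance (n : ℕ) : Group (BraidGroup n) := by
  unfold BraidGroup; infer_instance



namespace BraidLO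

abbrev F := FreeGroup ℕ

/-- the inverse letter -/
def flip (a : ℕ × Bool) : ℕ × Bool := (a.1, !a.2)

/-- numerical code of a letter -/
def cd (a : ℕ × Bool) : ℕ := 2 * a.1 + (if a.2 then 1 else 2)

theorem cd_inj {a b : ℕ × Bool} (h : cd a = cd b) : a = b := by
  obtain ⟨i, x⟩ := a
  obtain ⟨j, y⟩ := b
  cases x <;> cases y <;> simp [cd] at h ⊢ <;> omega

theorem cd_pos (a : ℕ × Bool) : 0 < cd a := by
  unfold cd; split_ifs <;> omega

theorem flip_flip (a : ℕ × Bool) : flip (flip a) = a := by simp [flip]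

def hdc : List (ℕ × Bool) → ℕ
  | [] => 0
  | b :: _ => cd b

def tn (p : ℤ) (b : ℕ) : ℕ ×ₗ ℕ := toLex (if p < b then 0 else 1, b)

def enc : ℤ → List (ℕ × Bool) → List (ℕ ×ₗ ℕ)
  | p, [] => [tn p 0]
  | p, b :: l => tn p (cd b) :: enc (cd (flip b)) l

def tl : List (ℕ × Bool) → List (ℕ ×ₗ ℕ)
  | [] => []
  | b :: l => enc (cd (flip b)) l

theorem enc_eq (p : ℤ) (l) : enc p l = tn p (hdc l) :: tl l := by
  cases l <;> rfl

theorem tn_inj {p : ℤ} {a b : ℕ} (h : tn p a = tn p b) : a = b := by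
  simp [tn] at h; exact h.2

theorem tn_lt {p : ℤ} {a b : ℕ} : tn p a < tn p b ↔
    (p < a ∧ ¬ p < b) ∨ ((p < a ↔ p < b) ∧ a < b) := by
  simp only [tn, Prod.Lex.toLex_lt_toLex]
  split_ifs <;> (simp_all; try grind)

theorem enc_lt {p : ℤ} {l l'} : enc p l < enc p l' ↔
    tn p (hdc l) < tn p (hdc l') ∨ (hdc l = hdc l' ∧ tl l < tl l') := by
  rw [enc_eq, enc_eq, List.cons_lt_cons_iff]
  constructor
  · rintro (h | h)
    · exact Or.inl h
    · exact Or.inr ⟨tn_inj h.1, h.2⟩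
  · rintro (h | h)
    · exact Or.inl h
    · exact Or.inr ⟨by rw [h.1], h.2⟩

theorem enc_inj : ∀ (l l' : List (ℕ × Bool)) (p : ℤ), enc p l = enc p l' → l = l'
  | [], [], _, _ => rfl
  | [], b :: l, p, h => by
    rw [enc_eq, enc_eq] at h
    have := tn_inj (List.cons.inj h).1
    have h2 := cd_pos b
    simp [hdc] at this; omega
  | b :: l, [], p, h => by
    rw [enc_eq, enc_eq] at h
    have := tn_inj (List.cons.inj h).1
    have h2 := cd_pos b
    simp [hdc] at this; omega
  | b :: l, c :: l', p, h => by
    simp only [enc] at h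
    obtain ⟨h1, h2⟩ := List.cons.inj h
    have := cd_inj (tn_inj h1)
    subst this
    rw [enc_inj l l' _ h2]

def K (x : F) : List (ℕ ×ₗ ℕ) := enc (-1) x.toWord

theorem K_inj : Function.Injective K := fun _ _ h =>
  FreeGroup.toWord_injective (enc_inj _ _ _ h)

noncomputable instance ordF : LinearOrder F := LinearOrder.lift' K K_inj

theorem lt_def (x y : F) : x < y ↔ K x < K y := Iff.rfl

def h (x : F) : ℕ := hdc x.toWord

def lt (a : ℕ × Bool) : F := FreeGroup.mk [a]

theorem lt_flip (a) : lt (flip a) = (lt a)⁻¹ := by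
  simp [lt, flip, FreeGroup.inv_mk, FreeGroup.invRev]

theorem h_one : h 1 = 0 := by simp [h, hdc]

theorem eq_one_of_h {x : F} (hx : h x = 0) : x = 1 := by
  unfold h at hx
  rcases hw : x.toWord with _ | ⟨b, l⟩
  · exact FreeGroup.toWord_eq_nil_iff.1 hw
  · rw [hw] at hx; have := cd_pos b; simp [hdc] at hx; omega

theorem toWord_lt_mul {a : ℕ × Bool} {x : F} (hx : h x ≠ cd (flip a)) :
    (lt a * x).toWord = a :: x.toWord := by
  rw [FreeGroup.toWord_mul]
  have : (lt a).toWord = [a] := by simp [lt]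
  rw [this]
  simp only [List.cons_append, List.nil_append, FreeGroup.reduce.cons, FreeGroup.reduce_toWord]
  unfold h at hx
  rcases hw : x.toWord with _ | ⟨b, l⟩
  · rfl
  · rw [hw] at hx
    simp only [hdc] at hx
    have : ¬ (a.1 = b.1 ∧ a.2 = !b.2) := by
      rintro ⟨h1, h2⟩
      apply hx
      congr 1
      ext <;> simp [flip, h1, h2]
    simp [this]

theorem h_mul {a : ℕ × Bool} {x : F} (hx : h x ≠ cd (flip a)) : h (lt a * x) = cd a := by
  unfold h
  rw [toWord_lt_mul hx]
  rfl

theorem exists_dec {x : F} (hx : x ≠ 1) : ∃ a y, x = lt a * y ∧ h y ≠ cd (flip a) ∧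
    y.norm < x.norm := by
  rcases hw : x.toWord with _ | ⟨a, l⟩
  · exact absurd (FreeGroup.toWord_eq_nil_iff.1 hw) hx
  · have hr : FreeGroup.reduce (a :: l) = a :: l := by rw [← hw, FreeGroup.reduce_toWord]
    have hr' : FreeGroup.IsReduced (a :: l) := FreeGroup.isReduced_iff_reduce_eq.2 hr
    have hl : FreeGroup.IsReduced l := by
      unfold FreeGroup.IsReduced at hr' ⊢
      exact hr'.tail
    have hl' : (FreeGroup.mk l).toWord = l := by
      rw [FreeGroup.toWord_mk, hl.reduce_eq]
    refine ⟨a, FreeGroup.mk l, ?_, ?_, ?_⟩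
    · rw [← FreeGroup.mk_toWord (x := x), hw]
      simp [lt, FreeGroup.mul_mk]
    · unfold h
      rw [hl']
      intro hc
      cases l with
      | nil => have := cd_pos (flip a); simp [hdc] at hc; omega
      | cons b l =>
        simp only [hdc] at hc
        have := cd_inj hc
        subst this
        simp [FreeGroup.IsReduced, flip] at hr'
    · simp [FreeGroup.norm, hw, hl']

theorem F_ind {P : F → Prop} (h1 : P 1)
    (hs : ∀ a x, h x ≠ cd (flip a) → P x → P (lt a * x)) (x : F) : P x := by
  induction hn : x.norm using Nat.strong_induction_on generalizing x with
  | _ n ih =>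
    by_cases hx : x = 1
    · rw [hx]; exact h1
    · obtain ⟨a, y, rfl, hy, hlt⟩ := exists_dec hx
      exact hs a y hy (ih _ (hn ▸ hlt) y rfl)

/-- exact decomposition by first letter code -/
theorem dec_of_h {x : F} {a : ℕ × Bool} (hx : h x = cd a) :
    ∃ y, x = lt a * y ∧ h y ≠ cd (flip a) := by
  have : x ≠ 1 := by
    rintro rfl
    rw [h_one] at hx
    have := cd_pos a; omega
  obtain ⟨b, y, rfl, hy, -⟩ := exists_dec this
  rw [h_mul hy] at hx
  rw [← cd_inj hx]
  exact ⟨y, rfl, hy⟩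

theorem O1 {x y : F} (hxy : h x < h y) : x < y := by
  rw [lt_def]
  unfold K
  rw [enc_lt]
  left
  rw [tn_lt]
  right
  change _ ∧ h x < h y
  refine ⟨⟨fun _ => by omega, fun _ => by omega⟩, hxy⟩

theorem h_le {x y : F} (hxy : x < y) : h x ≤ h y := by
  by_contra hc
  exact absurd (O1 (not_le.1 hc)) (lt_asymm hxy)

theorem O2 {a : ℕ × Bool} {x y : F} (hx : h x ≠ cd (flip a)) (hy : h y ≠ cd (flip a)) :
    lt a * x < lt a * y ↔
      (cd (flip a) < h x ∧ ¬ cd (flip a) < h y) ∨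
        ((cd (flip a) < h x ↔ cd (flip a) < h y) ∧ x < y) := by
  have e1 : lt a * x < lt a * y ↔
      enc (cd (flip a)) x.toWord < enc (cd (flip a)) y.toWord := by
    rw [lt_def]
    unfold K
    rw [toWord_lt_mul hx, toWord_lt_mul hy]
    simp [enc]
  have e2 : x < y ↔ h x < h y ∨ (h x = h y ∧ tl x.toWord < tl y.toWord) := by
    rw [lt_def]
    unfold K
    rw [enc_lt, tn_lt]
    change (_ ∨ (_ ∧ h x < h y)) ∨ _ ↔ _
    have a1 : (-1 : ℤ) < hdc x.toWord := by omega
    have a2 : (-1 : ℤ) < hdc y.toWord := by omega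
    simp [a1, a2]
    rfl
  rw [e1, enc_lt, tn_lt, e2]
  change ((((_ : ℤ) < ((h x : ℕ) : ℤ)) ∧ ¬ ((_ : ℤ) < ((h y : ℕ) : ℤ))) ∨ ((((_ : ℤ) < ((h x : ℕ) : ℤ)) ↔ ((_ : ℤ) < ((h y : ℕ) : ℤ))) ∧ h x < h y)) ∨ (h x = h y ∧ _) ↔ _
  simp only [Nat.cast_lt]
  grind

def cyc (x y z : F) : Prop := (x < y ∧ y < z) ∨ (y < z ∧ z < x) ∨ (z < x ∧ x < y)

def Rot (g : F) : Prop := ∃ J : F → Prop, (∀ x y, x < y → J x → J y) ∧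
  (∀ x y, x < y → (J x ↔ J y) → g * x < g * y) ∧ (∀ x y, ¬ J x → J y → g * y < g * x)

theorem Rot.cyc {g : F} (hg : Rot g) {x y z : F} (hc : cyc x y z) :
    cyc (g * x) (g * y) (g * z) := by
  obtain ⟨J, h1, h2, h3⟩ := hg
  unfold BraidLO.cyc at *
  grind

theorem dec_flip {x : F} {a : ℕ × Bool} (hx : h x = cd (flip a)) :
    ∃ y, x = lt (flip a) * y ∧ lt a * x = y ∧ h y ≠ cd a := by
  obtain ⟨y, rfl, hy⟩ := dec_of_h hx
  rw [flip_flip] at hy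
  exact ⟨y, rfl, by rw [lt_flip]; group, hy⟩

theorem O2f {a : ℕ × Bool} {x y : F} (hx : h x ≠ cd a) (hy : h y ≠ cd a) :
    lt (flip a) * x < lt (flip a) * y ↔
      (cd a < h x ∧ ¬ cd a < h y) ∨ ((cd a < h x ↔ cd a < h y) ∧ x < y) := by
  have := O2 (a := flip a) (x := x) (y := y) (by rwa [flip_flip]) (by rwa [flip_flip])
  rwa [flip_flip] at this

open Classical in
noncomputable def JJ (a : ℕ × Bool) (w : F) : Prop :=
  if h w = cd (flip a) then h (lt a * w) < cd a else cd (flip a) < h w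

theorem rot_aux (a : ℕ × Bool) (x y : F) : (x < y → JJ a x → JJ a y) ∧
    (x < y → (JJ a x ↔ JJ a y) → lt a * x < lt a * y) ∧
    (¬ JJ a x → JJ a y → lt a * y < lt a * x) := by
  unfold JJ
  by_cases hx : h x = cd (flip a) <;> by_cases hy : h y = cd (flip a)
  · simp only [hx, hy, if_true]
    obtain ⟨x', ex, fx, hx'⟩ := dec_flip hx
    obtain ⟨y', ey, fy, hy'⟩ := dec_flip hy
    have o1 := @O1 y' x'
    have o2 := O2f hx' hy'
    rw [fx, fy, ex, ey]
    grind
  · simp only [hx, hy, if_true, if_false]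
    obtain ⟨x', ex, fx, hx'⟩ := dec_flip hx
    have m := h_mul hy
    have o1 := @O1 x' (lt a * y)
    have o1' := @O1 (lt a * y) x'
    have o3 := @h_le x y
    rw [fx]
    grind
  · simp only [hx, hy, if_true, if_false]
    obtain ⟨y', ey, fy, hy'⟩ := dec_flip hy
    have m := h_mul hx
    have o1 := @O1 y' (lt a * x)
    have o1' := @O1 (lt a * x) y'
    have o3 := @h_le x y
    rw [fy]
    grind
  · simp only [hx, hy, if_false]
    have o2 := O2 hx hy
    have o2' := O2 hy hx
    have o3 := @h_le x y
    grind

theorem rot_lt (a : ℕ × Bool) : Rot (lt a) :=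
  ⟨JJ a, fun x y => (rot_aux a x y).1, fun x y => (rot_aux a x y).2.1,
    fun x y => (rot_aux a x y).2.2⟩

theorem rot_cyc (g : F) : ∀ {x y z : F}, cyc x y z → cyc (g * x) (g * y) (g * z) := by
  induction g using F_ind with
  | h1 => simp
  | hs a x _ ih =>
    intro u v w huvw
    rw [mul_assoc, mul_assoc, mul_assoc]
    exact (rot_lt a).cyc (ih huvw)


def sgF (i : ℕ) : F →* F := FreeGroup.lift fun j =>
  if j = i then FreeGroup.of i * FreeGroup.of (i+1) * (FreeGroup.of i)⁻¹
  else if j = i + 1 then FreeGroup.of i else FreeGroup.of j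

def alF (i : ℕ) : F →* F := FreeGroup.lift fun j =>
  if j = i then FreeGroup.of (i+1)
  else if j = i + 1 then (FreeGroup.of (i+1))⁻¹ * FreeGroup.of i * FreeGroup.of (i+1)
  else FreeGroup.of j

theorem sg_i (i) : sgF i (FreeGroup.of i) =
    FreeGroup.of i * FreeGroup.of (i+1) * (FreeGroup.of i)⁻¹ := by simp [sgF]
theorem sg_i1 (i) : sgF i (FreeGroup.of (i+1)) = FreeGroup.of i := by simp [sgF]
theorem sg_o {i j} (h1 : j ≠ i) (h2 : j ≠ i + 1) : sgF i (FreeGroup.of j) = FreeGroup.of j := by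
  simp [sgF, h1, h2]
theorem al_i (i) : alF i (FreeGroup.of i) = FreeGroup.of (i+1) := by simp [alF]
theorem al_i1 (i) : alF i (FreeGroup.of (i+1)) =
    (FreeGroup.of (i+1))⁻¹ * FreeGroup.of i * FreeGroup.of (i+1) := by simp [alF]
theorem al_o {i j} (h1 : j ≠ i) (h2 : j ≠ i + 1) : alF i (FreeGroup.of j) = FreeGroup.of j := by
  simp [alF, h1, h2]

theorem sg_al (i) : (sgF i).comp (alF i) = MonoidHom.id F := by
  ext j
  by_cases h1 : j = i
  · subst h1; simp [al_i, sg_i1]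
  by_cases h2 : j = i + 1
  · subst h2; simp [al_i1, sg_i1, sg_i]; group
  · simp [al_o h1 h2, sg_o h1 h2]

theorem al_sg (i) : (alF i).comp (sgF i) = MonoidHom.id F := by
  ext j
  by_cases h1 : j = i
  · subst h1; simp [al_i, sg_i, al_i1]; group
  by_cases h2 : j = i + 1
  · subst h2; simp [al_i, sg_i1]
  · simp [al_o h1 h2, sg_o h1 h2]

def al (i : ℕ) : MulAut F where
  toFun := alF i
  invFun := sgF i
  left_inv x := DFunLike.congr_fun (sg_al i) x
  right_inv x := DFunLike.congr_fun (al_sg i) x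
  map_mul' := map_mul _

theorem al_apply (i x) : al i x = alF i x := rfl

theorem lt_true (j) : lt (j, true) = FreeGroup.of j := rfl
theorem lt_false (j) : lt (j, false) = (FreeGroup.of j)⁻¹ := by
  rw [← lt_true, ← lt_flip]; rfl

theorem hmt (i : ℕ) {z : F} (hz : h z ≠ 2 * i + 2) : h (FreeGroup.of i * z) = 2 * i + 1 := by
  rw [← lt_true]; exact h_mul hz
theorem hmf (i : ℕ) {z : F} (hz : h z ≠ 2 * i + 1) : h ((FreeGroup.of i)⁻¹ * z) = 2 * i + 2 := by
  rw [← lt_false]; exact h_mul hz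

theorem F_ind' {P : F → Prop} (h1 : P 1)
    (ht : ∀ i x, h x ≠ 2 * i + 2 → P x → P (FreeGroup.of i * x))
    (hf : ∀ i x, h x ≠ 2 * i + 1 → P x → P ((FreeGroup.of i)⁻¹ * x)) (x : F) : P x := by
  induction x using F_ind with
  | h1 => exact h1
  | hs a x hx ih =>
    obtain ⟨i, b⟩ := a
    cases b
    · rw [lt_false]; exact hf i x hx ih
    · rw [lt_true]; exact ht i x hx ih

def SS (i : ℕ) (w : F) : Prop :=
  ((h w < 2 * i + 1 ∨ 2 * i + 4 < h w) → h (sgF i w) = h w) ∧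
  (h w = 2 * i + 1 → ∃ z, sgF i w = FreeGroup.of i * (FreeGroup.of (i+1) * z) ∧ h z ≠ 2 * i + 4) ∧
  (h w = 2 * i + 2 → ∃ z, sgF i w = FreeGroup.of i * ((FreeGroup.of (i+1))⁻¹ * z) ∧
    h z ≠ 2 * i + 3) ∧
  (h w = 2 * i + 3 → ∃ z, sgF i w = FreeGroup.of i * z ∧
    (h z < 2 * i + 2 ∨ 2 * i + 4 < h z)) ∧
  (h w = 2 * i + 4 → 2 * i + 2 ≤ h (sgF i w) ∧ h (sgF i w) ≤ 2 * i + 4)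

theorem SS_cases {i : ℕ} {w : F} (hw : SS i w) :
    ((h w < 2 * i + 1 ∨ 2 * i + 4 < h w) ∧ h (sgF i w) = h w) ∨
    (h w = 2 * i + 1 ∧ ∃ z, sgF i w = FreeGroup.of i * (FreeGroup.of (i+1) * z) ∧ h z ≠ 2 * i + 4) ∨
    (h w = 2 * i + 2 ∧ ∃ z, sgF i w = FreeGroup.of i * ((FreeGroup.of (i+1))⁻¹ * z) ∧
      h z ≠ 2 * i + 3) ∨
    (h w = 2 * i + 3 ∧ ∃ z, sgF i w = FreeGroup.of i * z ∧
      (h z < 2 * i + 2 ∨ 2 * i + 4 < h z)) ∨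
    (h w = 2 * i + 4 ∧ 2 * i + 2 ≤ h (sgF i w) ∧ h (sgF i w) ≤ 2 * i + 4) := by
  obtain ⟨a, b, c, d, e⟩ := hw
  have : (h w < 2 * i + 1 ∨ 2 * i + 4 < h w) ∨ h w = 2 * i + 1 ∨ h w = 2 * i + 2 ∨ h w = 2 * i + 3 ∨
    h w = 2 * i + 4 := by omega
  rcases this with t | t | t | t | t
  · exact Or.inl ⟨t, a t⟩
  · exact Or.inr (Or.inl ⟨t, b t⟩)
  · exact Or.inr (Or.inr (Or.inl ⟨t, c t⟩))
  · exact Or.inr (Or.inr (Or.inr (Or.inl ⟨t, d t⟩)))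
  · exact Or.inr (Or.inr (Or.inr (Or.inr ⟨t, e t⟩)))

theorem h_sg_cases {i : ℕ} {w : F} (hw : SS i w) :
    ((h w < 2 * i + 1 ∨ 2 * i + 4 < h w) ∧ h (sgF i w) = h w) ∨
    ((2 * i + 1 ≤ h w ∧ h w ≤ 2 * i + 3) ∧ h (sgF i w) = 2 * i + 1) ∨
    (h w = 2 * i + 4 ∧ 2 * i + 2 ≤ h (sgF i w) ∧ h (sgF i w) ≤ 2 * i + 4) := by
  rcases SS_cases hw with t | ⟨t, z, e, hz⟩ | ⟨t, z, e, hz⟩ | ⟨t, z, e, hz⟩ | t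
  · exact Or.inl t
  · right; left; refine ⟨by omega, ?_⟩
    rw [e]; apply hmt; rw [hmt (i+1) (by omega)]; omega
  · right; left; refine ⟨by omega, ?_⟩
    rw [e]; apply hmt; rw [hmf (i+1) (by omega)]; omega
  · right; left; refine ⟨by omega, ?_⟩
    rw [e]; apply hmt; omega
  · exact Or.inr (Or.inr t)

theorem SS_all (i : ℕ) (w : F) : SS i w := by
  induction w using F_ind' with
  | h1 =>
    simp only [SS, map_one, h_one]
    refine ⟨by simp, ?_, ?_, ?_, ?_⟩ <;> intro hh <;> omega
  | ht j x hx ih =>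
    have hc := h_sg_cases ih
    have hj := hmt j hx
    unfold SS
    rw [hj, map_mul]
    refine ⟨fun hh => ?_, fun hh => ?_, fun hh => ?_, fun hh => ?_, fun hh => ?_⟩
    · rw [sg_o (by omega) (by omega)]
      apply hmt; omega
    · obtain rfl : j = i := by omega
      rw [sg_i]
      refine ⟨(FreeGroup.of j)⁻¹ * sgF j x, by group, ?_⟩
      rcases SS_cases ih with t | ⟨t, z, e, hz⟩ | ⟨t, z, e, hz⟩ | ⟨t, z, e, hz⟩ | t
      · rw [hmf j (by omega)]; omega
      · rw [e, inv_mul_cancel_left, hmt (j+1) (by omega)]; omega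
      · omega
      · rw [e, inv_mul_cancel_left]; omega
      · rw [hmf j (by omega)]; omega
    · omega
    · obtain rfl : j = i + 1 := by omega
      rw [sg_i1]
      exact ⟨_, rfl, by omega⟩
    · omega
  | hf j x hx ih =>
    have hc := h_sg_cases ih
    have hj := hmf j hx
    unfold SS
    rw [hj, map_mul, map_inv]
    refine ⟨fun hh => ?_, fun hh => ?_, fun hh => ?_, fun hh => ?_, fun hh => ?_⟩
    · rw [sg_o (by omega) (by omega)]
      apply hmf; omega
    · omega
    · obtain rfl : j = i := by omega
      rw [sg_i]
      refine ⟨(FreeGroup.of j)⁻¹ * sgF j x, by group, ?_⟩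
      rcases SS_cases ih with t | ⟨t, z, e, hz⟩ | ⟨t, z, e, hz⟩ | ⟨t, z, e, hz⟩ | t
      · rw [hmf j (by omega)]; omega
      · omega
      · rw [e, inv_mul_cancel_left, hmf (j+1) (by omega)]; omega
      · rw [e, inv_mul_cancel_left]; omega
      · rw [hmf j (by omega)]; omega
    · omega
    · obtain rfl : j = i + 1 := by omega
      rw [sg_i1]
      rcases SS_cases ih with t | ⟨t, z, e, hz⟩ | ⟨t, z, e, hz⟩ | ⟨t, z, e, hz⟩ | t
      · rw [hmf i (by omega)]; omega
      · rw [e, inv_mul_cancel_left, hmt (i+1) (by omega)]; omega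
      · rw [e, inv_mul_cancel_left, hmf (i+1) (by omega)]; omega
      · omega
      · rw [hmf i (by omega)]; omega

theorem O2t (i : ℕ) {x y : F} (hx : h x ≠ 2 * i + 2) (hy : h y ≠ 2 * i + 2) :
    FreeGroup.of i * x < FreeGroup.of i * y ↔
      (2 * i + 2 < h x ∧ ¬ 2 * i + 2 < h y) ∨
        ((2 * i + 2 < h x ↔ 2 * i + 2 < h y) ∧ x < y) := O2 (a := (i, true)) hx hy

theorem block (i : ℕ) {u v : F} (huv : h u < h v) : sgF i u < sgF i v := by
  have cu := h_sg_cases (SS_all i u)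
  have cv := h_sg_cases (SS_all i v)
  by_cases hlt : h (sgF i u) < h (sgF i v)
  · exact O1 hlt
  rcases SS_cases (SS_all i v) with t | ⟨t, z, e, hz⟩ | ⟨t, z, e, hz⟩ | ⟨t, z, e, hz⟩ | t
  · omega
  · omega
  · rcases SS_cases (SS_all i u) with t' | ⟨t', z', e', hz'⟩ | t' | t' | t'
    · omega
    · have a1 := hmf (i+1) (z := z) (by omega)
      have a2 := hmt (i+1) (z := z') (by omega)
      rw [e, e', O2t i (by omega) (by omega)]
      right
      exact ⟨by omega, O1 (by omega)⟩
    all_goals omega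
  · have key : ∀ y, h y = 2 * i + 3 ∨ h y = 2 * i + 4 → FreeGroup.of i * y < FreeGroup.of i * z := by
      intro y hy
      rw [O2t i (by omega) (by omega)]
      by_cases hz' : 2 * i + 2 < h z
      · right; exact ⟨by omega, O1 (by omega)⟩
      · left; omega
    rw [e]
    rcases SS_cases (SS_all i u) with t' | ⟨t', z', e', hz'⟩ | ⟨t', z', e', hz'⟩ | t' | t'
    · omega
    · rw [e']; apply key; left; rw [hmt (i+1) (by omega)]; omega
    · rw [e']; apply key; right; rw [hmf (i+1) (by omega)]; omega
    all_goals omega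
  · omega

theorem sg_mono (i : ℕ) (u : F) : ∀ v, u < v → sgF i u < sgF i v := by
  induction u using F_ind with
  | h1 =>
    intro v hv
    apply block
    rw [h_one]
    by_contra hc
    rw [eq_one_of_h (x := v) (by omega)] at hv
    exact lt_irrefl _ hv
  | hs a u hu ih =>
    intro v hv
    by_cases hh : h (lt a * u) < h v
    · exact block i hh
    have hv' : h v = cd a := by
      have := h_le hv
      rw [h_mul hu] at this hh
      omega
    obtain ⟨w, rfl, hw⟩ := dec_of_h hv'
    have o2 := (O2 hu hw).1 hv
    have hi : h (lt (flip a)) = cd (flip a) := by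
      have := h_mul (a := flip a) (x := 1) (by
        rw [h_one, flip_flip]; exact (cd_pos a).ne)
      rwa [mul_one] at this
    have hc : cyc (sgF i (lt (flip a))) (sgF i u) (sgF i w) := by
      unfold cyc
      have b1 := @block i u (lt (flip a))
      have b2 := @block i (lt (flip a)) u
      have b3 := @block i w (lt (flip a))
      have b4 := @block i (lt (flip a)) w
      have b5 := ih w
      rw [hi] at b1 b2 b3 b4
      rcases o2 with ⟨p, q⟩ | ⟨p, q⟩
      · exact Or.inr (Or.inr ⟨b3 (by omega), b2 p⟩)
      · by_cases r : cd (flip a) < h u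
        · exact Or.inl ⟨b2 r, b5 q⟩
        · exact Or.inr (Or.inl ⟨b5 q, b3 (by omega)⟩)
    have := rot_cyc (sgF i (lt a)) hc
    rw [← map_mul, ← map_mul, ← map_mul, lt_flip, mul_inv_cancel, map_one] at this
    have m : ∀ x : F, ¬ x < 1 := by
      intro x hx
      have h0 := h_le hx
      rw [h_one] at h0
      rw [eq_one_of_h (x := x) (by omega)] at hx
      exact lt_irrefl _ hx
    rcases this with t | t | t
    · exact t.2
    · exact absurd t.2 (m _)
    · exact absurd t.1 (m _)

theorem sgF_strictMono (i : ℕ) : StrictMono (sgF i) := fun u v huv => sg_mono i u v huv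

theorem al_symm_mono (i : ℕ) : StrictMono ((al i)⁻¹ : MulAut F) := sgF_strictMono i

theorem al_mono (i : ℕ) : StrictMono (al i : MulAut F) := by
  intro u v huv
  by_contra hc
  rcases (not_lt.1 hc).lt_or_eq with hc | hc
  · have := sgF_strictMono i hc
    have e1 : sgF i (al i u) = u := (al i).symm_apply_apply u
    have e2 : sgF i (al i v) = v := (al i).symm_apply_apply v
    rw [e1, e2] at this
    exact lt_asymm huv this
  · have := (al i).injective hc
    exact huv.ne this.symm

theorem al_comm {i j : ℕ} (hij : i + 1 < j) : al i * al j = al j * al i := by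
  apply MulEquiv.toMonoidHom_injective
  ext k
  change alF i (alF j (FreeGroup.of k)) = alF j (alF i (FreeGroup.of k))
  by_cases h1 : k = i
  · subst h1; simp (disch := omega) [al_i, al_o]
  by_cases h2 : k = i + 1
  · subst h2; simp (disch := omega) [al_i1, al_o]
  by_cases h3 : k = j
  · subst h3; simp (disch := omega) [al_i, al_o]
  by_cases h4 : k = j + 1
  · subst h4; simp (disch := omega) [al_i1, al_o]
  simp (disch := omega) [al_o]

theorem al_braid (i : ℕ) : al i * al (i+1) * al i = al (i+1) * al i * al (i+1) := by
  apply MulEquiv.toMonoidHom_injective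
  ext k
  change alF i (alF (i+1) (alF i (FreeGroup.of k))) =
    alF (i+1) (alF i (alF (i+1) (FreeGroup.of k)))
  by_cases h1 : k = i
  · subst h1; simp (disch := omega) [al_i, al_o]
  by_cases h2 : k = i + 1
  · subst h2; simp (disch := omega) [al_i, al_i1, al_o]
  by_cases h3 : k = i + 1 + 1
  · subst h3; simp (disch := omega) [al_i, al_i1, al_o]; group
  simp (disch := omega) [al_o]

abbrev Bd (m : ℕ) := BraidGroup (m + 1)

def s (m i : ℕ) : Bd m :=
  if hi : i < m then (PresentedGroup.of (⟨i, hi⟩ : Fin m) : PresentedGroup (braidRels (m + 1))) else 1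

theorem s_of {m i : ℕ} (hi : i < m) : s m i =
    (PresentedGroup.of (⟨i, hi⟩ : Fin m) : PresentedGroup (braidRels (m + 1))) := by
  exact dif_pos hi

theorem s_ge {m i : ℕ} (hi : m ≤ i) : s m i = 1 := by
  simp [s, not_lt.2 hi]

theorem s_comm {m i j : ℕ} (hij : i + 1 < j) (hj : j < m) :
    s m i * s m j = s m j * s m i := by
  rw [s_of hj, s_of (by omega : i < m)]
  have := PresentedGroup.mk_eq_mk_of_mul_inv_mem (rels := braidRels (m + 1))
    (x := FreeGroup.of (⟨i, by omega⟩ : Fin m) * FreeGroup.of (⟨j, hj⟩ : Fin m))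
    (y := FreeGroup.of (⟨j, hj⟩ : Fin m) * FreeGroup.of (⟨i, by omega⟩ : Fin m))
    (Or.inl ⟨⟨i, by omega⟩, ⟨j, hj⟩, by
      rw [lt_abs]; right; simp only; omega, rfl⟩)
  exact this

theorem s_braid {m i : ℕ} (hi : i + 1 < m) :
    s m i * s m (i+1) * s m i = s m (i+1) * s m i * s m (i+1) := by
  rw [s_of hi, s_of (by omega : i < m)]
  have := PresentedGroup.mk_eq_mk_of_mul_inv_mem (rels := braidRels (m + 1))
    (x := FreeGroup.of (⟨i, by omega⟩ : Fin m) * FreeGroup.of (⟨i+1, hi⟩ : Fin m) *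
      FreeGroup.of (⟨i, by omega⟩ : Fin m))
    (y := FreeGroup.of (⟨i+1, hi⟩ : Fin m) * FreeGroup.of (⟨i, by omega⟩ : Fin m) *
      FreeGroup.of (⟨i+1, hi⟩ : Fin m))
    (Or.inr ⟨⟨i, by omega⟩, ⟨i+1, hi⟩, by simp, rfl⟩)
  exact this

theorem bl_aux {G : Type*} [Group G] (m : ℕ) (f : ℕ → G)
    (hc : ∀ i j, i + 1 < j → j < m → f i * f j = f j * f i)
    (hb : ∀ i, i + 1 < m → f i * f (i+1) * f i = f (i+1) * f i * f (i+1)) :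
    ∀ r ∈ braidRels (m + 1), FreeGroup.lift (fun i : Fin (m + 1 - 1) => f i) r = 1 := by
  rintro r (⟨i, j, hij, rfl⟩ | ⟨i, j, hij, rfl⟩)
  · have hi := i.2
    have hj := j.2
    simp only [map_mul, map_inv, FreeGroup.lift_apply_of]
    rw [mul_inv_eq_one]
    rcases lt_abs.1 hij with t | t
    · exact (hc j i (by omega) (by omega)).symm
    · exact hc i j (by omega) (by omega)
  · have hi := i.2
    have hj := j.2
    simp only [map_mul, map_inv, FreeGroup.lift_apply_of]
    rw [mul_inv_eq_one]
    rcases (abs_eq (by norm_num)).1 hij with t | t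
    · have e : (i : ℕ) = j + 1 := by omega
      rw [e]
      exact (hb j (by omega)).symm
    · have e : (j : ℕ) = i + 1 := by omega
      rw [e]
      exact hb i (by omega)

def bl {G : Type*} [Group G] (m : ℕ) (f : ℕ → G)
    (hc : ∀ i j, i + 1 < j → j < m → f i * f j = f j * f i)
    (hb : ∀ i, i + 1 < m → f i * f (i+1) * f i = f (i+1) * f i * f (i+1)) : Bd m →* G :=
  PresentedGroup.toGroup (bl_aux m f hc hb)

theorem bl_s {G : Type*} [Group G] {m : ℕ} {f : ℕ → G} {hc hb} {i : ℕ} (hi : i < m) :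
    bl m f hc hb (s m i) = f i := by
  rw [s_of hi]
  exact PresentedGroup.toGroup.of (bl_aux m f hc hb)

def mkB (m : ℕ) (z : FreeGroup (Fin m)) : Bd m := PresentedGroup.mk (braidRels (m + 1)) z

theorem Bd_ind {m : ℕ} {P : Bd m → Prop} (h1 : P 1)
    (hs : ∀ i, i < m → ∀ x, P x → P (s m i * x))
    (hi : ∀ i, i < m → ∀ x, P x → P ((s m i)⁻¹ * x)) (x : Bd m) : P x := by
  have key : ∀ z : FreeGroup (Fin m), ∀ x : Bd m, P x →
      P (mkB m z * x) := by
    intro z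
    induction z using FreeGroup.induction_on with
    | C1 => intro x hx; exact (one_mul x).symm ▸ hx
    | of i =>
      intro x hx
      have := hs i i.2 x hx
      rw [s_of i.2] at this
      exact this
    | inv_of i _ =>
      intro x hx
      have := hi i i.2 x hx
      rw [s_of i.2] at this
      exact this
    | mul a b ha hb =>
      intro x hx
      have := ha _ (hb x hx)
      rw [← mul_assoc] at this
      exact this
  obtain ⟨z, rfl⟩ := PresentedGroup.mk_surjective (braidRels (m + 1)) x
  have := key z 1 h1
  rw [mul_one] at this
  exact this

def art (m : ℕ) : Bd m →* MulAut F := bl m al (fun _ _ hij _ => al_comm hij) (fun i _ => al_braid i)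

theorem art_s {m i : ℕ} (hi : i < m) : art m (s m i) = al i := bl_s hi

def sh (m : ℕ) : Bd m →* Bd (m+1) := bl m (fun i => s (m+1) (i+1))
  (fun _ _ hij hj => s_comm (by omega) (by omega)) (fun i hi => s_braid (by omega))

theorem sh_s {m i : ℕ} (hi : i < m) : sh m (s m i) = s (m+1) (i+1) := bl_s hi

def c (M : ℕ) : ℕ → Bd M
  | 0 => 1
  | k + 1 => s M k * c M k

theorem c_comm {M i : ℕ} (hi : i < M) : ∀ {k : ℕ}, k < i → s M i * c M k = c M k * s M i
  | 0, _ => by simp [c]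
  | k + 1, hk => by
    rw [c, ← mul_assoc, ← s_comm hk hi, mul_assoc, c_comm hi (by omega : k < i), mul_assoc]

theorem c_shift {M i : ℕ} : ∀ {k : ℕ}, i + 1 < k → k ≤ M → s M i * c M k = c M k * s M (i+1)
  | 0, h1, _ => by omega
  | k + 1, h1, h2 => by
    by_cases hk : k = i + 1
    · subst hk
      simp only [c]
      rw [← mul_assoc, ← mul_assoc, s_braid (by omega), mul_assoc, mul_assoc, mul_assoc,
        c_comm (by omega) (by omega), mul_assoc]
    · rw [c, ← mul_assoc, s_comm (by omega) (by omega), mul_assoc, c_shift (by omega) (by omega),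
        mul_assoc]

def aa (M j : ℕ) : Bd M := (c M j)⁻¹ * (s M j * s M j) * c M j

theorem aa_ge {M j : ℕ} (hj : M ≤ j) : aa M j = 1 := by simp [aa, s_ge hj]

def AA (M : ℕ) : F →* Bd M := FreeGroup.lift (aa M)

theorem AA_of (M j : ℕ) : AA M (FreeGroup.of j) = aa M j := by simp [AA]

/-- conjugation helper -/
theorem conj_aux {G : Type*} [Group G] {t p u t' : G} (h1 : t * p = p * t')
    (h2 : t * u = u * t) : t' * (p⁻¹ * u * p) * t'⁻¹ = p⁻¹ * u * p := by
  have e : t' = p⁻¹ * t * p := by rw [mul_assoc, h1]; group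
  have e2 : u = t * u * t⁻¹ := by rw [h2]; group
  subst e
  conv_rhs => rw [e2]
  group

theorem braid3 {G : Type*} [Group G] {a b : G} (hab : a * b * a = b * a * b) :
    b * (a * a) * b⁻¹ = a⁻¹ * (b * b) * a := by
  rw [mul_inv_eq_iff_eq_mul, mul_assoc a⁻¹, mul_assoc a⁻¹, eq_inv_mul_iff_mul_eq]
  calc a * (b * (a * a)) = (a * b * a) * a := by group
    _ = b * (a * b * a) := by rw [hab]; simp only [mul_assoc]; rw [← mul_assoc a b a, hab]; simp only [mul_assoc]
    _ = b * (b * a * b) := by rw [hab]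
    _ = _ := by group

theorem braid3' {G : Type*} [Group G] {a b : G} (hab : a * b * a = b * a * b) :
    b * (a⁻¹ * (b * b) * a) * b⁻¹ =
      (a⁻¹ * (b * b) * a)⁻¹ * (a * a) * (a⁻¹ * (b * b) * a) := by
  rw [← braid3 hab]
  have k : Commute (a * a) (b * (a * a) * b) := by
    have h1 : Commute a (b * (a * a) * b) := by
      show a * (b * (a * a) * b) = b * (a * a) * b * a
      calc a * (b * (a * a) * b) = (a * b * a) * (a * b) := by group
        _ = (b * a * b) * (a * b) := by rw [hab]
        _ = b * a * (b * a * b) := by group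
        _ = b * a * (a * b * a) := by rw [hab]
        _ = _ := by group
    exact h1.mul_left h1
  have k' := k.eq
  have k2 : b * (a * a) * b * (a * a) * (b * (a*a) * b)⁻¹ = a * a := by rw [← k']; group
  have : (b * (a * a) * b⁻¹) * (b * (b * (a * a) * b⁻¹) * b⁻¹) = (a * a) * (b * (a * a) * b⁻¹) := by
    calc _ = (b * (a * a) * b) * (a * a) * (b * b)⁻¹ := by group
      _ = (a * a) * (b * (a * a) * b) * (b * b)⁻¹ := by rw [k']
      _ = _ := by group
  rw [mul_assoc (_)⁻¹, ← this]
  group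

theorem aa_conj {M i : ℕ} (hi : i + 1 < M) (j : ℕ) :
    s M (i+1) * aa M j * (s M (i+1))⁻¹ = AA M (al i (FreeGroup.of j)) := by
  rw [al_apply]
  rcases lt_trichotomy j i with hj | rfl | hj
  · rw [al_o (by omega) (by omega), AA_of]
    refine conj_aux (t := s M (i+1)) (c_comm hi (by omega)) ?_
    have := s_comm (i := j) (j := i + 1) (by omega) hi
    rw [← mul_assoc, ← this, mul_assoc, ← this, mul_assoc]
  · rw [al_i, AA_of]
    have hc := c_comm hi (Nat.lt_succ_self j)
    have b3 := braid3 (s_braid hi)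
    have e : aa M (j+1) = (c M j)⁻¹ * ((s M j)⁻¹ * (s M (j+1) * s M (j+1)) * s M j) * c M j := by
      simp only [aa, c]; group
    rw [e, ← b3]
    have hc' : s M (j+1) * (c M j)⁻¹ = (c M j)⁻¹ * s M (j+1) := by
      rw [mul_inv_eq_iff_eq_mul, mul_assoc, hc]; group
    have hc2 : c M j * (s M (j+1))⁻¹ = (s M (j+1))⁻¹ * c M j := by
      rw [mul_inv_eq_iff_eq_mul, mul_assoc, ← hc]; group
    rw [aa, ← mul_assoc, ← mul_assoc, hc', mul_assoc _ (c M j), hc2]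
    group
  · by_cases hj' : j = i + 1
    · subst hj'
      rw [al_i1]
      simp only [map_mul, map_inv, AA_of]
      have hc := c_comm hi (Nat.lt_succ_self i)
      have b3 := braid3' (s_braid hi)
      have e : aa M (i+1) = (c M i)⁻¹ * ((s M i)⁻¹ * (s M (i+1) * s M (i+1)) * s M i) * c M i := by
        simp only [aa, c]; group
      have hc' : s M (i+1) * (c M i)⁻¹ = (c M i)⁻¹ * s M (i+1) := by
        rw [mul_inv_eq_iff_eq_mul, mul_assoc, hc]; group
      have hc2 : c M i * (s M (i+1))⁻¹ = (s M (i+1))⁻¹ * c M i := by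
        rw [mul_inv_eq_iff_eq_mul, mul_assoc, ← hc]; group
      rw [e]
      generalize (s M i)⁻¹ * (s M (i+1) * s M (i+1)) * s M i = z at *
      calc _ = (s M (i+1) * (c M i)⁻¹) * z * (c M i * (s M (i+1))⁻¹) := by group
        _ = (c M i)⁻¹ * (s M (i+1) * z * (s M (i+1))⁻¹) * c M i := by rw [hc', hc2]; group
        _ = _ := by rw [b3, aa]; group
    · rw [al_o (by omega) (by omega), AA_of]
      by_cases hM : M ≤ j
      · rw [aa_ge hM]; simp
      refine conj_aux (t := s M i) (c_shift (by omega) (by omega)) ?_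
      have := s_comm (m := M) (i := i) (j := j) (by omega) (by omega)
      rw [← mul_assoc, this, mul_assoc, this, mul_assoc]

theorem AA_conj {M i : ℕ} (hi : i + 1 < M) (f : F) :
    s M (i+1) * AA M f * (s M (i+1))⁻¹ = AA M (al i f) := by
  have : ((MulAut.conj (s M (i+1))).toMonoidHom.comp (AA M)) =
      (AA M).comp (al i).toMonoidHom := by
    ext j
    simpa [AA_of] using aa_conj hi j
  exact DFunLike.congr_fun this f

theorem AA_conj' {M i : ℕ} (hi : i + 1 < M) (f : F) :
    (s M (i+1))⁻¹ * AA M f = AA M ((al i)⁻¹ f) * (s M (i+1))⁻¹ := by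
  have := AA_conj hi ((al i)⁻¹ f)
  rw [MulAut.apply_inv_self] at this
  rw [← this]; group

theorem AA_conj'' {M i : ℕ} (hi : i + 1 < M) (f : F) :
    s M (i+1) * AA M f = AA M (al i f) * s M (i+1) := by
  rw [← AA_conj hi]; group

theorem nf (m : ℕ) (β : Bd (m+1)) : ∃ k ≤ m + 1, ∃ f γ,
    β = c (m+1) k * AA (m+1) f * sh m γ := by
  induction β using Bd_ind with
  | h1 => exact ⟨0, by omega, 1, 1, by simp [c]⟩
  | hs i hi x ih =>
    obtain ⟨k, hk, f, γ, rfl⟩ := ih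
    rcases lt_trichotomy i k with hik | rfl | hik
    · by_cases h2 : k = i + 1
      · subst h2
        refine ⟨i, by omega, FreeGroup.of i * f, γ, ?_⟩
        rw [map_mul, AA_of, aa, c]; group
      · refine ⟨k, hk, al i f, s m i * γ, ?_⟩
        rw [map_mul, sh_s (by omega), ← mul_assoc, ← mul_assoc, c_shift (by omega) hk,
          mul_assoc (c _ _), AA_conj'' (by omega)]
        group
    · exact ⟨i + 1, by omega, f, γ, by rw [c]; group⟩
    · obtain ⟨i, rfl⟩ : ∃ j, i = j + 1 := ⟨i - 1, by omega⟩
      refine ⟨k, hk, al i f, s m i * γ, ?_⟩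
      rw [map_mul, sh_s (by omega), ← mul_assoc, ← mul_assoc, c_comm hi hik,
        mul_assoc (c _ _), AA_conj'' (by omega)]
      group
  | hi i hi x ih =>
    obtain ⟨k, hk, f, γ, rfl⟩ := ih
    rcases lt_trichotomy i k with hik | rfl | hik
    · by_cases h2 : k = i + 1
      · subst h2
        exact ⟨i, by omega, f, γ, by rw [c]; group⟩
      · refine ⟨k, hk, (al i)⁻¹ f, (s m i)⁻¹ * γ, ?_⟩
        have e : (s (m+1) i)⁻¹ * c (m+1) k = c (m+1) k * (s (m+1) (i+1))⁻¹ := by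
          rw [inv_mul_eq_iff_eq_mul, ← mul_assoc, c_shift (by omega) hk]; group
        rw [map_mul, map_inv, sh_s (by omega), ← mul_assoc, ← mul_assoc, e,
          mul_assoc (c _ _), AA_conj' (by omega)]
        group
    · refine ⟨i + 1, by omega, (FreeGroup.of i)⁻¹ * f, γ, ?_⟩
      rw [map_mul, map_inv, AA_of, aa, c]; group
    · obtain ⟨i, rfl⟩ : ∃ j, i = j + 1 := ⟨i - 1, by omega⟩
      refine ⟨k, hk, (al i)⁻¹ f, (s m i)⁻¹ * γ, ?_⟩
      have e : (s (m+1) (i+1))⁻¹ * c (m+1) k = c (m+1) k * (s (m+1) (i+1))⁻¹ := by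
        rw [inv_mul_eq_iff_eq_mul, ← mul_assoc, c_comm hi hik]; group
      rw [map_mul, map_inv, sh_s (by omega), ← mul_assoc, ← mul_assoc, e,
        mul_assoc (c _ _), AA_conj' (by omega)]
      group

def q : F →* F := FreeGroup.lift fun j => if j = 0 then 1 else FreeGroup.of (j - 1)

theorem q_zero : q (FreeGroup.of 0) = 1 := by simp [q]
theorem q_succ (j : ℕ) : q (FreeGroup.of (j + 1)) = FreeGroup.of j := by simp [q]

theorem q_surj : Function.Surjective q := by
  intro x
  induction x using FreeGroup.induction_on with
  | C1 => exact ⟨1, map_one _⟩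
  | of i => exact ⟨_, q_succ i⟩
  | inv_of i _ => exact ⟨(FreeGroup.of (i+1))⁻¹, by rw [map_inv, q_succ]⟩
  | mul a b ha hb =>
    obtain ⟨x, rfl⟩ := ha
    obtain ⟨y, rfl⟩ := hb
    exact ⟨x * y, map_mul _ _ _⟩

theorem q_al (i : ℕ) (x : F) : q (al (i+1) x) = al i (q x) := by
  have : q.comp (alF (i+1)) = (alF i).comp q := by
    ext j
    rcases j with _ | j
    · simp [al_o, q_zero]
    · by_cases h1 : j = i
      · subst h1; simp [al_i, q_succ]
      by_cases h2 : j = i + 1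
      · subst h2; simp [al_i1, q_succ]
      · simp [al_o h1 h2, al_o (i := i + 1) (j := j + 1) (by omega) (by omega), q_succ]
  exact DFunLike.congr_fun this x

theorem q_al_inv (i : ℕ) (x : F) : q ((al (i+1))⁻¹ x) = (al i)⁻¹ (q x) := by
  apply (al i).injective
  rw [← q_al, MulAut.apply_inv_self, MulAut.apply_inv_self]

theorem al_zero (i : ℕ) : al (i+1) (FreeGroup.of 0) = FreeGroup.of 0 :=
  al_o (i := i + 1) (j := 0) (by omega) (by omega)

theorem al_inv_zero (i : ℕ) : (al (i+1))⁻¹ (FreeGroup.of 0) = FreeGroup.of 0 := by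
  conv_lhs => rw [← al_zero i]
  rw [MulAut.inv_apply_self]

theorem q_sh {m : ℕ} (γ : Bd m) : ∀ x, q (art (m+1) (sh m γ) x) = art m γ (q x) := by
  induction γ using Bd_ind with
  | h1 => intro x; simp
  | hs i hi y ih =>
    intro x
    rw [map_mul, map_mul, map_mul, sh_s hi, art_s hi, art_s (by omega)]
    rw [MulAut.mul_apply, MulAut.mul_apply, q_al, ih]
  | hi i hi y ih =>
    intro x
    rw [map_mul, map_mul, map_mul, map_inv, map_inv, map_inv, sh_s hi, art_s hi, art_s (by omega)]
    rw [MulAut.mul_apply, MulAut.mul_apply, q_al_inv, ih]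

theorem sh_zero {m : ℕ} (γ : Bd m) : art (m+1) (sh m γ) (FreeGroup.of 0) = FreeGroup.of 0 := by
  induction γ using Bd_ind with
  | h1 => simp
  | hs i hi y ih =>
    rw [map_mul, map_mul, sh_s hi, art_s (by omega), MulAut.mul_apply, ih, al_zero]
  | hi i hi y ih =>
    rw [map_mul, map_mul, map_inv, map_inv, sh_s hi, art_s (by omega), MulAut.mul_apply, ih,
      al_inv_zero]

def rr (M : ℕ) : F →* F := FreeGroup.lift fun j => if j < M then FreeGroup.of j else 1

theorem AA_rr (M : ℕ) (f : F) : AA M (rr M f) = AA M f := by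
  have : (AA M).comp (rr M) = AA M := by
    ext j
    by_cases hj : j < M
    · simp [rr, hj]
    · simp [rr, hj, AA_of, aa_ge (not_lt.1 hj)]
  exact DFunLike.congr_fun this f

/-- good pure braids -/
def Good (M : ℕ) (A : MulAut F) (g : F) : Prop :=
  (∀ x, q (A x) = q x) ∧
    ∃ W, A (FreeGroup.of 0) = W * FreeGroup.of 0 * W⁻¹ ∧ q W = g⁻¹

theorem Good.mul {M : ℕ} {A B : MulAut F} {g k : F} (hA : Good M A g) (hB : Good M B k) :
    Good M (A * B) (g * k) := by
  obtain ⟨h1, W, h2, h3⟩ := hA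
  obtain ⟨k1, V, k2, k3⟩ := hB
  refine ⟨fun x => by rw [MulAut.mul_apply, h1, k1], A V * W, ?_, ?_⟩
  · rw [MulAut.mul_apply, k2, map_mul, map_mul, map_inv, h2]; group
  · rw [map_mul, h1, h3, k3]; group

theorem Good.inv {M : ℕ} {A : MulAut F} {g : F} (hA : Good M A g) :
    Good M A⁻¹ g⁻¹ := by
  obtain ⟨h1, W, h2, h3⟩ := hA
  have h1' : ∀ x, q (A⁻¹ x) = q x := fun x => by rw [← h1, MulAut.apply_inv_self]
  refine ⟨h1', (A⁻¹ W)⁻¹, ?_, ?_⟩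
  · have : A⁻¹ (A (FreeGroup.of 0)) = A⁻¹ (W * FreeGroup.of 0 * W⁻¹) := by rw [h2]
    rw [MulAut.inv_apply_self, map_mul, map_mul, map_inv] at this
    generalize A⁻¹ (FreeGroup.of 0) = u at *
    rw [this]; group
  · rw [map_inv, h1', h3]

theorem Good.one {M : ℕ} : Good M 1 1 := ⟨fun x => rfl, 1, by simp, by simp⟩

theorem good_aa {M : ℕ} : ∀ j, j < M → Good M (art M (aa M j)) (FreeGroup.of j)
  | 0, h0 => by
    have e : art M (aa M 0) = al 0 * al 0 := by
      simp only [aa, c, map_mul, map_inv, map_one, art_s h0]; group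
    rw [e]
    refine ⟨fun x => ?_, (FreeGroup.of 1)⁻¹, ?_, ?_⟩
    · have : q.comp ((alF 0).comp (alF 0)) = q := by
        ext j
        have a0 := al_i 0
        have a1 := al_i1 0
        have q1 := q_succ 0
        rw [zero_add] at a0 a1 q1
        rcases j with _ | _ | j
        · simp [a0, a1, q_zero]
        · simp [a0, a1, q_zero, q1]
        · simp [al_o]
      exact DFunLike.congr_fun this x
    · have a0 := al_i 0
      have a1 := al_i1 0
      rw [zero_add] at a0 a1
      rw [MulAut.mul_apply, al_apply, al_apply, a0, a1]; group
    · rw [map_inv, q_succ 0]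
  | i + 1, hi => by
    obtain ⟨h1, W, h2, h3⟩ := good_aa (M := M) i (by omega)
    have e := aa_conj hi i
    rw [al_apply, al_i, AA_of] at e
    rw [← e, map_mul, map_mul, map_inv, art_s hi]
    refine ⟨fun x => ?_, al (i+1) W, ?_, ?_⟩
    · rw [MulAut.mul_apply, MulAut.mul_apply, q_al, h1, ← q_al, MulAut.apply_inv_self]
    · rw [MulAut.mul_apply, MulAut.mul_apply, al_inv_zero, h2, map_mul, map_mul, map_inv, al_zero]
    · rw [q_al, h3, map_inv, al_apply, al_i]

theorem good_AA (M : ℕ) (f : F) : Good M (art M (AA M f)) (rr M f) := by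
  have ho : ∀ i, Good M (art M (AA M (FreeGroup.of i))) (rr M (FreeGroup.of i)) := by
    intro i
    rw [AA_of]
    by_cases hi : i < M
    · have := good_aa i hi
      simpa [rr, hi] using this
    · have := Good.one (M := M)
      simpa [rr, hi, aa_ge (not_lt.1 hi)] using this
  induction f using FreeGroup.induction_on with
  | C1 => simpa using Good.one
  | of i => exact ho i
  | inv_of i _ => simpa only [map_inv] using (ho i).inv
  | mul a b ha hb => simpa only [map_mul] using ha.mul hb

theorem c_zero {M : ℕ} : ∀ k, k ≤ M → art M (c M k) (FreeGroup.of 0) = FreeGroup.of k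
  | 0, _ => by simp [c]
  | k + 1, hk => by
    rw [c, map_mul, art_s (by omega), MulAut.mul_apply, c_zero k (by omega), al_apply, al_i]

abbrev RG := MonoidAlgebra ℤ F

noncomputable def rg (x : F) : RG := MonoidAlgebra.of ℤ F x

theorem rg_mul (x y : F) : rg (x * y) = rg x * rg y := map_mul _ _ _
theorem rg_one : rg 1 = 1 := map_one _
theorem rg_inj {x y : F} (hxy : rg x = rg y) : x = y := MonoidAlgebra.of_injective hxy

noncomputable def mP (x : F) : Equiv.Perm RG where
  toFun v := rg x * v
  invFun v := rg x⁻¹ * v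
  left_inv v := by beta_reduce; rw [← mul_assoc, ← rg_mul, inv_mul_cancel, rg_one, one_mul]
  right_inv v := by beta_reduce; rw [← mul_assoc, ← rg_mul, mul_inv_cancel, rg_one, one_mul]

noncomputable def th : F →* Equiv.Perm RG :=
  FreeGroup.lift fun j => if j = 0 then Equiv.addRight (1 : RG) else mP (FreeGroup.of (j - 1))

theorem th_zero (v : RG) : th (FreeGroup.of 0) v = v + 1 := by simp [th]
theorem th_succ (j : ℕ) (v : RG) : th (FreeGroup.of (j+1)) v = rg (FreeGroup.of j) * v := by
  simp [th, mP]

theorem th_aff (W : F) : ∀ v, th W v = rg (q W) * v + th W 0 := by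
  have ho : ∀ i v, th (FreeGroup.of i) v = rg (q (FreeGroup.of i)) * v + th (FreeGroup.of i) 0 := by
    intro i v
    rcases i with _ | i
    · simp [th_zero, q_zero, rg_one]
    · simp [th_succ, q_succ]
  induction W using FreeGroup.induction_on with
  | C1 => intro v; simp [rg_one]
  | of i => exact ho i
  | inv_of i _ =>
    intro v
    have := ho i (th (FreeGroup.of i)⁻¹ v)
    have t2 := ho i (th (FreeGroup.of i)⁻¹ 0)
    rw [map_inv, Equiv.Perm.inv_def, Equiv.apply_symm_apply, ← Equiv.Perm.inv_def] at this t2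
    have t3 : v = rg (q (FreeGroup.of i)) * ((th (FreeGroup.of i))⁻¹ v -
        (th (FreeGroup.of i))⁻¹ 0) := by
      rw [mul_sub]; nth_rewrite 1 [this]
      rw [← sub_eq_zero]
      have : th (FreeGroup.of i) 0 = - (rg (q (FreeGroup.of i)) * (th (FreeGroup.of i))⁻¹ 0) := by
        rw [eq_neg_iff_add_eq_zero, add_comm]; exact t2.symm
      rw [this]; abel
    rw [map_inv, map_inv, ← sub_eq_iff_eq_add]
    nth_rewrite 2 [t3]
    rw [← mul_assoc, ← rg_mul, inv_mul_cancel, rg_one, one_mul]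
  | mul a b ha hb =>
    intro v
    rw [map_mul, map_mul, Equiv.Perm.mul_apply, Equiv.Perm.mul_apply, ha, hb, ha (th b 0), rg_mul]
    rw [mul_add, mul_assoc, add_assoc]

theorem centr {W : F} (hW : W * FreeGroup.of 0 = FreeGroup.of 0 * W) : q W = 1 := by
  have h1 : th (W * FreeGroup.of 0) 0 = th (FreeGroup.of 0 * W) 0 := by rw [hW]
  rw [map_mul, map_mul, Equiv.Perm.mul_apply, Equiv.Perm.mul_apply, th_zero, th_zero, th_aff,
    zero_add, mul_one, add_comm] at h1
  have := add_left_cancel h1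
  rw [← rg_one] at this
  exact rg_inj this

noncomputable def ct : F →* Multiplicative ℤ :=
  FreeGroup.lift fun j => if j = 0 then Multiplicative.ofAdd 1 else 1

theorem conj_zero {k : ℕ} {U : F} (hU : U * FreeGroup.of k * U⁻¹ = FreeGroup.of 0) : k = 0 := by
  by_contra hk
  have := congrArg ct hU
  simp [ct, hk] at this
  exact absurd (congrArg Multiplicative.toAdd this) (by simp)

theorem art_inj : ∀ m, ∀ β : Bd m, art m β = 1 → β = 1
  | 0 => fun β _ => by
    induction β using Bd_ind with
    | h1 => rfl
    | hs i hi => omega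
    | hi i hi => omega
  | m + 1 => fun β hβ => by
    obtain ⟨k, hk, f, γ, rfl⟩ := nf m β
    obtain ⟨h1, W, h2, h3⟩ := good_AA (m+1) f
    have hx : ∀ x, art (m+1) (c (m+1) k) (art (m+1) (AA (m+1) f) (art (m+1) (sh m γ) x)) = x := by
      intro x
      have := DFunLike.congr_fun hβ x
      simpa only [map_mul, MulAut.mul_apply, MulAut.one_apply] using this
    have hk0 : k = 0 := by
      have := hx (FreeGroup.of 0)
      rw [sh_zero, h2, map_mul, map_mul, map_inv, c_zero k hk] at this
      exact conj_zero this
    subst hk0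
    simp only [c, map_one, MulAut.one_apply] at hx
    have hγ : γ = 1 := by
      apply art_inj m
      ext1 y
      obtain ⟨x, rfl⟩ := q_surj y
      rw [← q_sh, ← h1, hx]; rfl
    subst hγ
    have h4 := hx (FreeGroup.of 0)
    rw [sh_zero, h2, mul_inv_eq_iff_eq_mul] at h4
    have h5 := centr h4
    rw [h3, inv_eq_one] at h5
    rw [← AA_rr, h5]
    simp [c]

theorem art_mono {m : ℕ} (β : Bd m) : StrictMono (art m β) := by
  induction β using Bd_ind with
  | h1 => rw [map_one]; exact strictMono_id
  | hs i hi x ih =>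
    rw [map_mul, art_s hi]; exact (al_mono i).comp ih
  | hi i hi x ih =>
    rw [map_mul, map_inv, art_s hi]; exact (al_symm_mono i).comp ih

noncomputable def key (m : ℕ) (β : Bd m) : Lex (ℕ → F) := toLex fun j => art m β (FreeGroup.of j)

theorem key_inj (m : ℕ) : Function.Injective (key m) := by
  intro β γ hβ
  have e : art m β = art m γ := by
    have : (art m β).toMonoidHom = (art m γ).toMonoidHom := by
      ext j
      exact congrFun (toLex.injective hβ) j
    ext1 x
    exact DFunLike.congr_fun this x
  have := art_inj m (β⁻¹ * γ) (by rw [map_mul, map_inv, e, inv_mul_cancel])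
  exact (inv_mul_eq_one.1 this)

theorem main (m : ℕ) : LeftOrderable (Bd m) := by
  refine ⟨fun β γ => key m β < key m γ, ?_, ?_⟩
  · exact { trichotomous := fun a b h1 h2 => key_inj m (le_antisymm (not_lt.1 h2) (not_lt.1 h1))
            irrefl := fun a => lt_irrefl _
            trans := fun a b c h1 h2 => lt_trans h1 h2 }
  · rintro f g k ⟨i, hi, hlt⟩
    refine ⟨i, fun j hj => ?_, ?_⟩
    · have := hi j hj
      change art m g _ = art m k _ at this
      change art m (f * g) _ = art m (f * k) _
      rw [map_mul, map_mul, MulAut.mul_apply, MulAut.mul_apply, this]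
    · change art m g _ < art m k _ at hlt
      change art m (f * g) _ < art m (f * k) _
      rw [map_mul, map_mul, MulAut.mul_apply, MulAut.mul_apply]
      exact art_mono f hlt

end BraidLO

/-- for every `n ≥ 2`, the braid group `B_n` is left-orderable. -/
theorem braidGroup_leftOrderable (n : ℕ) (hn : 2 ≤ n) :
    LeftOrderable (BraidGroup n) := by
  obtain ⟨m, rfl⟩ : ∃ m, n = m + 1 := ⟨n - 1, by omega⟩
  exact BraidLO.main m
end

section
/- (Rivas) Let G and H be nontrivial left-orderable groups, and let G ∗ H denote their free product. For every positive cone P of a left-ordering of G ∗ H and every finite subset S ⊆ P, there exists a positive cone P′ of a left-ordering of G ∗ H with P′ ≠ P and S ⊆ P′. (Hence the space of left-orderings LO(G ∗ H) has no isolated points.) -/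
/-- A positive cone of a left-ordering of a group: a subsemigroup `P` such that
`1 ∉ P` and every nonidentity element lies in exactly one of `P` and `P⁻¹`. -/
def IsLeftOrderCone {G : Type*} [Group G] (P : Set G) : Prop :=
  (1 : G) ∉ P ∧ (∀ a ∈ P, ∀ b ∈ P, a * b ∈ P) ∧
    ∀ g : G, g ≠ 1 → Xor' (g ∈ P) (g⁻¹ ∈ P)

universe u

/-- Contracting by `1/2` above `m` in an ordered rational vector space. -/
theorem exists_contraction {V : Type*} [AddCommGroup V] [LinearOrder V] [IsOrderedAddMonoid V]
    [Module ℚ V] (m a b : V) (hm : m < b) (hab : b + m < a + a) :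
    ∃ f : V ≃o V, (∀ x ≤ m, f x = x) ∧ f b < a := by
  classical
  have hh : ∀ c : V, (1 / 2 : ℚ) • c + (1 / 2 : ℚ) • c = c := fun c => by module
  have hmono : ∀ c d : V, c < d → (1 / 2 : ℚ) • c < (1 / 2 : ℚ) • d := by
    intro c d h
    by_contra hn
    have h2 := add_le_add (not_lt.1 hn) (not_lt.1 hn)
    rw [hh, hh] at h2
    exact absurd h (not_lt.2 h2)
  have hkey : ∀ x, m < x → m < (1 / 2 : ℚ) • m + (1 / 2 : ℚ) • x := by
    intro x hx
    calc m = (1 / 2 : ℚ) • m + (1 / 2 : ℚ) • m := (hh m).symm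
      _ < _ := by have := hmono _ _ hx; gcongr
  let F : V → V := fun x => if x ≤ m then x else (1 / 2 : ℚ) • m + (1 / 2 : ℚ) • x
  have hF : StrictMono F := by
    intro x y hxy
    simp only [F]
    split_ifs with h1 h2 h2
    · exact hxy
    · exact lt_of_le_of_lt h1 (hkey y (not_le.1 h2))
    · exact absurd (hxy.le.trans h2) h1
    · have := hmono _ _ hxy; gcongr
  have hs : Function.Surjective F := by
    intro y
    by_cases h : y ≤ m
    · exact ⟨y, by simp [F, h]⟩
    · refine ⟨y + y - m, ?_⟩
      have h1 : ¬ (y + y - m ≤ m) := by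
        rw [not_le, lt_sub_iff_add_lt]
        exact add_lt_add (not_le.1 h) (not_le.1 h)
      simp only [F, h1, if_false]
      module
  refine ⟨hF.orderIsoOfSurjective F hs, ?_, ?_⟩
  · intro x hx
    simp [F, hx]
  · have : ¬ b ≤ m := not_le.2 hm
    simp only [StrictMono.coe_orderIsoOfSurjective, F, this, if_false]
    have := hmono _ _ hab
    calc (1 / 2 : ℚ) • m + (1 / 2 : ℚ) • b = (1 / 2 : ℚ) • (b + m) := by module
      _ < _ := this
      _ = a := by module

theorem exists_space (F : Type u) [Group F] [LinearOrder F]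
    (hmul : ∀ a b c : F, a < b → c * a < c * b) :
    ∃ (V : Type u) (_ : LinearOrder V) (A : F →* (V ≃o V)) (φ : F → V), StrictMono φ ∧
      (∀ g x, A g (φ x) = φ (g * x)) ∧
      ∀ m a b, m < a → a < b → ∃ f : V ≃o V, (∀ x ≤ φ m, f x = x) ∧ f (φ b) < φ a := by
  let V := Lex (F →₀ ℚ)
  have hA : ∀ g : F, StrictMono
      (fun x : V => (toLex (Finsupp.equivMapDomain (Equiv.mulLeft g) (ofLex x)) : V)) := by
    intro g x y hxy
    rw [Finsupp.Lex.lt_iff] at hxy ⊢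
    obtain ⟨i, hi, hlt⟩ := hxy
    refine ⟨g * i, fun j hj => ?_, ?_⟩
    · have := hi (g⁻¹ * j) (by simpa using hmul _ _ g⁻¹ hj)
      simpa [Finsupp.equivMapDomain_apply] using this
    · simpa [Finsupp.equivMapDomain_apply] using hlt
  have hcomp : ∀ (g h : F) (x : F →₀ ℚ), Finsupp.equivMapDomain (Equiv.mulLeft (g * h)) x =
      Finsupp.equivMapDomain (Equiv.mulLeft g) (Finsupp.equivMapDomain (Equiv.mulLeft h) x) := by
    intro g h x
    ext a
    simp only [Finsupp.equivMapDomain_apply, Equiv.mulLeft_symm_apply, mul_inv_rev, mul_assoc]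
  have hone : ∀ (x : F →₀ ℚ), Finsupp.equivMapDomain (Equiv.mulLeft (1 : F)) x = x := by
    intro x
    ext a
    simp only [Finsupp.equivMapDomain_apply, Equiv.mulLeft_symm_apply, inv_one, one_mul]
  let A : F →* (V ≃o V) :=
    { toFun := fun g => (hA g).orderIsoOfSurjective _ (fun y =>
        ⟨toLex (Finsupp.equivMapDomain (Equiv.mulLeft g⁻¹) (ofLex y)), by
          simp only [ofLex_toLex]
          rw [← hcomp, mul_inv_cancel, hone, toLex_ofLex]⟩)
      map_one' := by
        apply RelIso.ext
        intro x
        change toLex (Finsupp.equivMapDomain (Equiv.mulLeft (1 : F)) (ofLex x)) = x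
        rw [hone, toLex_ofLex]
      map_mul' := fun g h => by
        apply RelIso.ext
        intro x
        change toLex (Finsupp.equivMapDomain (Equiv.mulLeft (g * h)) (ofLex x)) =
          toLex (Finsupp.equivMapDomain (Equiv.mulLeft g)
            (Finsupp.equivMapDomain (Equiv.mulLeft h) (ofLex x)))
        rw [hcomp] }
  have hlt : ∀ {x y : F}, x < y →
      (toLex (Finsupp.single y (1 : ℚ)) : V) < toLex (Finsupp.single x (1 : ℚ)) := by
    intro x y h
    rw [Finsupp.Lex.lt_iff]
    refine ⟨x, fun j hj => ?_, ?_⟩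
    · change Finsupp.single y (1 : ℚ) j = Finsupp.single x (1 : ℚ) j
      simp [Finsupp.single_apply, hj.ne', (hj.trans h).ne']
    · change Finsupp.single y (1 : ℚ) x < Finsupp.single x (1 : ℚ) x
      simp [Finsupp.single_apply, h.ne']
  refine ⟨V, inferInstance, A, fun x => - toLex (Finsupp.single x (1 : ℚ)), ?_, ?_, ?_⟩
  · intro x y hxy
    exact neg_lt_neg (hlt hxy)
  · intro g x
    have : (- toLex (Finsupp.single x (1 : ℚ)) : V) = toLex (Finsupp.single x (-1 : ℚ)) := by
      rw [Finsupp.single_neg]; rfl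
    have h2 : (- toLex (Finsupp.single (g * x) (1 : ℚ)) : V)
        = toLex (Finsupp.single (g * x) (-1 : ℚ)) := by
      rw [Finsupp.single_neg]; rfl
    simp only [this, h2]
    change toLex (Finsupp.equivMapDomain (Equiv.mulLeft g) (Finsupp.single x (-1 : ℚ))) = _
    rw [Finsupp.equivMapDomain_single]
    rfl
  · intro m a b hma hab
    refine exists_contraction _ _ _ (neg_lt_neg (hlt (hma.trans hab))) ?_
    rw [← neg_add, ← neg_add, neg_lt_neg_iff, Finsupp.Lex.lt_iff]
    refine ⟨m, fun j hj => ?_, ?_⟩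
    · change (Finsupp.single a (1 : ℚ) + Finsupp.single a 1 : F →₀ ℚ) j
        = (Finsupp.single b (1 : ℚ) + Finsupp.single m 1 : F →₀ ℚ) j
      have h1 := (hj.trans hma).ne'
      have h2 := (hj.trans (hma.trans hab)).ne'
      simp [Finsupp.single_apply, h1, h2, hj.ne']
    · change (Finsupp.single a (1 : ℚ) + Finsupp.single a 1 : F →₀ ℚ) m
        < (Finsupp.single b (1 : ℚ) + Finsupp.single m 1 : F →₀ ℚ) m
      simp [Finsupp.single_apply, hma.ne', (hma.trans hab).ne']

/-- The cone obtained from an action on a linear order, using `P` on the stabilizer. -/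
theorem cone_of_action {F V : Type*} [Group F] [LinearOrder V] (P : Set F)
    (hP : IsLeftOrderCone P) (ρ : F →* (V ≃o V)) (v : V) :
    IsLeftOrderCone {w : F | v < ρ w v ∨ (ρ w v = v ∧ w ∈ P)} := by
  obtain ⟨h1, h2, h3⟩ := hP
  have hinv : ∀ w, ρ w⁻¹ (ρ w v) = v := fun w => by
    rw [← RelIso.mul_apply, ← map_mul]; simp
  refine ⟨by simp [h1], ?_, ?_⟩
  · rintro a (ha | ⟨ha, ha'⟩) b (hb | ⟨hb, hb'⟩)
    · left
      rw [map_mul, RelIso.mul_apply]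
      exact ha.trans ((ρ a).lt_iff_lt.2 hb)
    · left
      rw [map_mul, RelIso.mul_apply, hb]; exact ha
    · left
      rw [map_mul, RelIso.mul_apply]
      exact ha.symm.trans_lt ((ρ a).lt_iff_lt.2 hb)
    · right
      rw [map_mul, RelIso.mul_apply, hb]
      exact ⟨ha, h2 _ ha' _ hb'⟩
  · intro g hg
    have h3g := h3 g hg
    have hi := hinv g
    simp only [Set.mem_setOf_eq]
    rcases lt_trichotomy (ρ g v) v with h | h | h
    · have : v < ρ g⁻¹ v := by
        have := (ρ g⁻¹).lt_iff_lt.2 h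
        rwa [hi] at this
      right
      exact ⟨Or.inl this, by rintro (h' | h'); exacts [lt_asymm h h', h.ne h'.1]⟩
    · rw [h] at hi
      simpa only [h, hi, lt_irrefl, false_or, true_and] using h3g
    · have : ρ g⁻¹ v < v := by
        have := (ρ g⁻¹).lt_iff_lt.2 h
        rwa [hi] at this
      left
      exact ⟨Or.inl h, by rintro (h' | h'); exacts [lt_asymm this h', this.ne h'.1]⟩

/-- The action in which the second factor is conjugated by `f`. -/
def twist {G H V : Type*} [Group G] [Group H] [LinearOrder V]
    (A : Monoid.Coprod G H →* (V ≃o V)) (f : V ≃o V) : Monoid.Coprod G H →* (V ≃o V) :=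
  Monoid.Coprod.lift (A.comp Monoid.Coprod.inl)
    ((MulAut.conj f).toMonoidHom.comp (A.comp Monoid.Coprod.inr))

theorem twist_inl {G H V : Type*} [Group G] [Group H] [LinearOrder V]
    (A : Monoid.Coprod G H →* (V ≃o V)) (f : V ≃o V) (g : G) (x : V) :
    twist A f (Monoid.Coprod.inl g) x = A (Monoid.Coprod.inl g) x := by
  simp [twist]

theorem twist_inr {G H V : Type*} [Group G] [Group H] [LinearOrder V]
    (A : Monoid.Coprod G H →* (V ≃o V)) (f : V ≃o V) (h : H) (x : V) (hx : f x = x) :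
    twist A f (Monoid.Coprod.inr h) x = f (A (Monoid.Coprod.inr h) x) := by
  have : f⁻¹ x = x := by
    conv_lhs => rw [← hx]
    rw [← RelIso.mul_apply]; simp
  simp [twist, this]

theorem exists_good {G H V : Type*} [Group G] [Group H] [LinearOrder V]
    (A : Monoid.Coprod G H →* (V ≃o V)) (φ : Monoid.Coprod G H → V)
    (hφ : ∀ g x, A g (φ x) = φ (g * x)) (S : Finset (Monoid.Coprod G H)) :
    ∃ E : Finset (Monoid.Coprod G H), 1 ∈ E ∧ S ⊆ E ∧
      ∀ f : V ≃o V, (∀ x ∈ E, f (φ x) = φ x) → ∀ x ∈ E, twist A f x (φ 1) = φ x := by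
  classical
  have hone : ∀ w : Monoid.Coprod G H, ∃ E : Finset (Monoid.Coprod G H), 1 ∈ E ∧ w ∈ E ∧
      ∀ f : V ≃o V, (∀ x ∈ E, f (φ x) = φ x) → ∀ x ∈ E, twist A f x (φ 1) = φ x := by
    intro w
    induction w using Monoid.Coprod.induction_on' with
    | one => exact ⟨{1}, by simp, by simp, fun f hf x hx => by
        rw [Finset.mem_singleton.1 hx]; simp⟩
    | inl_mul g x ih =>
      obtain ⟨E, h1, h2, h3⟩ := ih
      refine ⟨insert (Monoid.Coprod.inl g * x) E, by simp [h1], by simp, fun f hf y hy => ?_⟩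
      have hE := h3 f (fun x hx => hf x (Finset.mem_insert_of_mem hx))
      rcases Finset.mem_insert.1 hy with rfl | hy
      · rw [map_mul, RelIso.mul_apply, hE x h2, twist_inl, hφ]
      · exact hE y hy
    | inr_mul g x ih =>
      obtain ⟨E, h1, h2, h3⟩ := ih
      refine ⟨insert (Monoid.Coprod.inr g * x) E, by simp [h1], by simp, fun f hf y hy => ?_⟩
      have hE := h3 f (fun x hx => hf x (Finset.mem_insert_of_mem hx))
      rcases Finset.mem_insert.1 hy with rfl | hy
      · rw [map_mul, RelIso.mul_apply, hE x h2,
          twist_inr _ _ _ _ (hf x (Finset.mem_insert_of_mem h2)), hφ, hf _ hy]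
      · exact hE y hy
  choose E h1 h2 h3 using hone
  refine ⟨(insert 1 S).biUnion E, ?_, ?_, ?_⟩
  · exact Finset.mem_biUnion.2 ⟨1, by simp, h1 1⟩
  · intro s hs
    exact Finset.mem_biUnion.2 ⟨s, by simp [hs], h2 s⟩
  · intro f hf x hx
    obtain ⟨s, hs, hxs⟩ := Finset.mem_biUnion.1 hx
    exact h3 s f (fun y hy => hf y (Finset.mem_biUnion.2 ⟨s, hs, hy⟩)) x hxs

/-- The linear order attached to a cone. -/
noncomputable def coneOrder {F : Type*} [Group F] (P : Set F) (hP : IsLeftOrderCone P) :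
    LinearOrder F := by
  classical
  exact
  { le := fun a b => a = b ∨ a⁻¹ * b ∈ P
    lt := fun a b => a⁻¹ * b ∈ P
    le_refl := fun a => Or.inl rfl
    le_trans := by
      rintro a b c (rfl | h) (rfl | h')
      · exact Or.inl rfl
      · exact Or.inr h'
      · exact Or.inr h
      · right
        have := hP.2.1 _ h _ h'
        simpa [mul_assoc] using this
    lt_iff_le_not_ge := by
      intro a b
      constructor
      · intro h
        refine ⟨Or.inr h, ?_⟩
        rintro (rfl | h')
        · exact hP.1 (by simpa using h)
        · exact hP.1 (by simpa [mul_assoc] using hP.2.1 _ h _ h')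
      · rintro ⟨rfl | h, h'⟩
        · exact absurd (Or.inl rfl) h'
        · exact h
    le_antisymm := by
      rintro a b (rfl | h) (h' | h')
      · rfl
      · rfl
      · exact h'.symm
      · exact absurd (by simpa [mul_assoc] using hP.2.1 _ h _ h') hP.1
    le_total := by
      intro a b
      by_cases hab : a = b
      · exact Or.inl (Or.inl hab)
      · have := hP.2.2 (a⁻¹ * b) (by rwa [Ne, inv_mul_eq_one])
        rcases this with h | h
        · exact Or.inl (Or.inr h.1)
        · exact Or.inr (Or.inr (by simpa using h.1))
    toDecidableLE := Classical.decRel _ }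

theorem exists_pos_letter {F K : Type*} [Group F] [LinearOrder F]
    (hmul : ∀ a b c : F, a < b → c * a < c * b) (m : F) [Group K] [Nontrivial K] (i : K →* F)
    (hi : Function.Injective i) : ∃ k : K, k ≠ 1 ∧ m < i k * m := by
  obtain ⟨k, hk⟩ := exists_ne (1 : K)
  have hne : i k * m ≠ m := by
    rw [Ne, mul_eq_right]
    exact fun h => hk (hi (by simpa using h))
  rcases lt_or_gt_of_ne hne with h | h
  · refine ⟨k⁻¹, by simpa using hk, ?_⟩
    have := hmul _ _ (i k)⁻¹ h
    simpa using this
  · exact ⟨k, hk, h⟩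

theorem freeProduct_leftOrderings_not_isolated
    {G H : Type*} [Group G] [Group H] [Nontrivial G] [Nontrivial H]
    (hG : LeftOrderable G) (hH : LeftOrderable H)
    (P : Set (Monoid.Coprod G H)) (hP : IsLeftOrderCone P)
    (S : Finset (Monoid.Coprod G H)) (hS : ↑S ⊆ P) :
    ∃ P' : Set (Monoid.Coprod G H), IsLeftOrderCone P' ∧ P' ≠ P ∧ ↑S ⊆ P' := by
  letI := coneOrder P hP
  have hlt : ∀ a b : Monoid.Coprod G H, a < b ↔ a⁻¹ * b ∈ P := fun a b => Iff.rfl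
  have hmul : ∀ a b c : Monoid.Coprod G H, a < b → c * a < c * b := by
    intro a b c h
    rw [hlt] at h ⊢
    simpa [mul_assoc] using h
  obtain ⟨V, _, A, φ, hmono, hφ, hf⟩ := exists_space _ hmul
  obtain ⟨E, h1, hSE, hE⟩ := exists_good A φ hφ S
  obtain ⟨m, hmE, hm⟩ := E.exists_max_image id ⟨1, h1⟩
  simp only [id] at hm
  obtain ⟨g, hg1, hg⟩ := exists_pos_letter hmul m Monoid.Coprod.inl
    (Monoid.Coprod.inl_injective (M := G) (N := H))
  obtain ⟨h, hh1, hh⟩ := exists_pos_letter hmul m Monoid.Coprod.inr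
    (Monoid.Coprod.inr_injective (M := G) (N := H))
  have hne : (Monoid.Coprod.inl g * m : Monoid.Coprod G H) ≠ Monoid.Coprod.inr h * m := by
    intro he
    have := congrArg Monoid.Coprod.fst (mul_right_cancel he)
    simp at this
    exact hg1 this
  have hex : ∃ f : V ≃o V, (∀ x ≤ φ m, f x = x) ∧
      ((Monoid.Coprod.inl g * m < Monoid.Coprod.inr h * m ∧
          f (φ (Monoid.Coprod.inr h * m)) < φ (Monoid.Coprod.inl g * m)) ∨
        (Monoid.Coprod.inr h * m < Monoid.Coprod.inl g * m ∧
          φ (Monoid.Coprod.inl g * m) < f (φ (Monoid.Coprod.inr h * m)))) := by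
    rcases lt_or_gt_of_ne hne with hl | hl
    · obtain ⟨f, hf1, hf2⟩ := hf m _ _ hg hl
      exact ⟨f, hf1, Or.inl ⟨hl, hf2⟩⟩
    · obtain ⟨f, hf1, hf2⟩ := hf m _ _ hh hl
      refine ⟨f.symm, fun x hx => ?_, Or.inr ⟨hl, ?_⟩⟩
      · rw [OrderIso.symm_apply_eq, hf1 x hx]
      · rwa [OrderIso.lt_symm_apply]
  obtain ⟨f, hf1, hf2⟩ := hex
  have hEf := hE f (fun x hx => hf1 _ (hmono.monotone (hm x hx)))
  refine ⟨_, cone_of_action P hP (twist A f) (φ 1), ?_, ?_⟩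
  · intro heq
    have e1 : twist A f (Monoid.Coprod.inl g * m) (φ 1) = φ (Monoid.Coprod.inl g * m) := by
      rw [map_mul, RelIso.mul_apply, hEf m hmE, twist_inl, hφ]
    have e2 : twist A f (Monoid.Coprod.inr h * m) (φ 1) = f (φ (Monoid.Coprod.inr h * m)) := by
      rw [map_mul, RelIso.mul_apply, hEf m hmE, twist_inr _ _ _ _ (hf1 _ le_rfl), hφ]
    generalize (Monoid.Coprod.inl g * m : Monoid.Coprod G H) = a at *
    generalize (Monoid.Coprod.inr h * m : Monoid.Coprod G H) = b at *
    have e3 : twist A f a (twist A f (a⁻¹ * b) (φ 1)) = twist A f b (φ 1) := by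
      rw [← RelIso.mul_apply, ← map_mul, mul_inv_cancel_left]
    have hw : a⁻¹ * b ∈ {w | φ 1 < twist A f w (φ 1) ∨ twist A f w (φ 1) = φ 1 ∧ w ∈ P} ↔
        a < b := by rw [heq]; rfl
    rcases hf2 with ⟨hl, hr⟩ | ⟨hl, hr⟩
    · have : twist A f (a⁻¹ * b) (φ 1) < φ 1 := by
        rw [← (twist A f a).lt_iff_lt, e3, e1, e2]; exact hr
      rcases hw.2 hl with h' | h'
      · exact lt_asymm this h'
      · exact this.ne h'.1
    · have : φ 1 < twist A f (a⁻¹ * b) (φ 1) := by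
        rw [← (twist A f a).lt_iff_lt, e3, e1, e2]; exact hr
      exact lt_asymm hl (hw.1 (Or.inl this))
  · intro s hs
    left
    rw [hEf s (hSE hs)]
    apply hmono
    rw [hlt]
    simpa using hS hs
end

section
/- (Linnell) For any group G, the set of positive cones of left-orderings of G is either finite or uncountable; equivalently, no group has a countably infinite number of left-orderings. -/
namespace Linnell

/-- The set of all left orders. -/
def LO (G : Type*) [Group G] : Set (Set G) := {P | IsLeftOrderCone P}

/-- Real characters. -/
def Hm {G : Type*} [Group G] (φ : G → ℝ) : Prop := ∀ x y, φ (x * y) = φ x + φ y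

section Basic
variable {G : Type*} [Group G]

lemma cone_mk {P : Set G} (h1 : (1 : G) ∉ P) (hm : ∀ a ∈ P, ∀ b ∈ P, a * b ∈ P)
    (ht : ∀ g : G, g ≠ 1 → g ∈ P ∨ g⁻¹ ∈ P) : IsLeftOrderCone P := by
  refine ⟨h1, hm, fun g hg => ?_⟩
  have : ¬ (g ∈ P ∧ g⁻¹ ∈ P) := fun h => h1 (by simpa using hm _ h.1 _ h.2)
  rcases ht g hg with h | h
  · exact Or.inl ⟨h, fun h' => this ⟨h, h'⟩⟩
  · exact Or.inr ⟨h, fun h' => this ⟨h', h⟩⟩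

lemma cone_total {P : Set G} (hP : IsLeftOrderCone P) (g : G) (hg : g ≠ 1) : g ∈ P ∨ g⁻¹ ∈ P := by
  rcases hP.2.2 g hg with h | h
  · exact Or.inl h.1
  · exact Or.inr h.1

lemma cone_anti {P : Set G} (hP : IsLeftOrderCone P) {g : G} (hg : g ∈ P) : g⁻¹ ∉ P :=
  fun h => hP.1 (by simpa using hP.2.1 _ hg _ h)

/-- The linear order of a cone. -/
@[reducible]
noncomputable def coneOrder {P : Set G} (hP : IsLeftOrderCone P) : LinearOrder G where
  le x y := x = y ∨ x⁻¹ * y ∈ P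
  lt x y := x⁻¹ * y ∈ P
  le_refl x := Or.inl rfl
  le_trans x y z := by
    rintro (rfl | h) (rfl | h')
    · exact Or.inl rfl
    · exact Or.inr h'
    · exact Or.inr h
    · right
      have := hP.2.1 _ h _ h'
      simpa [mul_assoc] using this
  le_antisymm x y := by
    rintro (rfl | h) (h' | h')
    · rfl
    · rfl
    · exact h'.symm
    · exact absurd h' (by simpa using cone_anti hP h)
  lt_iff_le_not_ge x y := by
    constructor
    · intro h
      refine ⟨Or.inr h, ?_⟩
      rintro (rfl | h')
      · exact hP.1 (by simpa using h)
      · exact absurd h' (by simpa using cone_anti hP h)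
    · rintro ⟨rfl | h, h'⟩
      · exact absurd (Or.inl rfl) h'
      · exact h
  le_total x y := by
    by_cases h : x = y
    · exact Or.inl (Or.inl h)
    · rcases cone_total hP (x⁻¹ * y) (by rwa [Ne, inv_mul_eq_one]) with h' | h'
      · exact Or.inl (Or.inr h')
      · exact Or.inr (Or.inr (by simpa using h'))
  toDecidableLE := Classical.decRel _

lemma cone_leftStrict {P : Set G} (hP : IsLeftOrderCone P) :
    letI := coneOrder hP
    ∀ a x y : G, x < y → a * x < a * y := by
  intro a x y h
  change (a * x)⁻¹ * (a * y) ∈ P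
  have h' : x⁻¹ * y ∈ P := h
  simpa [mul_assoc] using h'

/-- General lexicographic construction. -/
lemma lexCone (s μ : G → ℝ) (R : Set G) (hμ : ∀ x, 0 < μ x)
    (hs : ∀ x y, s (x * y) = s x + μ x * s y) (h1 : (1 : G) ∉ R)
    (hm : ∀ a b, s a = 0 → s b = 0 → a ∈ R → b ∈ R → a * b ∈ R)
    (ht : ∀ g : G, s g = 0 → g ≠ 1 → g ∈ R ∨ g⁻¹ ∈ R) :
    IsLeftOrderCone {x | 0 < s x ∨ s x = 0 ∧ x ∈ R} := by
  have s1 : s 1 = 0 := by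
    have := hs 1 1
    rw [mul_one] at this
    have h2 := hμ 1
    have : μ 1 * s 1 = 0 := by linarith
    rcases mul_eq_zero.1 this with h | h
    · linarith
    · exact h
  have sinv : ∀ x, s x + μ x * s x⁻¹ = 0 := fun x => by rw [← hs, mul_inv_cancel, s1]
  apply cone_mk
  · simp [s1, h1]
  · rintro a ha b hb
    have key : 0 < s a → 0 ≤ s b → 0 < s (a * b) := fun h h' => by
      rw [hs]; have := mul_nonneg (hμ a).le h'; linarith
    rcases ha with ha | ⟨ha, ha'⟩ <;> rcases hb with hb | ⟨hb, hb'⟩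
    · exact Or.inl (key ha hb.le)
    · exact Or.inl (key ha hb.ge)
    · left; rw [hs]; have := mul_pos (hμ a) hb; linarith
    · right; exact ⟨by rw [hs, ha, hb]; simp, hm a b ha hb ha' hb'⟩
  · intro g hg
    rcases lt_trichotomy (s g) 0 with h | h | h
    · right; left
      have := sinv g
      by_contra hh
      have := mul_nonpos_of_nonneg_of_nonpos (hμ g).le (not_lt.1 hh)
      linarith
    · have h' : s g⁻¹ = 0 := by
        have := sinv g
        rw [h, zero_add] at this
        exact (mul_eq_zero.1 this).resolve_left (hμ g).ne'
      rcases ht g h hg with h2 | h2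
      · exact Or.inl (Or.inr ⟨h, h2⟩)
      · exact Or.inr (Or.inr ⟨h', h2⟩)
    · exact Or.inl (Or.inl h)

lemma lexCone' (s μ : G → ℝ) {P : Set G} (hP : IsLeftOrderCone P) (hμ : ∀ x, 0 < μ x)
    (hs : ∀ x y, s (x * y) = s x + μ x * s y) :
    IsLeftOrderCone {x | 0 < s x ∨ s x = 0 ∧ x ∈ P} :=
  lexCone s μ P hμ hs hP.1 (fun a b _ _ ha hb => hP.2.1 a ha b hb)
    (fun g _ hg => cone_total hP g hg)

lemma uncountable_of_inj {ι : Type*} [Uncountable ι] (F : ι → Set G)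
    (hF : ∀ i, IsLeftOrderCone (F i)) (hinj : Function.Injective F) : ¬ (LO G).Countable := by
  intro h
  have h1 : (Set.range F).Countable := h.mono (by rintro _ ⟨i, rfl⟩; exact hF i)
  have h2 : Countable (Set.range F) := h1
  have : Countable ι := (Equiv.ofInjective F hinj).countable_iff.2 h2
  exact not_countable this

lemma uncountable_of_sep (s : ℝ → G → ℝ) (μ : G → ℝ) {P : Set G} (hP : IsLeftOrderCone P)
    (hμ : ∀ x, 0 < μ x)
    (hs : ∀ t x y, s t (x * y) = s t x + μ x * s t y)
    (hsep : ∀ t t', t < t' → ∃ x, s t x < 0 ∧ 0 < s t' x) : ¬ (LO G).Countable := by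
  refine uncountable_of_inj (fun t => {x | 0 < s t x ∨ s t x = 0 ∧ x ∈ P})
    (fun t => lexCone' (s t) μ hP hμ (hs t)) ?_
  have aux : ∀ t t', t < t' → {x | 0 < s t x ∨ s t x = 0 ∧ x ∈ P} ≠
      {x | 0 < s t' x ∨ s t' x = 0 ∧ x ∈ P} := by
    intro t t' htt h
    obtain ⟨x, hx, hx'⟩ := hsep t t' htt
    have : x ∈ {x | 0 < s t' x ∨ s t' x = 0 ∧ x ∈ P} := Or.inl hx'
    rw [← h] at this
    rcases this with h | ⟨h, _⟩ <;> linarith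
  intro t t' h
  rcases lt_trichotomy t t' with h' | h' | h'
  · exact absurd h (aux _ _ h')
  · exact h'
  · exact absurd h.symm (aux _ _ h')

lemma Hm.one {φ : G → ℝ} (h : Hm φ) : φ 1 = 0 := by have := h 1 1; simp at this; exact this
lemma Hm.inv {φ : G → ℝ} (h : Hm φ) (x : G) : φ x⁻¹ = - φ x := by
  have := h x x⁻¹; rw [mul_inv_cancel, h.one] at this; linarith
lemma Hm.pow {φ : G → ℝ} (h : Hm φ) (x : G) (n : ℕ) : φ (x ^ n) = n * φ x := by
  induction n with
  | zero => simp [h.one]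
  | succ n ih => rw [pow_succ, h, ih]; push_cast; ring
lemma Hm.zpow {φ : G → ℝ} (h : Hm φ) (x : G) (n : ℤ) : φ (x ^ n) = n * φ x := by
  obtain ⟨m, rfl | rfl⟩ := n.eq_nat_or_neg
  · simp [h.pow]
  · simp [h.pow, h.inv]

/-- The kernel. -/
def Hm.ker {φ : G → ℝ} (h : Hm φ) : Subgroup G where
  carrier := {x | φ x = 0}
  mul_mem' := by intro a b ha hb; simp only [Set.mem_ofPred_eq] at *; rw [h, ha, hb, add_zero]
  one_mem' := h.one
  inv_mem' := by intro a ha; simp only [Set.mem_ofPred_eq] at *; rw [h.inv, ha, neg_zero]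

lemma Hm.mem_ker {φ : G → ℝ} (h : Hm φ) {x : G} : x ∈ h.ker ↔ φ x = 0 := Iff.rfl

/-- Two independent characters. -/
lemma two_hom {P : Set G} (hP : IsLeftOrderCone P) (hc : (LO G).Countable) {φ ψ : G → ℝ}
    (hφ : Hm φ) (hψ : Hm ψ) (g h : G) : φ g * ψ h = φ h * ψ g := by
  by_contra hne
  set d := φ g * ψ h - φ h * ψ g with hd
  have hd0 : d ≠ 0 := fun h => hne (by linarith)
  -- α g = 1, α h = 0; β g = 0, β h = 1
  refine uncountable_of_sep
    (fun t x => ((φ x * ψ h - φ h * ψ x) + t * (φ g * ψ x - φ x * ψ g)) / d) (fun _ => 1)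
    hP (fun _ => one_pos) (fun t x y => by rw [hφ, hψ]; ring) ?_ hc
  intro t t' htt
  obtain ⟨q, hq1, hq2⟩ := exists_rat_btwn htt
  refine ⟨g ^ (-q.num) * h ^ (q.den), ?_, ?_⟩ <;>
  · have hden : (0 : ℝ) < q.den := by exact_mod_cast q.den_pos
    have hqq : (q : ℝ) = q.num / q.den := by exact_mod_cast (Rat.num_div_den q).symm
    rw [hqq] at hq1 hq2
    rw [lt_div_iff₀ hden] at hq1
    rw [div_lt_iff₀ hden] at hq2
    rw [hφ, hψ, hφ.zpow, hψ.zpow, hφ.pow, hψ.pow]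
    push_cast
    have : ∀ t : ℝ, (((-(q.num : ℝ) * φ g + q.den * φ h) * ψ h -
      φ h * (-(q.num : ℝ) * ψ g + q.den * ψ h)) + t * (φ g * (-(q.num : ℝ) * ψ g + q.den * ψ h)
        - (-(q.num : ℝ) * φ g + q.den * φ h) * ψ g)) / d = - q.num + t * q.den := by
      intro t
      rw [div_eq_iff hd0, hd]; ring
    rw [this]; linarith

/-- Rank one. -/
lemma rank_one {P : Set G} (hP : IsLeftOrderCone P) (hc : (LO G).Countable) {φ : G → ℝ}
    (hφ : Hm φ) (t : G) (ht : φ t ≠ 0) (g : G) : ∃ k : ℕ, 0 < k ∧ ∃ l : ℤ, k * φ g = l * φ t := by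
  have hmem : φ g ∈ Submodule.span ℚ {φ t} := by
    by_contra hn
    obtain ⟨f, hf, hf'⟩ := Submodule.exists_le_ker_of_notMem hn
    have hft : f (φ t) = 0 := hf' (Submodule.mem_span_singleton_self _)
    have := two_hom hP hc hφ (ψ := fun x => ((f (φ x) : ℚ) : ℝ))
      (fun x y => by simp [hφ x y]) g t
    simp only [hft] at this
    simp at this
    tauto
  obtain ⟨q, hq⟩ := Submodule.mem_span_singleton.1 hmem
  refine ⟨q.den, q.den_pos, q.num, ?_⟩
  rw [← hq, Rat.smul_def]
  have hden : (q.den : ℝ) ≠ 0 := by exact_mod_cast q.den_nz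
  have hqq : (q : ℝ) = q.num / q.den := by exact_mod_cast (Rat.num_div_den q).symm
  rw [hqq]; field_simp

end Basic
end Linnell

namespace Linnell
section Orbit
variable {G : Type*} [Group G]

/-- Conjugation of sets. -/
def cj (g : G) (P : Set G) : Set G := {x | g⁻¹ * x * g ∈ P}

lemma cj_cone (g : G) {P : Set G} (hP : IsLeftOrderCone P) : IsLeftOrderCone (cj g P) := by
  apply cone_mk
  · simpa [cj] using hP.1
  · intro a ha b hb
    have := hP.2.1 _ ha _ hb
    simpa [cj, mul_assoc] using this
  · intro x hx
    have := cone_total hP (g⁻¹ * x * g) (by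
      intro h; apply hx
      have : x = g * (g⁻¹ * x * g) * g⁻¹ := by group
      rw [this, h]; group)
    simpa [cj, mul_assoc] using this

/-- `P` is invariant under conjugation by the normal finite index subgroup `H`. -/
structure FO (P : Set G) (H : Subgroup G) (e : ℕ) : Prop where
  cone : IsLeftOrderCone P
  normal : H.Normal
  fin : H.FiniteIndex
  epos : 0 < e
  pow_mem : ∀ g : G, g ^ e ∈ H
  conj : ∀ h ∈ H, ∀ p ∈ P, h⁻¹ * p * h ∈ P

lemma FO_of_finite {P : Set G} (hP : IsLeftOrderCone P) (hf : (Set.range fun g => cj g P).Finite) :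
    ∃ H e, FO P H e := by
  let _ : MulAction G (Set G) :=
    { smul := cj
      one_smul := fun P => by change cj 1 P = P; ext x; simp [cj]
      mul_smul := fun a b P => by
        change cj (a * b) P = cj a (cj b P)
        ext x; simp [cj, mul_assoc] }
  have hidx : (MulAction.stabilizer G P).index = (MulAction.orbit G P).ncard :=
    MulAction.index_stabilizer G P
  have hne : (MulAction.orbit G P).ncard ≠ 0 := by
    exact Set.ncard_ne_zero_of_mem (MulAction.mem_orbit_self P) hf
  have : (MulAction.stabilizer G P).FiniteIndex := ⟨by rw [hidx]; exact hne⟩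
  refine ⟨(MulAction.stabilizer G P).normalCore, (MulAction.stabilizer G P).normalCore.index,
    hP, inferInstance, inferInstance, Nat.pos_of_ne_zero Subgroup.FiniteIndex.index_ne_zero,
    fun g => Subgroup.pow_index_mem _ g, ?_⟩
  intro h hh p hp
  have h1 : h ∈ MulAction.stabilizer G P := Subgroup.normalCore_le _ hh
  have h2 : cj h P = P := h1
  rw [← h2] at hp
  exact hp

/-- Conjugation of functions. -/
def cb (g : G) (p : G → Bool) : G → Bool := fun x => p (g⁻¹ * x * g)

lemma cb_cont (g : G) : Continuous (cb g) := continuous_pi fun _ => continuous_apply _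

lemma cb_cb (g h : G) (p : G → Bool) : cb g (cb h p) = cb (g * h) p := by
  ext x; simp [cb, mul_assoc]

lemma cb_one (p : G → Bool) : cb 1 p = p := by
  ext x; simp [cb]

lemma exists_FO (hne : (LO G).Nonempty) (hc : (LO G).Countable) : ∃ P : Set G, ∃ H e, FO P H e := by
  classical
  let T : (G → Bool) → Set G := fun p => {x | p x = true}
  have Tinj : Function.Injective T := by
    intro p q h
    ext x
    have := Set.ext_iff.1 h x
    simp only [T, Set.mem_ofPred_eq] at this
    cases hp : p x <;> cases hq : q x <;> simp_all
  have Tcj : ∀ g p, T (cb g p) = cj g (T p) := fun g p => rfl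
  let K0 : Set (G → Bool) := {p | IsLeftOrderCone (T p)}
  have hK0 : IsClosed K0 := by
    have : K0 = {p | p 1 = false} ∩ (⋂ a : G, ⋂ b : G, {p | p a = false ∨ p b = false ∨ p (a * b) = true})
        ∩ (⋂ g : G, {p | g = 1 ∨ p g = true ∨ p g⁻¹ = true}) := by
      ext p
      simp only [K0, Set.mem_ofPred_eq, Set.mem_inter_iff, Set.mem_iInter]
      constructor
      · intro h
        refine ⟨⟨by simpa [T] using h.1, fun a b => ?_⟩, fun g => ?_⟩
        · by_contra hh
          push Not at hh
          exact hh.2.2 (h.2.1 a (by simpa [T] using hh.1) b (by simpa [T] using hh.2.1))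
        · by_cases hg : g = 1
          · exact Or.inl hg
          · exact Or.inr (cone_total h g hg)
      · rintro ⟨⟨h1, h2⟩, h3⟩
        refine cone_mk (by simpa [T] using h1) ?_ fun g hg => (h3 g).resolve_left hg
        intro a ha b hb
        have ha' : p a = true := ha
        have hb' : p b = true := hb
        have := h2 a b
        change p (a * b) = true
        simpa [ha', hb'] using this
    rw [this]
    have ev : ∀ (a : G) (b : Bool), IsClosed {p : G → Bool | p a = b} := fun a b =>
      isClosed_eq (continuous_apply a) continuous_const
    refine ((ev _ _).inter (isClosed_iInter fun a => isClosed_iInter fun b => ?_)).inter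
      (isClosed_iInter fun g => ?_)
    · exact (ev _ _).union ((ev _ _).union (ev _ _))
    · exact isClosed_const.union ((ev _ _).union (ev _ _))
  have hK0c : K0.Countable := by
    have := hc.preimage_of_injOn (f := T) Tinj.injOn
    exact this
  let S : Set (Set (G → Bool)) := {K | K ⊆ K0 ∧ IsClosed K ∧ K.Nonempty ∧ ∀ g, ∀ p ∈ K, cb g p ∈ K}
  have hS0 : K0 ∈ S := by
    refine ⟨le_rfl, hK0, ?_, fun g p hp => ?_⟩
    · obtain ⟨P, hP⟩ := hne
      refine ⟨fun x => decide (x ∈ P), ?_⟩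
      have : T (fun x => decide (x ∈ P)) = P := by ext x; simp [T]
      change IsLeftOrderCone _
      rw [this]; exact hP
    · exact cj_cone g hp
  obtain ⟨K, hKK0, hKmin⟩ := zorn_superset_nonempty S (by
    intro c hcS hchain hcne
    refine ⟨⋂₀ c, ⟨?_, ?_, ?_, ?_⟩, fun s hs => Set.sInter_subset_of_mem hs⟩
    · obtain ⟨s, hs⟩ := hcne
      exact (Set.sInter_subset_of_mem hs).trans (hcS hs).1
    · exact isClosed_sInter fun s hs => (hcS hs).2.1
    · have : Nonempty c := hcne.to_subtype
      refine IsCompact.nonempty_sInter_of_directed_nonempty_isCompact_isClosed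
        (S := c) ?_ (fun s hs => (hcS hs).2.2.1)
        (fun s hs => (hcS hs).2.1.isCompact) (fun s hs => (hcS hs).2.1)
      intro x hx y hy
      rcases hchain.total hx hy with h | h
      · exact ⟨x, hx, le_rfl, h⟩
      · exact ⟨y, hy, h, le_rfl⟩
    · intro g p hp s hs
      exact (hcS hs).2.2.2 g p (hp s hs)) K0 hS0
  have hKS : K ∈ S := hKmin.1
  obtain ⟨hK1, hK2, hK3, hK4⟩ := hKS
  have : CompactSpace K := isCompact_iff_compactSpace.1 hK2.isCompact
  have : Countable K := (hK0c.mono hK1).to_subtype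
  have : Nonempty K := hK3.to_subtype
  obtain ⟨p, hp⟩ := nonempty_interior_of_iUnion_of_closed (X := K) (f := fun p : K => {p})
    (fun p => isClosed_singleton) (by ext x; simp)
  obtain ⟨q, hq⟩ := hp
  have hqo : IsOpen ({p} : Set K) := by
    have hqp : q = p := Set.mem_singleton_iff.1 (interior_subset hq)
    subst hqp
    have : interior ({q} : Set K) = {q} := by
      apply Set.Subset.antisymm interior_subset
      rintro _ rfl; exact hq
    rw [← this]; exact isOpen_interior
  obtain ⟨U, hU, hUp⟩ := isOpen_induced_iff.1 hqo
  have hUK : ∀ x ∈ K, x ∈ U → x = p := by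
    intro x hx hxU
    have : (⟨x, hx⟩ : K) ∈ ({p} : Set K) := by rw [← hUp]; exact hxU
    exact congrArg Subtype.val this
  have hpU : (p : G → Bool) ∈ U := by
    have : p ∈ Subtype.val ⁻¹' U := by rw [hUp]; rfl
    exact this
  have hcov : K ⊆ ⋃ g : G, (cb g) ⁻¹' U := by
    by_contra hncov
    obtain ⟨r, hrK, hrU⟩ := Set.not_subset.1 hncov
    have hK' : K ∩ (⋃ g : G, (cb g) ⁻¹' U)ᶜ ∈ S := by
      refine ⟨Set.inter_subset_left.trans hK1, hK2.inter ?_, ⟨r, hrK, hrU⟩, ?_⟩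
      · exact (isOpen_iUnion fun g => hU.preimage (cb_cont g)).isClosed_compl
      · rintro g x ⟨hx, hx'⟩
        refine ⟨hK4 g x hx, fun hh => hx' ?_⟩
        simp only [Set.mem_iUnion, Set.mem_preimage] at hh ⊢
        obtain ⟨i, hi⟩ := hh
        exact ⟨i * g, by rwa [← cb_cb]⟩
    have := hKmin.2 hK' Set.inter_subset_left p.2
    apply this.2
    simp only [Set.mem_iUnion, Set.mem_preimage]
    exact ⟨1, by rwa [cb_one]⟩
  obtain ⟨t, ht⟩ := hK2.isCompact.elim_finite_subcover _ (fun g => hU.preimage (cb_cont g)) hcov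
  have hKfin : K.Finite := by
    refine (t.finite_toSet.image fun g => cb g⁻¹ (p : G → Bool)).subset ?_
    intro x hx
    obtain ⟨g, hg, hgx⟩ := Set.mem_iUnion₂.1 (ht hx)
    refine ⟨g, hg, ?_⟩
    have : cb g x = p := hUK _ (hK4 g x hx) hgx
    change cb g⁻¹ (p : G → Bool) = x
    rw [← this, cb_cb, inv_mul_cancel, cb_one]
  refine ⟨T p, FO_of_finite (hK1 p.2) ?_⟩
  refine (hKfin.image T).subset ?_
  rintro _ ⟨g, rfl⟩
  exact ⟨cb g p, hK4 g p p.2, rfl⟩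

lemma FO_of_LO_finite (hf : (LO G).Finite) {P : Set G} (hP : IsLeftOrderCone P) :
    ∃ H e, FO P H e :=
  FO_of_finite hP (hf.subset (by rintro _ ⟨g, rfl⟩; exact cj_cone g hP))

end Orbit
end Linnell

namespace Linnell
section Holder
variable {G : Type*} [Group G] [LinearOrder G]

lemma exists_hom (hL : ∀ a x y : G, x < y → a * x < a * y) (H : Subgroup G) (hHn : H.Normal)
    (hHf : H.FiniteIndex) (hR : ∀ h ∈ H, ∀ x y : G, x < y → x * h < y * h)
    (F : G) (hFH : F ∈ H) (hF : 1 < F) (e : ℕ) (he : 0 < e) (heH : ∀ g : G, g ^ e ∈ H)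
    (cof : ∀ g : G, ∃ n : ℤ, F ^ (-n) ≤ g ∧ g ≤ F ^ n) :
    ∃ τ : G → ℝ, Hm τ ∧ (∀ g, 1 ≤ g → 0 ≤ τ g) ∧ τ F ≠ 0 := by
  have hL' : ∀ a x y : G, x ≤ y → a * x ≤ a * y := fun a x y h => by
    rcases h.eq_or_lt with rfl | h
    · exact le_rfl
    · exact (hL a x y h).le
  have hR' : ∀ h ∈ H, ∀ x y : G, x ≤ y → x * h ≤ y * h := fun a ha x y h => by
    rcases h.eq_or_lt with rfl | h
    · exact le_rfl
    · exact (hR a ha x y h).le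
  have hpow1 : ∀ g : G, 1 ≤ g → ∀ n : ℕ, 1 ≤ g ^ n := by
    intro g hg n
    induction n with
    | zero => simp
    | succ n ih => rw [pow_succ]; exact ih.trans (by simpa using hL' (g ^ n) _ _ hg)
  have hFp : ∀ n : ℕ, 1 < F ^ (n + 1) := by
    intro n
    rw [pow_succ]
    exact (hpow1 F hF.le n).trans_lt (by simpa using hL (F ^ n) _ _ hF)
  have hmono : StrictMono (fun n : ℤ => F ^ n) := by
    intro a b hab
    obtain ⟨k, hk⟩ := Int.eq_ofNat_of_zero_le (show 0 ≤ b - a - 1 by omega)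
    have hb : b = a + ((k + 1 : ℕ) : ℤ) := by push_cast; omega
    have := hL (F ^ a) _ _ (hFp k)
    simp only
    rw [hb, zpow_add, zpow_natCast]
    simpa using this
  have hFn : ∀ n : ℤ, F ^ n ∈ H := fun n => H.zpow_mem hFH n
  have hex : ∀ g : G, ∃ n : ℤ, F ^ n ≤ g ∧ g < F ^ (n + 1) := by
    intro g
    obtain ⟨m, hm1, hm2⟩ := cof g
    obtain ⟨n, hn1, hn2⟩ := Int.exists_greatest_of_bdd (P := fun n => F ^ n ≤ g)
      ⟨m, fun z hz => hmono.le_iff_le.1 (hz.trans hm2)⟩ ⟨_, hm1⟩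
    refine ⟨n, hn1, ?_⟩
    by_contra h
    have := hn2 _ (not_lt.1 h)
    omega
  choose fl fl1 fl2 using hex
  have le_fl : ∀ g n, F ^ n ≤ g → n ≤ fl g := fun g n h => by
    have := hmono.lt_iff_lt.1 (h.trans_lt (fl2 g)); omega
  have fl_lt : ∀ g n, g < F ^ n → fl g < n := fun g n h => hmono.lt_iff_lt.1 ((fl1 g).trans_lt h)
  have fl_mono : ∀ g h, g ≤ h → fl g ≤ fl h := fun g h hh => le_fl _ _ ((fl1 g).trans hh)
  have fl_mul1 : ∀ g h, fl g + fl h ≤ fl (g * h) := by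
    intro g h
    apply le_fl
    rw [zpow_add]
    exact (hR' _ (hFn _) _ _ (fl1 g)).trans (hL' _ _ _ (fl1 h))
  have fl_mul2 : ∀ g h, fl (g * h) ≤ fl g + fl h + 1 := by
    intro g h
    have : fl (g * h) < (fl g + 1) + (fl h + 1) := by
      apply fl_lt
      rw [zpow_add]
      exact (hL _ _ _ (fl2 h)).trans (hR _ (hFn _) _ _ (fl2 g))
    omega
  have fl_pow : ∀ g (n : ℕ), (fl (g ^ n) : ℤ) ≤ n * (fl g + 1) + fl 1 := by
    intro g n
    induction n with
    | zero => simp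
    | succ n ih =>
      have := fl_mul2 (g ^ n) g
      rw [pow_succ]; push_cast; linarith
  have hlim : ∀ g, ∃ l : ℝ, Filter.Tendsto (fun n : ℕ => (fl (g ^ n) : ℝ) / n) Filter.atTop (nhds l) := by
    intro g
    have hsub : Subadditive (fun n : ℕ => -(fl (g ^ n) : ℝ)) := by
      intro m n
      have := fl_mul1 (g ^ m) (g ^ n)
      rw [← pow_add] at this
      have : (fl (g ^ m) : ℝ) + fl (g ^ n) ≤ fl (g ^ (m + n)) := by exact_mod_cast this
      linarith
    have := hsub.tendsto_lim (by
      refine ⟨-(|(fl g : ℝ) + 1| + |(fl 1 : ℝ)|), ?_⟩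
      rintro _ ⟨n, rfl⟩
      simp only
      rcases Nat.eq_zero_or_pos n with rfl | hn
      · have := abs_nonneg ((fl g : ℝ) + 1)
        have := abs_nonneg (fl 1 : ℝ)
        simp; linarith
      · have hn' : (1 : ℝ) ≤ n := by exact_mod_cast hn
        rw [le_div_iff₀ (by linarith)]
        have h1 : (fl (g ^ n) : ℝ) ≤ n * (fl g + 1) + fl 1 := by exact_mod_cast fl_pow g n
        have h2 : (n : ℝ) * (fl g + 1) ≤ n * |(fl g : ℝ) + 1| :=
          mul_le_mul_of_nonneg_left (le_abs_self _) (by linarith)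
        have h3 := le_abs_self (fl 1 : ℝ)
        have h4 : |(fl 1 : ℝ)| ≤ n * |(fl 1 : ℝ)| := le_mul_of_one_le_left (abs_nonneg _) hn'
        nlinarith)
    refine ⟨-hsub.lim, ?_⟩
    have h2 := this.neg
    refine h2.congr fun n => ?_
    ring
  choose χ hχ using hlim
  -- bounded difference gives equal limits
  have bdd0 : ∀ (u : ℕ → ℝ) (l C : ℝ), Filter.Tendsto (fun n : ℕ => u n / n) Filter.atTop (nhds l) →
      (∀ n, |u n| ≤ C) → l = 0 := by
    intro u l C hu hC
    refine tendsto_nhds_unique hu ?_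
    have : Filter.Tendsto (fun n : ℕ => C / (n : ℝ)) Filter.atTop (nhds 0) :=
      tendsto_const_div_atTop_nhds_zero_nat C
    refine squeeze_zero_norm (fun n => ?_) this
    rw [Real.norm_eq_abs, abs_div, Nat.abs_cast]
    exact div_le_div_of_nonneg_right (hC n) (Nat.cast_nonneg n)
  have sandwich : ∀ g ∈ H, ∀ h ∈ H, g * h ≤ h * g → ∀ k : ℕ,
      g ^ k * h ^ k ≤ (g * h) ^ k ∧ (g * h) ^ k ≤ h ^ k * g ^ k := by
    intro g hg h hh hgh
    have c1 : ∀ k : ℕ, g * h ^ k ≤ h ^ k * g := by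
      intro k
      induction k with
      | zero => simp
      | succ k ih =>
        calc g * h ^ (k + 1) = (g * h ^ k) * h := by rw [pow_succ, mul_assoc]
          _ ≤ (h ^ k * g) * h := hR' h hh _ _ ih
          _ = h ^ k * (g * h) := by rw [mul_assoc]
          _ ≤ h ^ k * (h * g) := hL' _ _ _ hgh
          _ = h ^ (k + 1) * g := by rw [pow_succ, mul_assoc]
    have c2 : ∀ k : ℕ, g ^ k * h ≤ h * g ^ k := by
      intro k
      induction k with
      | zero => simp
      | succ k ih =>
        calc g ^ (k + 1) * h = g ^ k * (g * h) := by rw [pow_succ, mul_assoc]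
          _ ≤ g ^ k * (h * g) := hL' _ _ _ hgh
          _ = (g ^ k * h) * g := by rw [mul_assoc]
          _ ≤ (h * g ^ k) * g := hR' g hg _ _ ih
          _ = h * g ^ (k + 1) := by rw [pow_succ, mul_assoc]
    intro k
    induction k with
    | zero => simp
    | succ k ih =>
      constructor
      · calc g ^ (k + 1) * h ^ (k + 1) = g ^ k * ((g * h ^ k) * h) := by
              rw [pow_succ, pow_succ]; simp only [mul_assoc]
          _ ≤ g ^ k * ((h ^ k * g) * h) := hL' _ _ _ (hR' h hh _ _ (c1 k))
          _ = (g ^ k * h ^ k) * (g * h) := by simp only [mul_assoc]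
          _ ≤ (g * h) ^ k * (g * h) := hR' _ (H.mul_mem hg hh) _ _ ih.1
          _ = (g * h) ^ (k + 1) := by rw [pow_succ]
      · calc (g * h) ^ (k + 1) = (g * h) ^ k * (g * h) := by rw [pow_succ]
          _ ≤ (h ^ k * g ^ k) * (g * h) := hR' _ (H.mul_mem hg hh) _ _ ih.2
          _ = h ^ k * (g ^ (k + 1) * h) := by rw [pow_succ]; simp only [mul_assoc]
          _ ≤ h ^ k * (h * g ^ (k + 1)) := hL' _ _ _ (c2 _)
          _ = h ^ (k + 1) * g ^ (k + 1) := by rw [pow_succ h]; simp only [mul_assoc]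
  have χadd : ∀ g ∈ H, ∀ h ∈ H, χ (g * h) = χ g + χ h := by
    intro g hg h hh
    have key : ∀ k : ℕ, |((fl ((g * h) ^ k) : ℝ) - fl (g ^ k) - fl (h ^ k))| ≤ 1 := by
      intro k
      have i1 := fl_mul1 (g ^ k) (h ^ k)
      have i2 := fl_mul2 (g ^ k) (h ^ k)
      have i3 := fl_mul1 (h ^ k) (g ^ k)
      have i4 := fl_mul2 (h ^ k) (g ^ k)
      have : |(fl ((g * h) ^ k) - fl (g ^ k) - fl (h ^ k))| ≤ 1 := by
        rcases le_total (g * h) (h * g) with hle | hle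
        · obtain ⟨s1, s2⟩ := sandwich g hg h hh hle k
          have j1 := fl_mono _ _ s1
          have j2 := fl_mono _ _ s2
          rw [abs_le]; omega
        · -- (g h)^k versus (h g)^k
          have hle' : h⁻¹ * g⁻¹ ≤ g⁻¹ * h⁻¹ := by
            have a1 := hL' (h⁻¹ * g⁻¹) _ _ hle
            have a2 := hR' (g⁻¹ * h⁻¹) (H.mul_mem (H.inv_mem hg) (H.inv_mem hh)) _ _ a1
            have e1 : h⁻¹ * g⁻¹ * (h * g) * (g⁻¹ * h⁻¹) = h⁻¹ * g⁻¹ := by group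
            have e2 : h⁻¹ * g⁻¹ * (g * h) * (g⁻¹ * h⁻¹) = g⁻¹ * h⁻¹ := by group
            rwa [e1, e2] at a2
          have invle : ∀ x ∈ H, ∀ y ∈ H, x ≤ y → y⁻¹ ≤ x⁻¹ := by
            intro x hx y hy hxy
            have a1 := hL' x⁻¹ _ _ hxy
            have a2 := hR' y⁻¹ (H.inv_mem hy) _ _ a1
            simpa [mul_assoc] using a2
          obtain ⟨s1, s2⟩ := sandwich h⁻¹ (H.inv_mem hh) g⁻¹ (H.inv_mem hg) hle' k
          have mg := H.inv_mem hg
          have mh := H.inv_mem hh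
          have t1 := invle _ (H.mul_mem (H.pow_mem mh k) (H.pow_mem mg k)) _
            (H.pow_mem (H.mul_mem mh mg) k) s1
          have t2 := invle _ (H.pow_mem (H.mul_mem mh mg) k) _
            (H.mul_mem (H.pow_mem mg k) (H.pow_mem mh k)) s2
          have e0 : ((h⁻¹ * g⁻¹) ^ k)⁻¹ = (g * h) ^ k := by
            rw [← mul_inv_rev, inv_pow, inv_inv]
          have e1 : (h⁻¹ ^ k * g⁻¹ ^ k)⁻¹ = g ^ k * h ^ k := by
            rw [mul_inv_rev, inv_pow, inv_pow, inv_inv, inv_inv]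
          have e2 : (g⁻¹ ^ k * h⁻¹ ^ k)⁻¹ = h ^ k * g ^ k := by
            rw [mul_inv_rev, inv_pow, inv_pow, inv_inv, inv_inv]
          rw [e0, e1] at t1
          rw [e0, e2] at t2
          have j1 := fl_mono _ _ t1
          have j2 := fl_mono _ _ t2
          rw [abs_le]; omega
      exact_mod_cast this
    have := bdd0 _ (χ (g * h) - χ g - χ h) 1
      ((((hχ (g * h)).sub (hχ g)).sub (hχ h)).congr fun n => by rw [← sub_div, ← sub_div]) key
    linarith
  have χconj : ∀ q h : G, χ (q⁻¹ * h * q) = χ h := by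
    intro q h
    have := bdd0 _ (χ (q⁻¹ * h * q) - χ h) (|(fl q⁻¹ : ℝ)| + |(fl q : ℝ)| + 2)
      (((hχ (q⁻¹ * h * q)).sub (hχ h)).congr fun n => by rw [← sub_div]) (by
        intro k
        have e : (q⁻¹ * h * q) ^ k = q⁻¹ * h ^ k * q := by
          have := conj_pow (i := k) (a := q⁻¹) (b := h)
          simpa using this
        rw [e]
        have i1 := fl_mul1 (q⁻¹ * h ^ k) q
        have i2 := fl_mul2 (q⁻¹ * h ^ k) q
        have i3 := fl_mul1 q⁻¹ (h ^ k)
        have i4 := fl_mul2 q⁻¹ (h ^ k)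
        have : |fl (q⁻¹ * h ^ k * q) - fl (h ^ k)| ≤ |fl q⁻¹| + |fl q| + 2 := by
          have a1 := neg_abs_le (fl q)
          have a2 := le_abs_self (fl q)
          have a3 := neg_abs_le (fl q⁻¹)
          have a4 := le_abs_self (fl q⁻¹)
          rw [abs_le]; constructor <;> linarith
        exact_mod_cast this)
    linarith
  have χF : χ F = 1 := by
    refine tendsto_nhds_unique (hχ F) ?_
    refine tendsto_const_nhds.congr' ?_
    filter_upwards [Filter.eventually_gt_atTop 0] with n hn
    have : fl (F ^ n) = n := by
      have h1 := le_fl (F ^ n) n (by rw [zpow_natCast])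
      have h2 := fl_lt (F ^ n) (n + 1) (by rw [← zpow_natCast]; exact hmono (by simp))
      omega
    rw [this]
    have : (n : ℝ) ≠ 0 := by exact_mod_cast hn.ne'
    simp [this]
  have χpos : ∀ g, 1 ≤ g → 0 ≤ χ g := by
    intro g hg
    refine ge_of_tendsto' (hχ g) fun n => ?_
    have : 0 ≤ fl (g ^ n) := le_fl _ _ (by simpa using hpow1 g hg n)
    have : (0 : ℝ) ≤ fl (g ^ n) := by exact_mod_cast this
    positivity
  -- transfer
  let o : G → G := fun x => (Quotient.out (x : G ⧸ H) : G)
  have ho : ∀ x, (o x)⁻¹ * x ∈ H := fun x => by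
    rw [← QuotientGroup.eq]; exact Quotient.out_eq _
  let θ : G → ℝ := fun x => χ ((o x)⁻¹ * x)
  have hθ : ∀ x, ∀ h ∈ H, θ (x * h) = θ x + χ h := by
    intro x h hh
    have e : o (x * h) = o x := by
      simp only [o]
      congr 1
      rw [QuotientGroup.eq]
      simpa using hh
    simp only [θ, e]
    rw [← mul_assoc, χadd _ (ho x) _ hh]
  have : Fintype (G ⧸ H) := Fintype.ofFinite _
  let v : G → G ⧸ H → ℝ := fun g q => θ (g * q.out) - θ q.out
  have hv : ∀ g x : G, v g (x : G ⧸ H) = θ (g * x) - θ x := by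
    intro g x
    have e : x = o x * ((o x)⁻¹ * x) := by group
    have h1 : θ x = θ (o x) + χ ((o x)⁻¹ * x) := by
      rw [← hθ _ _ (ho x), ← e]
    have h2 : θ (g * x) = θ (g * o x) + χ ((o x)⁻¹ * x) := by
      rw [← hθ _ _ (ho x)]; congr 1; rw [mul_assoc, ← e]
    rw [h1, h2]
    change θ (g * o x) - θ (o x) = _
    ring
  let τ : G → ℝ := fun g => ∑ q, v g q
  have hτ : Hm τ := by
    intro x y
    have : ∑ q, v x (y • q) = ∑ q, v x q := by
      exact (Equiv.sum_comp (MulAction.toPerm y : Equiv.Perm (G ⧸ H)) (v x))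
    simp only [τ]
    rw [← this, ← Finset.sum_add_distrib]
    refine Finset.sum_congr rfl fun q _ => ?_
    obtain ⟨z, rfl⟩ := QuotientGroup.mk_surjective q
    have e : y • (z : G ⧸ H) = ((y * z : G) : G ⧸ H) := rfl
    rw [e, hv, hv, hv, mul_assoc]; ring
  have hτH : ∀ h ∈ H, τ h = Fintype.card (G ⧸ H) * χ h := by
    intro h hh
    have : ∀ q, v h q = χ h := by
      intro q
      obtain ⟨z, rfl⟩ := QuotientGroup.mk_surjective q
      have e : h * z = z * (z⁻¹ * h * z) := by group
      rw [hv, e, hθ _ _ (by simpa using hHn.conj_mem h hh z⁻¹), χconj]; ring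
    simp only [τ, this]
    simp
  have hcard : (0 : ℝ) < Fintype.card (G ⧸ H) := by
    exact_mod_cast Fintype.card_pos
  refine ⟨τ, hτ, fun g hg => ?_, ?_⟩
  · have h1 := hτ.pow g e
    rw [hτH _ (heH g)] at h1
    have h2 := mul_nonneg hcard.le (χpos _ (hpow1 g hg e))
    rw [h1] at h2
    have he' : (0 : ℝ) < e := by exact_mod_cast he
    exact nonneg_of_mul_nonneg_right h2 he'
  · rw [hτH F hFH, χF, mul_one]; exact hcard.ne'

end Holder
end Linnell

namespace Linnell
section Convex
variable {G : Type*} [Group G]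

/-- `g` is bounded by powers of `f`. -/
def Bd [LinearOrder G] (e : ℕ) (f g : G) : Prop := ∃ n : ℤ, (f ^ e) ^ (-n) ≤ g ∧ g ≤ (f ^ e) ^ n

variable [LinearOrder G]

/-- Working hypotheses on an order. -/
structure Good (G : Type*) [Group G] [LinearOrder G] (e : ℕ) : Prop where
  l : ∀ a x y : G, x ≤ y → a * x ≤ a * y
  epos : 0 < e
  r : ∀ g x y : G, x ≤ y → x * g ^ e ≤ y * g ^ e

variable {e : ℕ}

lemma Good.rz (hg : Good G e) (f : G) (n : ℤ) (x y : G) (h : x ≤ y) :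
    x * (f ^ e) ^ n ≤ y * (f ^ e) ^ n := by
  have : (f ^ e) ^ n = (f ^ n) ^ e := by
    rw [← zpow_natCast, ← zpow_natCast, ← zpow_mul, ← zpow_mul, mul_comm]
  rw [this]; exact hg.r _ _ _ h

/-- The convex subgroup generated by `f`. -/
def Bs (hg : Good G e) (f : G) : Subgroup G where
  carrier := {g | Bd e f g}
  mul_mem' := by
    rintro a b ⟨n, h1, h2⟩ ⟨m, h3, h4⟩
    refine ⟨n + m, ?_, ?_⟩
    · rw [neg_add, zpow_add]
      exact (hg.rz f (-m) _ _ h1).trans (hg.l _ _ _ h3)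
    · rw [zpow_add]
      exact (hg.l _ _ _ h4).trans (hg.rz f m _ _ h2)
  one_mem' := ⟨0, by simp, by simp⟩
  inv_mem' := by
    rintro a ⟨n, h1, h2⟩
    refine ⟨n, ?_, ?_⟩
    · have := hg.l a⁻¹ _ _ (hg.rz f (-n) _ _ h2)
      simpa using this
    · have := hg.l a⁻¹ _ _ (hg.rz f n _ _ h1)
      simpa using this

/-- Convexity. -/
def Cvx (C : Subgroup G) : Prop := ∀ x ∈ C, ∀ y ∈ C, ∀ z, x ≤ z → z ≤ y → z ∈ C

lemma Bs_cvx (hg : Good G e) (f : G) : Cvx (Bs hg f) := by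
  rintro x ⟨n, h1, h2⟩ y ⟨m, h3, h4⟩ z hxz hzy
  have pos : ∀ n : ℤ, (f ^ e) ^ (-n) ≤ (f ^ e) ^ n → 1 ≤ (f ^ e) ^ n := by
    intro n hn
    by_contra hh
    have hh := (not_le.1 hh).le
    have := hg.l ((f ^ e) ^ (-n)) _ _ hh
    simp at this
    have h1 : (f ^ e) ^ n = 1 := le_antisymm hh (this.trans (by simpa using hn))
    simp_all
  have pn := pos n (h1.trans h2)
  have pm := pos m (h3.trans h4)
  refine ⟨n + m, ?_, ?_⟩
  · have := hg.l ((f ^ e) ^ (-n) * (f ^ e) ^ (-m)) _ _ pm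
    rw [neg_add, zpow_add]
    refine le_trans ?_ (h1.trans hxz)
    simpa [mul_assoc] using this
  · have := hg.rz f m _ _ pn
    rw [zpow_add]
    refine (hzy.trans h4).trans ?_
    simpa using this

lemma Good.inv1 (hg : Good G e) {x : G} (h : x < 1) : 1 < x⁻¹ := by
  have := hg.l x⁻¹ _ _ h.le
  simp at this
  exact lt_of_le_of_ne this (by intro h'; simp at h'; rw [h'] at h; exact lt_irrefl _ h)

lemma Good.inv2 (hg : Good G e) {x : G} (h : 1 < x) : x⁻¹ < 1 := by
  have := hg.l x⁻¹ _ _ h.le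
  simp at this
  exact lt_of_le_of_ne this (by intro h'; simp at h'; rw [h'] at h; exact lt_irrefl _ h)

lemma Good.pow (hg : Good G e) {x : G} (h : 1 ≤ x) (n : ℕ) : 1 ≤ x ^ n := by
  induction n with
  | zero => simp
  | succ n ih => rw [pow_succ]; exact ih.trans (by simpa using hg.l (x ^ n) _ _ h)

lemma self_mem (hg : Good G e) (f : G) : f ∈ Bs hg f := by
  have key : ∀ f : G, 1 ≤ f → f ∈ Bs hg f := by
    intro f hf
    refine ⟨1, ?_, ?_⟩
    · have h1 : 1 ≤ f ^ e := hg.pow hf e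
      have := hg.l (f ^ e)⁻¹ _ _ h1
      simp at this
      simpa using this.trans hf
    · obtain ⟨k, rfl⟩ : ∃ k, e = k + 1 := ⟨e - 1, by have := hg.epos; omega⟩
      have := hg.l f _ _ (hg.pow hf k)
      rw [zpow_one, pow_succ']
      simpa using this
  rcases le_or_gt 1 f with h | h
  · exact key f h
  · obtain ⟨n, h1, h2⟩ := key f⁻¹ (hg.inv1 h).le
    have : f⁻¹ ∈ Bs hg f := ⟨-n, by simpa using h1, by simpa using h2⟩
    simpa using (Bs hg f).inv_mem this

lemma Bs_le_of_mem (hg : Good G e) {C : Subgroup G} (hC : Cvx C) {f : G} (hf : f ∈ C) :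
    Bs hg f ≤ C := by
  rintro x ⟨n, h1, h2⟩
  exact hC _ (C.zpow_mem (C.pow_mem hf e) _) _ (C.zpow_mem (C.pow_mem hf e) _) x h1 h2

lemma cvx_chain (hg : Good G e) {C D : Subgroup G} (hC : Cvx C) (hD : Cvx D) : C ≤ D ∨ D ≤ C := by
  by_contra h
  push Not at h
  obtain ⟨c, hc, hc'⟩ := SetLike.not_le_iff_exists.1 h.1
  obtain ⟨d, hd, hd'⟩ := SetLike.not_le_iff_exists.1 h.2
  have pos : ∀ (A B : Subgroup G) (x : G), x ∈ A → x ∉ B → ∃ y, y ∈ A ∧ y ∉ B ∧ 1 ≤ y := by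
    intro A B x hx hx'
    rcases le_or_gt 1 x with h | h
    · exact ⟨x, hx, hx', h⟩
    · exact ⟨x⁻¹, A.inv_mem hx, by simpa using hx', (hg.inv1 h).le⟩
  obtain ⟨c, hc, hc', c1⟩ := pos C D c hc hc'
  obtain ⟨d, hd, hd', d1⟩ := pos D C d hd hd'
  rcases le_total c d with h | h
  · exact hc' (hD 1 D.one_mem d hd c c1 h)
  · exact hd' (hC 1 C.one_mem c hc d d1 h)

lemma sign_mul (hg : Good G e) {C : Subgroup G} (hC : Cvx C) {c h : G} (hc : c ∈ C) (hh : h ∉ C)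
    (h1 : 1 < h) : 1 < c * h ∧ 1 < h * c := by
  constructor
  · by_contra hn
    have := hg.l c⁻¹ _ _ (not_lt.1 hn)
    simp at this
    exact hh (hC 1 C.one_mem c⁻¹ (C.inv_mem hc) h h1.le this)
  · by_contra hn
    have := hg.l h⁻¹ _ _ (not_lt.1 hn)
    simp at this
    have h2 := hC c hc 1 C.one_mem h⁻¹ this (hg.inv2 h1).le
    exact hh (by simpa using h2)

lemma sign_mul' (hg : Good G e) {C : Subgroup G} (hC : Cvx C) {c h : G} (hc : c ∈ C) (hh : h ∉ C)
    (h1 : h < 1) : c * h < 1 ∧ h * c < 1 := by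
  have := sign_mul hg hC (C.inv_mem hc) (h := h⁻¹) (by simpa using hh) (hg.inv1 h1)
  constructor
  · have := hg.inv2 this.2
    simpa using this
  · have := hg.inv2 this.1
    simpa using this

/-- Flipped orders. -/
lemma flip_cone (hg : Good G e) (S : Set (Subgroup G)) :
    IsLeftOrderCone {g : G | (Bs hg g ∉ S ∧ 1 < g) ∨ (Bs hg g ∈ S ∧ g < 1)} := by
  have hinv : ∀ g : G, Bs hg g⁻¹ = Bs hg g := fun g => le_antisymm
    (Bs_le_of_mem hg (Bs_cvx hg g) ((Bs hg g).inv_mem (self_mem hg g)))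
    (Bs_le_of_mem hg (Bs_cvx hg _) (by simpa using (Bs hg g⁻¹).inv_mem (self_mem hg g⁻¹)))
  -- product with strictly smaller
  have hsm : ∀ g h : G, h ∉ Bs hg g → Bs hg (g * h) = Bs hg h ∧ Bs hg (h * g) = Bs hg h := by
    intro g h hh
    have hgh : g ∈ Bs hg h := by
      rcases cvx_chain hg (Bs_cvx hg g) (Bs_cvx hg h) with h1 | h1
      · exact h1 (self_mem hg g)
      · exact absurd (h1 (self_mem hg h)) hh
    have aux : ∀ z : G, z ∈ Bs hg h → z ∉ Bs hg g → (g ∈ Bs hg z → h ∈ Bs hg z) →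
        Bs hg z = Bs hg h := by
      intro z h1 h2 h3
      refine le_antisymm (Bs_le_of_mem hg (Bs_cvx hg h) h1) (Bs_le_of_mem hg (Bs_cvx hg z) (h3 ?_))
      rcases cvx_chain hg (Bs_cvx hg g) (Bs_cvx hg z) with h4 | h4
      · exact h4 (self_mem hg g)
      · exact absurd (h4 (self_mem hg z)) h2
    constructor
    · refine aux _ ((Bs hg h).mul_mem hgh (self_mem hg h)) ?_ ?_
      · rwa [Subgroup.mul_mem_cancel_left _ (self_mem hg g)]
      · intro h1
        exact (Subgroup.mul_mem_cancel_left _ h1).1 (self_mem hg (g * h))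
    · refine aux _ ((Bs hg h).mul_mem (self_mem hg h) hgh) ?_ ?_
      · rwa [Subgroup.mul_mem_cancel_right _ (self_mem hg g)]
      · intro h1
        exact (Subgroup.mul_mem_cancel_right _ h1).1 (self_mem hg (h * g))
  apply cone_mk
  · rintro (⟨_, h⟩ | ⟨_, h⟩) <;> exact lt_irrefl _ h
  · intro a ha b hb
    by_cases hab : b ∈ Bs hg a
    · by_cases hba : a ∈ Bs hg b
      · have heq : Bs hg a = Bs hg b := le_antisymm (Bs_le_of_mem hg (Bs_cvx hg b) hba)
          (Bs_le_of_mem hg (Bs_cvx hg a) hab)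
        have hle : Bs hg (a * b) ≤ Bs hg a :=
          Bs_le_of_mem hg (Bs_cvx hg a) ((Bs hg a).mul_mem (self_mem hg a) hab)
        rcases ha with ⟨ha, ha1⟩ | ⟨ha, ha1⟩ <;> rcases hb with ⟨hb, hb1⟩ | ⟨hb, hb1⟩
        · have h2 : a ≤ a * b := by simpa using hg.l a _ _ hb1.le
          have : Bs hg (a * b) = Bs hg a := le_antisymm hle (Bs_le_of_mem hg (Bs_cvx hg _)
            (Bs_cvx hg (a * b) 1 (Subgroup.one_mem _) _ (self_mem hg _) a ha1.le h2))
          exact Or.inl ⟨by rwa [this], ha1.trans_le h2⟩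
        · rw [heq] at ha; exact absurd hb ha
        · rw [heq] at ha; exact absurd ha hb
        · have h2 : a * b ≤ a := by simpa using hg.l a _ _ hb1.le
          have : Bs hg (a * b) = Bs hg a := le_antisymm hle (Bs_le_of_mem hg (Bs_cvx hg _)
            (Bs_cvx hg (a * b) _ (self_mem hg _) 1 (Subgroup.one_mem _) a h2 ha1.le))
          exact Or.inr ⟨by rwa [this], h2.trans_lt ha1⟩
      · have h1 := (hsm b a hba).2
        rcases ha with ⟨ha, ha1⟩ | ⟨ha, ha1⟩
        · exact Or.inl ⟨by rwa [h1], (sign_mul hg (Bs_cvx hg b) (self_mem hg b) hba ha1).2⟩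
        · exact Or.inr ⟨by rwa [h1], (sign_mul' hg (Bs_cvx hg b) (self_mem hg b) hba ha1).2⟩
    · have h1 := (hsm a b hab).1
      rcases hb with ⟨hb, hb1⟩ | ⟨hb, hb1⟩
      · exact Or.inl ⟨by rwa [h1], (sign_mul hg (Bs_cvx hg a) (self_mem hg a) hab hb1).1⟩
      · exact Or.inr ⟨by rwa [h1], (sign_mul' hg (Bs_cvx hg a) (self_mem hg a) hab hb1).1⟩
  · intro g hg1
    simp only [Set.mem_ofPred_eq, hinv]
    by_cases hS : Bs hg g ∈ S
    · rcases lt_or_gt_of_ne hg1 with h | h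
      · exact Or.inl (Or.inr ⟨hS, h⟩)
      · exact Or.inr (Or.inr ⟨hS, hg.inv2 h⟩)
    · rcases lt_or_gt_of_ne hg1 with h | h
      · exact Or.inr (Or.inl ⟨hS, hg.inv1 h⟩)
      · exact Or.inl (Or.inl ⟨hS, h⟩)

lemma classes_finite (hg : Good G e) (hc : (LO G).Countable) : (Set.range (Bs hg)).Finite := by
  let ι := {C : Subgroup G // ∃ g, g ≠ 1 ∧ Bs hg g = C}
  have hι : Finite ι := by
    by_contra hinf
    have : Infinite ι := not_finite_iff_infinite.1 hinf
    have : Uncountable (Set ι) := by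
      rw [← Cardinal.aleph0_lt_mk_iff, Cardinal.mk_set]
      exact (Cardinal.aleph0_le_mk ι).trans_lt (Cardinal.cantor _)
    refine uncountable_of_inj (fun S : Set ι =>
      {g : G | (Bs hg g ∉ Subtype.val '' S ∧ 1 < g) ∨ (Bs hg g ∈ Subtype.val '' S ∧ g < 1)})
      (fun S => flip_cone hg _) ?_ hc
    intro S T hST
    ext ⟨C, g, hg1, rfl⟩
    have h := Set.ext_iff.1 hST g
    simp only [Set.mem_ofPred_eq] at h
    have e : ∀ S : Set ι, Bs hg g ∈ Subtype.val '' S ↔ (⟨Bs hg g, g, hg1, rfl⟩ : ι) ∈ S := by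
      intro S
      constructor
      · rintro ⟨x, hx, hx'⟩
        have : x = ⟨Bs hg g, g, hg1, rfl⟩ := Subtype.ext hx'
        rwa [← this]
      · intro h; exact ⟨_, h, rfl⟩
    rw [e, e] at h
    rcases lt_or_gt_of_ne hg1 with h' | h'
    · simpa [h', h'.not_gt] using h
    · have := not_iff_not.1 (by simpa [h', h'.not_gt] using h)
      exact this
  have : (Set.range (Subtype.val : ι → Subgroup G)).Finite := Set.finite_range _
  refine (this.insert (Bs hg 1)).subset ?_
  rintro _ ⟨g, rfl⟩
  by_cases h : g = 1
  · left; rw [h]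
  · right; exact ⟨⟨_, g, h, rfl⟩, rfl⟩

lemma exists_c (hg : Good G e) (hc : (LO G).Countable) :
    ∃ n : ℕ, ∃ c : G → ℕ, (∀ g, c g < n) ∧ ∀ g h, c h ≤ c g → Bd e g h := by
  have hf := classes_finite hg hc
  refine ⟨(Set.range (Bs hg)).ncard + 1, fun g => {C ∈ Set.range (Bs hg) | C < Bs hg g}.ncard,
    fun g => Nat.lt_succ_of_le (Set.ncard_le_ncard (fun x hx => hx.1) hf), fun g h hle => ?_⟩
  by_contra hn
  have hn' : h ∉ Bs hg g := hn
  refine absurd hle (not_le.2 ?_)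
  have hlt : Bs hg g < Bs hg h := by
    rcases cvx_chain hg (Bs_cvx hg g) (Bs_cvx hg h) with h1 | h1
    · exact lt_of_le_of_ne h1 fun h2 => hn' (by rw [h2]; exact self_mem hg h)
    · exact absurd (h1 (self_mem hg h)) hn'
  refine Set.ncard_lt_ncard ?_ (hf.subset fun x hx => hx.1)
  refine ⟨fun x hx => ⟨hx.1, hx.2.trans hlt⟩, fun hh => ?_⟩
  have : Bs hg g ∈ {C ∈ Set.range (Bs hg) | C < Bs hg g} := hh ⟨⟨g, rfl⟩, hlt⟩
  exact lt_irrefl _ this.2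

end Convex

section Mono
variable {G : Type*} [Group G]

/-- `Bd` in terms of the cone. -/
def BdP (P : Set G) (e : ℕ) (f g : G) : Prop := ∃ n : ℤ,
  ((f ^ e) ^ (-n) = g ∨ ((f ^ e) ^ (-n))⁻¹ * g ∈ P) ∧ (g = (f ^ e) ^ n ∨ g⁻¹ * (f ^ e) ^ n ∈ P)

lemma FO.good {P : Set G} {H : Subgroup G} {e : ℕ} (h : FO P H e) :
    letI := coneOrder h.cone
    Good G e := by
  letI := coneOrder h.cone
  refine ⟨?_, h.epos, ?_⟩
  · rintro a x y (rfl | hxy)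
    · exact le_rfl
    · exact (cone_leftStrict h.cone a x y hxy).le
  · rintro g x y (rfl | hxy)
    · exact le_rfl
    · right
      have := h.conj _ (h.pow_mem g) _ hxy
      simpa [mul_assoc] using this

lemma FO.exists_c {P : Set G} {H : Subgroup G} {e : ℕ} (h : FO P H e) (hc : (LO G).Countable) :
    ∃ n : ℕ, ∃ c : G → ℕ, (∀ g, c g < n) ∧ ∀ g h, c h ≤ c g → BdP P e g h := by
  letI := coneOrder h.cone
  exact Linnell.exists_c h.good hc

lemma exists_max {n : ℕ} {c : G → ℕ} (h : ∀ g, c g < n) : ∃ f, ∀ g, c g ≤ c f := by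
  have : (Set.range c).Finite := (Set.finite_lt_nat n).subset (by rintro _ ⟨g, rfl⟩; exact h g)
  obtain ⟨_, ⟨f, rfl⟩, hf⟩ := Set.exists_max_image (Set.range c) id this ⟨_, 1, rfl⟩
  exact ⟨f, fun g => hf _ ⟨g, rfl⟩⟩

lemma FO.mono_hom [Nontrivial G] {P : Set G} {H : Subgroup G} {e : ℕ} (h : FO P H e) (f : G)
    (hf : ∀ g, BdP P e f g) : ∃ τ : G → ℝ, Hm τ ∧ (∀ g ∈ P, 0 ≤ τ g) ∧ τ f ≠ 0 := by
  letI := coneOrder h.cone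
  have hR : ∀ k ∈ H, ∀ x y : G, x < y → x * k < y * k := by
    intro k hk x y hxy
    have := h.conj _ hk _ hxy
    change (x * k)⁻¹ * (y * k) ∈ P
    simpa [mul_assoc] using this
  have hb : ∀ g, ∃ n : ℤ, (f ^ e) ^ (-n) ≤ g ∧ g ≤ (f ^ e) ^ n := hf
  have hne : f ^ e ≠ 1 := by
    intro h1
    obtain ⟨x, hx⟩ := exists_ne (1 : G)
    obtain ⟨n, h2, h3⟩ := hb x
    rw [h1] at h2 h3
    simp at h2 h3
    exact hx (le_antisymm h3 h2)
  have main : ∀ F ∈ H, 1 < F → (∀ g : G, ∃ n : ℤ, F ^ (-n) ≤ g ∧ g ≤ F ^ n) →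
      ∃ τ : G → ℝ, Hm τ ∧ (∀ g ∈ P, 0 ≤ τ g) ∧ τ F ≠ 0 := by
    intro F hF hF1 hcof
    obtain ⟨τ, h1, h2, h3⟩ := exists_hom (cone_leftStrict h.cone) H h.normal h.fin hR F hF hF1 e
      h.epos h.pow_mem hcof
    exact ⟨τ, h1, fun g hg => h2 g (Or.inr (by simpa using hg)), h3⟩
  rcases lt_or_gt_of_ne hne with h1 | h1
  · obtain ⟨τ, h2, h3, h4⟩ := main (f ^ e)⁻¹ (H.inv_mem (h.pow_mem f)) (h.good.inv1 h1) (by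
      intro g
      obtain ⟨n, h2, h3⟩ := hb g
      exact ⟨-n, by simpa using h2, by simpa using h3⟩)
    refine ⟨τ, h2, h3, fun h5 => h4 ?_⟩
    rw [h2.inv, h2.pow, h5]; simp
  · obtain ⟨τ, h2, h3, h4⟩ := main (f ^ e) (h.pow_mem f) h1 hb
    refine ⟨τ, h2, h3, fun h5 => h4 ?_⟩
    rw [h2.pow, h5]; simp

lemma mono_hom_of_finite [Nontrivial G] (hfin : (LO G).Finite) {P : Set G}
    (hP : IsLeftOrderCone P) : ∃ τ : G → ℝ, Hm τ ∧ (∀ g ∈ P, 0 ≤ τ g) ∧ ∃ f, τ f ≠ 0 := by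
  obtain ⟨H, e, h⟩ := FO_of_LO_finite hfin hP
  obtain ⟨n, c, h1, h2⟩ := h.exists_c hfin.countable
  obtain ⟨f, hf⟩ := exists_max h1
  obtain ⟨τ, h3, h4, h5⟩ := h.mono_hom f fun g => h2 f g (hf g)
  exact ⟨τ, h3, h4, f, h5⟩

end Mono
end Linnell

namespace Linnell
section Step
variable {G : Type*} [Group G]

lemma cone_pow {Q : Set G} (hQ : IsLeftOrderCone Q) {g : G} (hg : g ∈ Q) (k : ℕ) (hk : 0 < k) :
    g ^ k ∈ Q := by
  induction k with
  | zero => omega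
  | succ k ih =>
    rcases Nat.eq_zero_or_pos k with rfl | h
    · simpa using hg
    · rw [pow_succ]; exact hQ.2.1 _ (ih h) _ hg

lemma cone_zpow {Q : Set G} (hQ : IsLeftOrderCone Q) {g : G} (hg : g ∈ Q) (l : ℤ) :
    g ^ l ∈ Q ↔ 0 < l := by
  have pos : ∀ l : ℤ, 0 < l → g ^ l ∈ Q := by
    intro l hl
    obtain ⟨k, rfl⟩ := Int.eq_ofNat_of_zero_le hl.le
    rw [zpow_natCast]
    exact cone_pow hQ hg k (by exact_mod_cast hl)
  refine ⟨fun h => ?_, pos l⟩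
  by_contra hl
  rcases (not_lt.1 hl).eq_or_lt with h0 | h0
  · rw [h0, zpow_zero] at h; exact hQ.1 h
  · have := pos (-l) (by omega)
    rw [zpow_neg] at this
    exact cone_anti hQ h this

/-- Relative convexity of the kernel of `φ`. -/
def KC (φ : G → ℝ) (Q : Set G) : Prop := ∀ g ∈ Q, φ g ≠ 0 → ∀ h, φ h = 0 → h⁻¹ * g ∈ Q

lemma KC_zpow {φ : G → ℝ} (hφ : Hm φ) {Q : Set G} (hQ : IsLeftOrderCone Q) (hK : KC φ Q)
    {g t : G} (hg : g ∈ Q) (hgφ : φ g ≠ 0) (k : ℕ) (hk : 0 < k) (l : ℤ)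
    (hkl : k * φ g = l * φ t) : t ^ l ∈ Q := by
  have hk' : (k : ℝ) ≠ 0 := by exact_mod_cast hk.ne'
  have hlt : (l : ℝ) * φ t ≠ 0 := by rw [← hkl]; exact mul_ne_zero hk' hgφ
  have hne : t ^ l ≠ 1 := fun h => hlt (by rw [← hφ.zpow, h, hφ.one])
  refine (cone_total hQ _ hne).resolve_right fun hu => ?_
  have h1 := hK _ hu (by rw [hφ.inv, hφ.zpow]; exact neg_ne_zero.2 hlt) ((t ^ l)⁻¹ * g ^ k)
    (by rw [hφ, hφ.inv, hφ.zpow, hφ.pow]; linarith)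
  have h2 := hQ.2.1 _ (cone_pow hQ hg k hk) _ h1
  apply hQ.1
  simpa [mul_assoc] using h2

lemma restrict_cone {Q : Set G} (hQ : IsLeftOrderCone Q) (N : Subgroup G) :
    IsLeftOrderCone (Subtype.val ⁻¹' Q : Set N) := by
  apply cone_mk
  · simpa using hQ.1
  · intro a ha b hb; exact hQ.2.1 _ ha _ hb
  · intro g hg
    exact cone_total hQ (g : G) (by simpa using hg)

lemma finite_of_KC {φ : G → ℝ} (hφ : Hm φ) (t : G) (hc : (LO G).Countable) (ht : φ t ≠ 0)
    (hN : (LO hφ.ker).Finite) (hK : ∀ Q ∈ LO G, KC φ Q) : (LO G).Finite := by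
  let f : Set G → Set hφ.ker × Prop := fun Q => (Subtype.val ⁻¹' Q, t ∈ Q)
  refine Set.Finite.of_finite_image (f := f) ((hN.prod (Set.finite_univ (α := Prop))).subset ?_) ?_
  · rintro _ ⟨Q, hQ, rfl⟩
    exact ⟨restrict_cone hQ _, trivial⟩
  · have key : ∀ Q ∈ LO G, ∀ Q' ∈ LO G, f Q = f Q' → Q ⊆ Q' := by
      intro Q hQ Q' hQ' hf g hg
      have h1 : (Subtype.val ⁻¹' Q : Set hφ.ker) = Subtype.val ⁻¹' Q' := congrArg Prod.fst hf
      have h2 : t ∈ Q ↔ t ∈ Q' := iff_of_eq (congrArg Prod.snd hf)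
      by_cases hgφ : φ g = 0
      · have : (⟨g, hgφ⟩ : hφ.ker) ∈ (Subtype.val ⁻¹' Q : Set hφ.ker) := hg
        rw [h1] at this; exact this
      · have hg1 : g ≠ 1 := fun h => hgφ (by rw [h, hφ.one])
        refine (cone_total hQ' g hg1).resolve_right fun hg' => ?_
        obtain ⟨k, hk, l, hkl⟩ := rank_one hQ hc hφ t ht g
        have a1 := KC_zpow hφ hQ (hK Q hQ) hg hgφ k hk l hkl
        have a2 := KC_zpow hφ hQ' (hK Q' hQ') hg' (t := t)
          (by rw [hφ.inv]; exact neg_ne_zero.2 hgφ) k hk (-l)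
          (by rw [hφ.inv]; push_cast; linarith)
        have ht1 : t ≠ 1 := fun h => ht (by rw [h, hφ.one])
        rcases cone_total hQ t ht1 with h3 | h3
        · have b1 := (cone_zpow hQ h3 l).1 a1
          have b2 := (cone_zpow hQ' (h2.1 h3) (-l)).1 a2
          omega
        · have h4 : t⁻¹ ∈ Q' := by
            refine (cone_total hQ' t ht1).resolve_left fun h => ?_
            exact cone_anti hQ (h2.2 h) h3
          have b1 := (cone_zpow hQ h3 (-l)).1 (by simpa using a1)
          have b2 := (cone_zpow hQ' h4 l).1 (by simpa using a2)
          omega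
    intro Q hQ Q' hQ' hf
    exact Set.Subset.antisymm (key Q hQ Q' hQ' hf) (key Q' hQ' Q hQ hf.symm)

/-- Case A for a positive `t`. -/
lemma caseA_pos {Q : Set G} (hQ : IsLeftOrderCone Q) {φ Ψ lam : G → ℝ} (hφ : Hm φ)
    (hΨ : ∀ x y, φ x = 0 → φ y = 0 → Ψ (x * y) = Ψ x + Ψ y)
    (hmono : ∀ n, φ n = 0 → 0 < Ψ n → n ∈ Q) (n0 : G) (hn0 : φ n0 = 0) (hn0' : Ψ n0 ≠ 0)
    (hconj : ∀ x n, φ n = 0 → Ψ (x * n * x⁻¹) = lam x * Ψ n) (t : G) (ht : lam t⁻¹ < 0)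
    (htQ : t ∈ Q) (hφt : φ t ≠ 0)
    (hrank : ∀ g, ∃ k : ℕ, 0 < k ∧ ∃ l : ℤ, k * φ g = l * φ t) : KC φ Q := by
  have Ψ1 : Ψ 1 = 0 := by have := hΨ 1 1 hφ.one hφ.one; simp at this; exact this
  have Ψinv : ∀ x, φ x = 0 → Ψ x⁻¹ = - Ψ x := by
    intro x hx
    have := hΨ x x⁻¹ hx (by rw [hφ.inv, hx, neg_zero])
    rw [mul_inv_cancel, Ψ1] at this; linarith
  have Ψpow : ∀ x, φ x = 0 → ∀ j : ℕ, Ψ (x ^ j) = j * Ψ x := by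
    intro x hx j
    induction j with
    | zero => simp [Ψ1]
    | succ j ih => rw [pow_succ, hΨ _ _ (by rw [hφ.pow, hx, mul_zero]) hx, ih]; push_cast; ring
  have T0 : ∀ h, φ h = 0 → 0 < Ψ h → h⁻¹ * t ∈ Q := by
    intro h hh hp
    have hi : φ h⁻¹ = 0 := by rw [hφ.inv, hh, neg_zero]
    have h1 : Ψ (t⁻¹ * h⁻¹ * t) = lam t⁻¹ * Ψ h⁻¹ := by
      have := hconj t⁻¹ h⁻¹ hi; simpa using this
    have h2 : t⁻¹ * h⁻¹ * t ∈ Q := by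
      apply hmono
      · rw [hφ, hφ, hφ.inv, hi]; ring
      · rw [h1, Ψinv h hh]; nlinarith
    have := hQ.2.1 _ htQ _ h2
    simpa [mul_assoc] using this
  have hbig : ∀ r : ℝ, ∃ p, φ p = 0 ∧ r < Ψ p := by
    intro r
    have pos : ∀ m, φ m = 0 → 0 < Ψ m → ∃ p, φ p = 0 ∧ r < Ψ p := by
      intro m hm hm'
      obtain ⟨j, hj⟩ := Archimedean.arch (r + 1) hm'
      refine ⟨m ^ j, by rw [hφ.pow, hm, mul_zero], ?_⟩
      rw [Ψpow m hm]
      simp only [nsmul_eq_mul] at hj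
      linarith
    rcases lt_or_gt_of_ne hn0' with h | h
    · exact pos n0⁻¹ (by rw [hφ.inv, hn0, neg_zero]) (by rw [Ψinv _ hn0]; linarith)
    · exact pos n0 hn0 h
  have T : ∀ h, φ h = 0 → h⁻¹ * t ∈ Q := by
    intro h hh
    obtain ⟨p, hp, hp'⟩ := hbig |Ψ h|
    have h0 := abs_nonneg (Ψ h)
    have h1 := neg_abs_le (Ψ h)
    have a1 := T0 (h * p) (by rw [hφ, hh, hp, add_zero]) (by rw [hΨ _ _ hh hp]; linarith)
    have a2 := hQ.2.1 _ (hmono p hp (by linarith)) _ a1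
    simpa [mul_assoc] using a2
  have Tl : ∀ l : ℤ, 0 < l → ∀ h, φ h = 0 → h⁻¹ * t ^ l ∈ Q := by
    intro l hl h hh
    rcases (show 1 ≤ l by omega).eq_or_lt with h1 | h1
    · rw [← h1, zpow_one]; exact T h hh
    · have := hQ.2.1 _ (T h hh) _ ((cone_zpow hQ htQ (l - 1)).2 (by omega))
      rw [mul_assoc, ← zpow_one_add] at this
      simpa using this
  intro g hg hgφ h hh
  have hne : h⁻¹ * g ≠ 1 := fun h' => hgφ (by
    have := congrArg φ h'
    rw [hφ, hφ.inv, hh, hφ.one] at this; linarith)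
  refine (cone_total hQ _ hne).resolve_right fun hgh => ?_
  rw [mul_inv_rev, inv_inv] at hgh
  have hj : ∀ j : ℕ, ∃ d, φ d = 0 ∧ (g ^ (j + 1))⁻¹ * d ∈ Q := by
    intro j
    induction j with
    | zero => exact ⟨h, hh, by simpa using hgh⟩
    | succ j ih =>
      obtain ⟨d, hd, hd'⟩ := ih
      refine ⟨g * d * g⁻¹ * h, by rw [hφ, hφ, hφ, hφ.inv, hd, hh]; ring, ?_⟩
      have := hQ.2.1 _ hd' _ hgh
      rw [pow_succ' g (j + 1)]
      simpa [mul_assoc] using this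
  obtain ⟨k, hk, l, hkl⟩ := hrank g
  obtain ⟨d, hd, hd'⟩ := hj (k - 1)
  rw [Nat.sub_add_cancel hk] at hd'
  have hk' : (k : ℝ) ≠ 0 := by exact_mod_cast hk.ne'
  have hl0 : l ≠ 0 := by
    rintro rfl
    rw [Int.cast_zero, zero_mul] at hkl
    exact (mul_ne_zero hk' hgφ) hkl
  rcases lt_or_gt_of_ne hl0 with hl | hl
  · have a1 := Tl (-l) (by omega) (t ^ (-l) * g ^ k)
      (by rw [hφ, hφ.zpow, hφ.pow]; push_cast; linarith)
    have a2 := hQ.2.1 _ (cone_pow hQ hg k hk) _ a1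
    apply hQ.1
    simpa [mul_assoc] using a2
  · have a1 := Tl l hl (t ^ l * (g ^ k)⁻¹ * d)
      (by rw [hφ, hφ, hφ.inv, hφ.zpow, hφ.pow, hd]; linarith)
    have a2 := hQ.2.1 _ hd' _ a1
    apply hQ.1
    simpa [mul_assoc] using a2

lemma caseB2 {P : Set G} (hP : IsLeftOrderCone P) {φ Ψ lam : G → ℝ} (hφ : Hm φ)
    (hΨ : ∀ x y, φ x = 0 → φ y = 0 → Ψ (x * y) = Ψ x + Ψ y)
    (n0 : G) (hn0 : φ n0 = 0) (hn0' : Ψ n0 ≠ 0)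
    (hconj : ∀ x n, φ n = 0 → Ψ (x * n * x⁻¹) = lam x * Ψ n)
    (hlam : ∀ x y, lam (x * y) = lam x * lam y) (hpos : ∀ x, 0 < lam x)
    (hlam1 : ∀ n, φ n = 0 → lam n = 1) (t : G) (ht : 1 < lam t) : ¬ (LO G).Countable := by
  have Ψ1 : Ψ 1 = 0 := by have := hΨ 1 1 hφ.one hφ.one; simp at this; exact this
  have Ψinv : ∀ x, φ x = 0 → Ψ x⁻¹ = - Ψ x := by
    intro x hx
    have := hΨ x x⁻¹ hx (by rw [hφ.inv, hx, neg_zero])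
    rw [mul_inv_cancel, Ψ1] at this; linarith
  have Ψpow : ∀ x, φ x = 0 → ∀ j : ℕ, Ψ (x ^ j) = j * Ψ x := by
    intro x hx j
    induction j with
    | zero => simp [Ψ1]
    | succ j ih => rw [pow_succ, hΨ _ _ (by rw [hφ.pow, hx, mul_zero]) hx, ih]; push_cast; ring
  have Ψzpow : ∀ x, φ x = 0 → ∀ j : ℤ, Ψ (x ^ j) = j * Ψ x := by
    intro x hx j
    obtain ⟨m, rfl | rfl⟩ := j.eq_nat_or_neg
    · simp [Ψpow x hx]
    · rw [zpow_neg, Ψinv _ (by rw [hφ.zpow, hx, mul_zero]), zpow_natCast, Ψpow x hx]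
      push_cast; ring
  have hd : 1 - lam t ≠ 0 := by linarith
  let b : G → ℝ := fun x => Ψ (x * t * x⁻¹ * t⁻¹) / (1 - lam t)
  have φc : ∀ x, φ (x * t * x⁻¹ * t⁻¹) = 0 := by
    intro x; rw [hφ, hφ, hφ, hφ.inv, hφ.inv]; ring
  have hb : ∀ x y, b (x * y) = b x + lam x * b y := by
    intro x y
    have e : x * y * t * (x * y)⁻¹ * t⁻¹ =
      (x * (y * t * y⁻¹ * t⁻¹) * x⁻¹) * (x * t * x⁻¹ * t⁻¹) := by group
    have e2 : φ (x * (y * t * y⁻¹ * t⁻¹) * x⁻¹) = 0 := by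
      rw [hφ, hφ, φc, hφ.inv]; ring
    simp only [b]
    rw [e, hΨ _ _ e2 (φc x), hconj _ _ (φc y)]
    ring
  have bn : ∀ n, φ n = 0 → b n = Ψ n := by
    intro n hn
    have hi : φ n⁻¹ = 0 := by rw [hφ.inv, hn, neg_zero]
    have e : n * t * n⁻¹ * t⁻¹ = n * (t * n⁻¹ * t⁻¹) := by group
    simp only [b]
    rw [e, hΨ _ _ hn (by rw [hφ, hφ, hφ.inv t, hi]; ring), hconj _ _ hi, Ψinv n hn,
      div_eq_iff hd]
    ring
  have bt : b t = 0 := by simp [b, Ψ1]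
  refine uncountable_of_sep (fun y x => lam x * y + b x - y) lam hP hpos ?_ ?_
  · intro y x x'
    simp only [hlam, hb]; ring
  · intro y y' hyy
    have hden : ∃ n, φ n = 0 ∧ y < Ψ n ∧ Ψ n < y' := by
      have hm : ∃ m, φ m = 0 ∧ 0 < Ψ m ∧ Ψ m < y' - y := by
        have main : ∀ m, φ m = 0 → 0 < Ψ m → ∃ m, φ m = 0 ∧ 0 < Ψ m ∧ Ψ m < y' - y := by
          intro m hm hm'
          have l1 : lam 1 = 1 := hlam1 1 hφ.one
          have lt : lam t * lam t⁻¹ = 1 := by rw [← hlam, mul_inv_cancel, l1]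
          have lt1 : lam t⁻¹ < 1 := by have := hpos t⁻¹; nlinarith
          obtain ⟨k, hk⟩ := exists_pow_lt_of_lt_one
            (show 0 < (y' - y) / Ψ m from div_pos (by linarith) hm') lt1
          have lk : ∀ k : ℕ, lam (t⁻¹ ^ k) = lam t⁻¹ ^ k := by
            intro k
            induction k with
            | zero => simp [l1]
            | succ k ih => rw [pow_succ, hlam, ih, pow_succ]
          refine ⟨t⁻¹ ^ k * m * (t⁻¹ ^ k)⁻¹, ?_, ?_, ?_⟩
          · rw [hφ, hφ, hm, hφ.inv]; ring
          · rw [hconj _ _ hm]; exact mul_pos (hpos _) hm'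
          · rw [hconj _ _ hm, lk]; rwa [lt_div_iff₀ hm'] at hk
        rcases lt_or_gt_of_ne hn0' with h | h
        · exact main n0⁻¹ (by rw [hφ.inv, hn0, neg_zero]) (by rw [Ψinv _ hn0]; linarith)
        · exact main n0 hn0 h
      obtain ⟨m, hm, hm1, hm2⟩ := hm
      refine ⟨m ^ (⌊y / Ψ m⌋ + 1), by rw [hφ.zpow, hm, mul_zero], ?_, ?_⟩
      · rw [Ψzpow m hm]
        have := Int.lt_floor_add_one (y / Ψ m)
        rw [div_lt_iff₀ hm1] at this
        push_cast; linarith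
      · rw [Ψzpow m hm]
        have := Int.floor_le (y / Ψ m)
        rw [le_div_iff₀ hm1] at this
        push_cast; linarith
    obtain ⟨n, hn, hn1, hn2⟩ := hden
    have hi : φ n⁻¹ = 0 := by rw [hφ.inv, hn, neg_zero]
    have e : ∀ y, lam (n * t * n⁻¹) * y + b (n * t * n⁻¹) - y = (lam t - 1) * (y - Ψ n) := by
      intro y
      rw [hb, hb, hlam, hlam, hlam1 n hn, hlam1 _ hi, bn n hn, bn _ hi, bt, Ψinv n hn]; ring
    refine ⟨n * t * n⁻¹, ?_, ?_⟩
    · simp only [e]; nlinarith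
    · simp only [e]; nlinarith

lemma caseB1 {φ Ψ : G → ℝ} (hφ : Hm φ)
    (hΨ : ∀ x y, φ x = 0 → φ y = 0 → Ψ (x * y) = Ψ x + Ψ y)
    (hconj : ∀ x n, φ n = 0 → Ψ (x * n * x⁻¹) = Ψ n)
    (hrank : ∀ t, φ t ≠ 0 → ∀ g, ∃ k : ℕ, 0 < k ∧ ∃ l : ℤ, k * φ g = l * φ t) :
    ∃ Φ : G → ℝ, Hm Φ ∧ ∀ n, φ n = 0 → Φ n = Ψ n := by
  have Ψ1 : Ψ 1 = 0 := by have := hΨ 1 1 hφ.one hφ.one; simp at this; exact this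
  have Ψinv : ∀ x, φ x = 0 → Ψ x⁻¹ = - Ψ x := by
    intro x hx
    have := hΨ x x⁻¹ hx (by rw [hφ.inv, hx, neg_zero])
    rw [mul_inv_cancel, Ψ1] at this; linarith
  have φc : ∀ x y, φ (x * y * x⁻¹ * y⁻¹) = 0 := by
    intro x y; rw [hφ, hφ, hφ, hφ.inv, hφ.inv]; ring
  have βm : ∀ y, Hm (fun x => Ψ (x * y * x⁻¹ * y⁻¹)) := by
    intro t x y
    have e : x * y * t * (x * y)⁻¹ * t⁻¹ =
      (x * (y * t * y⁻¹ * t⁻¹) * x⁻¹) * (x * t * x⁻¹ * t⁻¹) := by group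
    have e2 : φ (x * (y * t * y⁻¹ * t⁻¹) * x⁻¹) = 0 := by
      rw [hφ, hφ, φc, hφ.inv]; ring
    simp only
    rw [e, hΨ _ _ e2 (φc x t), hconj _ _ (φc y t)]
    ring
  have βn : ∀ n y, φ n = 0 → Ψ (n * y * n⁻¹ * y⁻¹) = 0 := by
    intro n y hn
    have hi : φ n⁻¹ = 0 := by rw [hφ.inv, hn, neg_zero]
    have e : n * y * n⁻¹ * y⁻¹ = n * (y * n⁻¹ * y⁻¹) := by group
    rw [e, hΨ _ _ hn (by rw [hφ, hφ, hφ.inv y, hi]; ring), hconj _ _ hi, Ψinv n hn]; ring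
  have β0 : ∀ x y, Ψ (x * y * x⁻¹ * y⁻¹) = 0 := by
    intro x y
    by_cases hy : φ y = 0
    · have h1 := βn y x hy
      have e : x * y * x⁻¹ * y⁻¹ = (y * x * y⁻¹ * x⁻¹)⁻¹ := by group
      rw [e, Ψinv _ (φc y x), h1, neg_zero]
    · obtain ⟨k, hk, l, hkl⟩ := hrank y hy x
      have hk' : (k : ℝ) ≠ 0 := by exact_mod_cast hk.ne'
      have h1 := (βm y).pow x k
      have h2 := (βm y).zpow y l
      have h3 := βm y (x ^ k * (y ^ l)⁻¹) (y ^ l)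
      have h4 := βn (x ^ k * (y ^ l)⁻¹) y (by rw [hφ, hφ.inv, hφ.pow, hφ.zpow]; linarith)
      simp only [inv_mul_cancel_right] at h3
      rw [h4, h2, h1] at h3
      simp [Ψ1] at h3
      exact h3.resolve_left hk.ne'
  have hcomm : ∀ x ∈ commutator G, φ x = 0 ∧ Ψ x = 0 := by
    let K : Subgroup G :=
      { carrier := {x | φ x = 0 ∧ Ψ x = 0}
        mul_mem' := by
          rintro a b ⟨h1, h2⟩ ⟨h3, h4⟩
          exact ⟨by rw [hφ, h1, h3, add_zero], by rw [hΨ _ _ h1 h3, h2, h4, add_zero]⟩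
        one_mem' := ⟨hφ.one, Ψ1⟩
        inv_mem' := by
          rintro a ⟨h1, h2⟩
          exact ⟨by rw [hφ.inv, h1, neg_zero], by rw [Ψinv _ h1, h2, neg_zero]⟩ }
    have : commutator G ≤ K := by
      rw [commutator_def, Subgroup.commutator_le]
      intro x _ y _
      exact ⟨φc x y, β0 x y⟩
    exact this
  let L : Subgroup (Abelianization G) := hφ.ker.map Abelianization.of
  have hwd : ∀ x y : G, φ x = 0 → φ y = 0 → Abelianization.of x = Abelianization.of y →
      Ψ x = Ψ y := by
    intro x y hx hy hxy
    have h1 : x⁻¹ * y ∈ commutator G := QuotientGroup.eq.1 hxy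
    have h2 := (hcomm _ h1).2
    have e : y = x * (x⁻¹ * y) := by group
    rw [e, hΨ _ _ hx (hcomm _ h1).1, h2, add_zero]
  have hch : ∀ a : L, ∃ x : G, φ x = 0 ∧ Abelianization.of x = (a : Abelianization G) := by
    rintro ⟨_, x, hx, rfl⟩
    exact ⟨x, hx, rfl⟩
  choose r hr1 hr2 using hch
  let g : Additive L →+ ℝ :=
    { toFun := fun a => Ψ (r a.toMul)
      map_zero' := by
        have := hwd (r (1 : L)) 1 (hr1 _) hφ.one (by rw [hr2]; simp)
        change Ψ (r 1) = 0
        rw [this, Ψ1]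
      map_add' := by
        intro a b
        change Ψ (r (a.toMul * b.toMul)) = Ψ (r a.toMul) + Ψ (r b.toMul)
        rw [← hΨ _ _ (hr1 _) (hr1 _)]
        refine hwd _ _ (hr1 _) (by rw [hφ, hr1, hr1, add_zero]) ?_
        rw [hr2, map_mul, hr2, hr2]; rfl }
  obtain ⟨F, hF⟩ := (Module.Baer.of_divisible ℝ).extension_property_addMonoidHom
    (MonoidHom.toAdditive L.subtype) (fun a b h => by
      exact L.subtype_injective h) g
  refine ⟨fun x => F (Additive.ofMul (Abelianization.of x)), ?_, ?_⟩
  · intro x y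
    simp only [map_mul, ofMul_mul, map_add]
  · intro n hn
    let a : L := ⟨Abelianization.of n, n, hn, rfl⟩
    have h1 : F (Additive.ofMul (Abelianization.of n)) = Ψ (r a) :=
      DFunLike.congr_fun hF (Additive.ofMul a)
    exact h1.trans (hwd _ _ (hr1 _) hn (hr2 a))

end Step
end Linnell

namespace Linnell
section Final
variable {G : Type*} [Group G]

lemma step {φ : G → ℝ} (hφ : Hm φ) (t0 : G) (ht0 : φ t0 ≠ 0) (hc : (LO G).Countable)
    (hN : (LO hφ.ker).Finite) : (LO G).Finite := by
  rcases (LO G).eq_empty_or_nonempty with h0 | ⟨P0, hP0⟩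
  · rw [h0]; exact Set.finite_empty
  rcases subsingleton_or_nontrivial hφ.ker with hs | hs
  · refine finite_of_KC hφ t0 hc ht0 hN fun Q hQ g hg _ h hh => ?_
    have : (⟨h, hh⟩ : hφ.ker) = 1 := Subsingleton.elim _ _
    have : h = 1 := congrArg Subtype.val this
    simpa [this] using hg
  have two : ∀ α β : G → ℝ, (∀ x y, φ x = 0 → φ y = 0 → α (x * y) = α x + α y) →
      (∀ x y, φ x = 0 → φ y = 0 → β (x * y) = β x + β y) → ∀ g h, φ g = 0 → φ h = 0 →
      α g * β h = α h * β g := by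
    intro α β hα hβ g h hg hh
    exact two_hom (restrict_cone hP0 hφ.ker) hN.countable (φ := fun x : hφ.ker => α x)
      (ψ := fun x : hφ.ker => β x) (fun x y => hα _ _ x.2 y.2) (fun x y => hβ _ _ x.2 y.2)
      ⟨g, hg⟩ ⟨h, hh⟩
  have ex : ∀ Q ∈ LO G, ∃ Ψ : G → ℝ, (∀ x y, φ x = 0 → φ y = 0 → Ψ (x * y) = Ψ x + Ψ y) ∧
      (∀ n, φ n = 0 → 0 < Ψ n → n ∈ Q) ∧ ∃ n0, φ n0 = 0 ∧ Ψ n0 ≠ 0 := by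
    classical
    intro Q hQ
    obtain ⟨ψ, h1, h2, f, hf⟩ := mono_hom_of_finite hN (restrict_cone hQ hφ.ker)
    have hv : ∀ n (hn : φ n = 0), (if h : φ n = 0 then ψ ⟨n, h⟩ else 0) = ψ ⟨n, hn⟩ :=
      fun n hn => dif_pos hn
    refine ⟨fun n => if h : φ n = 0 then ψ ⟨n, h⟩ else 0, ?_, ?_, f, f.2, ?_⟩
    · intro x y hx hy
      have hxy : φ (x * y) = 0 := by rw [hφ, hx, hy, add_zero]
      simp only [hv x hx, hv y hy, hv _ hxy]
      exact h1 ⟨x, hx⟩ ⟨y, hy⟩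
    · intro n hn hpos
      simp only [hv n hn] at hpos
      have hne : n ≠ 1 := by
        rintro rfl
        have : (⟨1, hn⟩ : hφ.ker) = 1 := rfl
        rw [this, h1.one] at hpos
        exact lt_irrefl _ hpos
      refine (cone_total hQ n hne).resolve_right fun h => ?_
      have h3 := h2 (⟨n, hn⟩ : hφ.ker)⁻¹ h
      rw [h1.inv] at h3
      linarith
    · simp only [hv f f.2]
      exact hf
  obtain ⟨Ψ, hΨ, hmono, n0, hn0, hn0'⟩ := ex P0 hP0
  have φc : ∀ x n, φ n = 0 → φ (x * n * x⁻¹) = 0 := by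
    intro x n hn; rw [hφ, hφ, hφ.inv, hn]; ring
  have Ψ1 : Ψ 1 = 0 := by have := hΨ 1 1 hφ.one hφ.one; simp at this; exact this
  have Ψinv : ∀ x, φ x = 0 → Ψ x⁻¹ = - Ψ x := by
    intro x hx
    have := hΨ x x⁻¹ hx (by rw [hφ.inv, hx, neg_zero])
    rw [mul_inv_cancel, Ψ1] at this; linarith
  obtain ⟨lam, hlamdef⟩ : ∃ lam : G → ℝ, ∀ x, lam x * Ψ n0 = Ψ (x * n0 * x⁻¹) :=
    ⟨fun x => Ψ (x * n0 * x⁻¹) / Ψ n0, fun x => div_mul_cancel₀ _ hn0'⟩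
  have hconj : ∀ x n, φ n = 0 → Ψ (x * n * x⁻¹) = lam x * Ψ n := by
    intro x n hn
    have h1 := two (fun n => Ψ (x * n * x⁻¹)) Ψ (fun a b ha hb => by
      have := hΨ _ _ (φc x a ha) (φc x b hb)
      rw [← this]; congr 1; group) hΨ n n0 hn hn0
    simp only [← hlamdef] at h1
    apply mul_right_cancel₀ hn0'
    rw [h1]; ring
  have hlam : ∀ x y, lam (x * y) = lam x * lam y := by
    intro x y
    apply mul_right_cancel₀ hn0'
    rw [hlamdef, mul_assoc (lam x), hlamdef, ← hconj x _ (φc y _ hn0)]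
    congr 1; group
  have hlam1 : ∀ n, φ n = 0 → lam n = 1 := by
    intro n hn
    apply mul_right_cancel₀ hn0'
    rw [hlamdef, hΨ _ _ (by rw [hφ, hn, hn0, add_zero]) (by rw [hφ.inv, hn, neg_zero]),
      hΨ _ _ hn hn0, Ψinv n hn]
    ring
  have hlaminv : ∀ x, lam x * lam x⁻¹ = 1 := by
    intro x; rw [← hlam, mul_inv_cancel, hlam1 1 hφ.one]
  have hlam0 : ∀ x, lam x ≠ 0 := fun x h => by
    have := hlaminv x; rw [h] at this; simp at this
  by_cases hneg : ∃ t, lam t < 0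
  · obtain ⟨t, ht⟩ := hneg
    have hφt : φ t ≠ 0 := fun h => by rw [hlam1 t h] at ht; linarith
    have ht' : lam t⁻¹ < 0 := by
      by_contra hh
      have := hlaminv t
      nlinarith
    refine finite_of_KC hφ t0 hc ht0 hN fun Q hQ => ?_
    obtain ⟨Ψ', hΨ', hmono', m0, hm0, hm0'⟩ := ex Q hQ
    have hconj' : ∀ x n, φ n = 0 → Ψ' (x * n * x⁻¹) = lam x * Ψ' n := by
      intro x n hn
      have h1 := two Ψ' Ψ hΨ' hΨ (x * n * x⁻¹) n0 (φc x n hn) hn0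
      have h2 := two Ψ' Ψ hΨ' hΨ n n0 hn hn0
      rw [hconj x n hn] at h1
      apply mul_right_cancel₀ hn0'
      linear_combination h1 - lam x * h2
    have ht1 : t ≠ 1 := fun h => hφt (by rw [h, hφ.one])
    have hφt' : φ t⁻¹ ≠ 0 := by rw [hφ.inv]; exact neg_ne_zero.2 hφt
    rcases cone_total hQ t ht1 with h | h
    · exact caseA_pos hQ hφ hΨ' hmono' m0 hm0 hm0' hconj' t ht' h hφt
        (rank_one hQ hc hφ t hφt)
    · exact caseA_pos hQ hφ hΨ' hmono' m0 hm0 hm0' hconj' t⁻¹ (by rwa [inv_inv]) h hφt'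
        (rank_one hQ hc hφ _ hφt')
  · push Not at hneg
    have hpos : ∀ x, 0 < lam x := fun x => lt_of_le_of_ne (hneg x) (hlam0 x).symm
    by_cases hone : ∀ x, lam x = 1
    · obtain ⟨Φ, hΦ, hΦ'⟩ := caseB1 hφ hΨ (fun x n hn => by rw [hconj x n hn, hone, one_mul])
        (fun t ht g => rank_one hP0 hc hφ t ht g)
      have := two_hom hP0 hc hφ hΦ t0 n0
      rw [hn0, zero_mul, hΦ' n0 hn0] at this
      exact absurd this (mul_ne_zero ht0 hn0')
    · push Not at hone
      obtain ⟨t, ht⟩ := hone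
      exfalso
      rcases lt_or_gt_of_ne ht with h | h
      · refine caseB2 hP0 hφ hΨ n0 hn0 hn0' hconj hlam hpos hlam1 t⁻¹ ?_ hc
        have := hlaminv t
        have := hpos t⁻¹
        nlinarith
      · exact caseB2 hP0 hφ hΨ n0 hn0 hn0' hconj hlam hpos hlam1 t h hc

lemma BdP_tau {P : Set G} {e : ℕ} {τ : G → ℝ} (hτ : Hm τ) (hp : ∀ g ∈ P, 0 ≤ τ g) {g f : G}
    (hg : τ g = 0) (h : BdP P e g f) : τ f = 0 := by
  obtain ⟨n, h1, h2⟩ := h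
  have hz : ∀ m : ℤ, τ ((g ^ e) ^ m) = 0 := fun m => by rw [hτ.zpow, hτ.pow, hg]; simp
  apply le_antisymm
  · rcases h2 with h | h
    · rw [h, hz]
    · have := hp _ h
      rw [hτ, hτ.inv, hz] at this; linarith
  · rcases h1 with h | h
    · rw [← h, hz]
    · have := hp _ h
      rw [hτ, hτ.inv, hz] at this; linarith

lemma countable_ker (hc : (LO G).Countable) {τ : G → ℝ} (hτ : Hm τ) : (LO hτ.ker).Countable := by
  refine Set.MapsTo.countable_of_injOn
    (f := fun Q : Set hτ.ker => {x : G | 0 < τ x ∨ τ x = 0 ∧ x ∈ Subtype.val '' Q}) ?_ ?_ hc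
  · intro Q hQ
    refine lexCone τ (fun _ => 1) _ (fun _ => one_pos) (fun x y => by rw [hτ, one_mul]) ?_ ?_ ?_
    · rintro ⟨x, hx, h⟩
      have : x = 1 := Subtype.ext h
      exact hQ.1 (this ▸ hx)
    · rintro _ _ - - ⟨a, ha, rfl⟩ ⟨b, hb, rfl⟩
      exact ⟨a * b, hQ.2.1 _ ha _ hb, rfl⟩
    · intro g hg hne
      rcases cone_total hQ (⟨g, hg⟩ : hτ.ker) (fun h => hne (congrArg Subtype.val h)) with h | h
      · exact Or.inl ⟨_, h, rfl⟩
      · exact Or.inr ⟨_, h, rfl⟩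
  · intro Q hQ Q' hQ' h
    have key : ∀ R : Set hτ.ker, ∀ x : hτ.ker,
        (x : G) ∈ {x : G | 0 < τ x ∨ τ x = 0 ∧ x ∈ Subtype.val '' R} ↔ x ∈ R := by
      intro R x
      have hx : τ x = 0 := x.2
      simp [hx]
    ext x
    rw [← key Q, ← key Q']
    exact iff_of_eq (congrArg (fun S : Set G => (x : G) ∈ S) h)

lemma main_ind (n : ℕ) : ∀ {G : Type*} [Group G] {P : Set G} {H : Subgroup G} {e : ℕ}
    (_ : FO P H e) (c : G → ℕ), (∀ g, c g < n) → (∀ g h, c h ≤ c g → BdP P e g h) →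
    (LO G).Countable → (LO G).Finite := by
  induction n with
  | zero => intro G _ P H e _ c hcn; exact absurd (hcn 1) (Nat.not_lt_zero _)
  | succ n ih =>
    intro G _ P H e hF c hcn hcB hc
    rcases subsingleton_or_nontrivial G with hs | hs
    · exact Set.toFinite _
    obtain ⟨f, hf⟩ := exists_max hcn
    obtain ⟨τ, hτ, hτp, hτf⟩ := hF.mono_hom f fun g => hcB f g (hf g)
    refine step hτ f hτf hc ?_
    have hnor := hF.normal
    have hfin := hF.fin
    have hF' : FO (Subtype.val ⁻¹' P : Set hτ.ker) (H.subgroupOf hτ.ker) e :=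
      { cone := restrict_cone hF.cone _
        normal := inferInstance
        fin := inferInstance
        epos := hF.epos
        pow_mem := fun g => hF.pow_mem g
        conj := fun h hh p hp => hF.conj _ hh _ hp }
    refine ih hF' (fun x => c x) ?_ ?_ (countable_ker hc hτ)
    · intro g
      have h1 : c g < c f := by
        by_contra hh
        exact hτf (BdP_tau hτ hτp g.2 (hcB g f (not_lt.1 hh)))
      have h2 := hcn f
      change c g < n
      omega
    · intro g h hgh
      obtain ⟨m, h1, h2⟩ := hcB g h hgh
      refine ⟨m, h1.imp (fun h => Subtype.ext ?_) id, h2.imp (fun h => Subtype.ext ?_) id⟩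
      · simpa using h
      · simpa using h

end Final
end Linnell

/-- Linnell: the set of left-orderings (positive cones) of any
group is either finite or uncountable; in particular it is never countably
infinite. -/
theorem leftOrderings_finite_or_uncountable (G : Type*) [Group G] :
    {P : Set G | IsLeftOrderCone P}.Finite ∨
      ¬ {P : Set G | IsLeftOrderCone P}.Countable := by
  by_cases hc : (Linnell.LO G).Countable
  · left
    rcases (Linnell.LO G).eq_empty_or_nonempty with h0 | h0
    · change (Linnell.LO G).Finite
      rw [h0]; exact Set.finite_empty
    · obtain ⟨P, H, e, hF⟩ := Linnell.exists_FO h0 hc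
      obtain ⟨n, c, h1, h2⟩ := hF.exists_c hc
      exact Linnell.main_ind n hF c h1 h2 hc
  · exact Or.inr hc
end
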